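/- arXiv:2605.03655 — 13 statements merged into one kernel-verified Lean document; each statement's English description precedes it below -/
import Mathlib

section
/- For every real number r with 0 < r < 1, the set ℤ((T))_{>r} is a subring of the ring of formal Laurent series over ℤ, and this subring is an integral domain in which every ideal is principal (i.e., it is a principal ideal domain). -/
open Filter

/-- The set `ℤ((T))_{>r}`: formal Laurent series over `ℤ` such that for some
`r < r' < 1` the coefficients satisfy `|aₙ|·(r')ⁿ → 0` as `n → ∞`. -/
def ZTgt (r : ℝ) : Set (LaurentSeries ℤ) :=
  {f | ∃ r' : ℝ, r < r' ∧ r' < 1 ∧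
    Tendsto (fun n : ℤ => |((f.coeff n : ℤ) : ℝ)| * r' ^ n) atTop (nhds 0)}

open PowerSeries in
/-- The subring of `K⟦X⟧` of series converging absolutely on a disc of radius larger than `r`. -/
def overconvergent (K : Type*) [NormedCommRing K] (r : ℝ) : Subring K⟦X⟧ where
  carrier := {f | ∃ ρ : ℝ, 0 < ρ ∧ r < ρ ∧ Summable fun n => ‖coeff n f‖ * ρ ^ n}
  mul_mem' := by
    rintro f g ⟨ρ, hρ, hrρ, hf⟩ ⟨σ, hσ, hrσ, hg⟩
    have hτ : 0 < min ρ σ := lt_min hρ hσ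
    refine ⟨min ρ σ, hτ, lt_min hrρ hrσ, ?_⟩
    have hf' : Summable fun n => ‖‖coeff n f‖ * min ρ σ ^ n‖ := by
      refine hf.of_nonneg_of_le (fun n => norm_nonneg _) fun n => ?_
      rw [Real.norm_of_nonneg (by positivity)]
      gcongr
      exact min_le_left _ _
    have hg' : Summable fun n => ‖‖coeff n g‖ * min ρ σ ^ n‖ := by
      refine hg.of_nonneg_of_le (fun n => norm_nonneg _) fun n => ?_
      rw [Real.norm_of_nonneg (by positivity)]
      gcongr
      exact min_le_right _ _
    refine (summable_norm_sum_mul_antidiagonal_of_summable_norm hf' hg').of_nonneg_of_le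
      (fun n => by positivity) fun n => ?_
    rw [Real.norm_of_nonneg (by positivity), coeff_mul]
    calc ‖∑ p ∈ Finset.HasAntidiagonal.antidiagonal n, coeff p.1 f * coeff p.2 g‖ * min ρ σ ^ n
        ≤ (∑ p ∈ Finset.HasAntidiagonal.antidiagonal n, ‖coeff p.1 f‖ * ‖coeff p.2 g‖) *
          min ρ σ ^ n := by
          gcongr
          exact (norm_sum_le _ _).trans (Finset.sum_le_sum fun p _ => norm_mul_le _ _)
      _ = _ := by
          rw [Finset.sum_mul]
          refine Finset.sum_congr rfl fun p hp => ?_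
          rw [← Finset.HasAntidiagonal.mem_antidiagonal.mp hp, pow_add]
          ring
  one_mem' := by
    refine ⟨max r 0 + 1, by positivity, by linarith [le_max_left r 0], ?_⟩
    refine summable_of_ne_finset_zero (s := {0}) fun n hn => ?_
    simp only [Finset.mem_singleton] at hn
    simp [coeff_one, hn]
  add_mem' := by
    rintro f g ⟨ρ, hρ, hrρ, hf⟩ ⟨σ, hσ, hrσ, hg⟩
    have hτ : 0 < min ρ σ := lt_min hρ hσ
    refine ⟨min ρ σ, hτ, lt_min hrρ hrσ, ?_⟩
    refine (hf.add hg).of_nonneg_of_le (fun n => by positivity) fun n => ?_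
    rw [map_add]
    calc ‖coeff n f + coeff n g‖ * min ρ σ ^ n
        ≤ ‖coeff n f‖ * min ρ σ ^ n + ‖coeff n g‖ * min ρ σ ^ n := by
          rw [← add_mul]
          gcongr
          exact norm_add_le _ _
      _ ≤ _ := by
          gcongr
          · exact min_le_left _ _
          · exact min_le_right _ _
  zero_mem' := ⟨max r 0 + 1, by positivity, by linarith [le_max_left r 0], by simp [summable_zero]⟩
  neg_mem' := by
    rintro f ⟨ρ, hρ, hrρ, hf⟩
    exact ⟨ρ, hρ, hrρ, by simpa using hf⟩

namespace overconvergent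

open PowerSeries

section General

variable {K L : Type*} [NormedCommRing K] [NormedCommRing L] {r : ℝ}

theorem of_norm_coeff_le {f : K⟦X⟧} {g : L⟦X⟧} (hf : f ∈ overconvergent K r)
    (h : ∀ n, ‖coeff n g‖ ≤ ‖coeff n f‖) : g ∈ overconvergent L r := by
  obtain ⟨ρ, hρ, hrρ, hf⟩ := hf
  refine ⟨ρ, hρ, hrρ, hf.of_nonneg_of_le (fun n => by positivity) fun n => ?_⟩
  gcongr
  exact h n

theorem of_bounded (hr0 : 0 < r) (hr1 : r < 1) {f : K⟦X⟧} (C : ℝ) (h : ∀ n, ‖coeff n f‖ ≤ C) :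
    f ∈ overconvergent K r := by
  obtain ⟨ρ, hrρ, hρ1⟩ := exists_between hr1
  have hρ : 0 < ρ := hr0.trans hrρ
  refine ⟨ρ, hρ, hrρ, ((summable_geometric_of_lt_one hρ.le hρ1).mul_left C).of_nonneg_of_le
    (fun n => by positivity) fun n => ?_⟩
  gcongr
  exact h n

theorem polynomial_mem (p : Polynomial K) : (p : K⟦X⟧) ∈ overconvergent K r := by
  refine ⟨max r 0 + 1, by positivity, by linarith [le_max_left r 0], ?_⟩
  refine summable_of_ne_finset_zero (s := p.support) fun n hn => ?_
  simp [Polynomial.notMem_support_iff.mp hn]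

theorem X_mem : (X : K⟦X⟧) ∈ overconvergent K r := by
  simpa using polynomial_mem (r := r) (Polynomial.X : Polynomial K)

theorem C_mem (a : K) : (C a : K⟦X⟧) ∈ overconvergent K r := by
  simpa using polynomial_mem (r := r) (Polynomial.C a : Polynomial K)

theorem of_X_pow_mul {f : K⟦X⟧} {k : ℕ} (h : X ^ k * f ∈ overconvergent K r) :
    f ∈ overconvergent K r := by
  obtain ⟨ρ, hρ, hrρ, h⟩ := h
  refine ⟨ρ, hρ, hrρ, ?_⟩
  have := ((summable_nat_add_iff k).mpr h).mul_right ((ρ ^ k)⁻¹)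
  refine this.congr fun n => ?_
  rw [coeff_X_pow_mul, pow_add]
  field_simp

end General

section Complex

variable {r : ℝ}

/-- The sum of a complex power series at a point. -/
noncomputable def sumAt (f : ℂ⟦X⟧) (z : ℂ) : ℂ := ∑' n, coeff n f * z ^ n

theorem summable_norm_coeff_mul_pow {f : ℂ⟦X⟧} {ρ : ℝ}
    (hf : Summable fun n => ‖coeff n f‖ * ρ ^ n) {z : ℂ} (hz : ‖z‖ ≤ ρ) :
    Summable fun n => ‖coeff n f * z ^ n‖ := by
  refine hf.of_nonneg_of_le (fun n => norm_nonneg _) fun n => ?_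
  rw [norm_mul, norm_pow]
  gcongr

theorem summable_of_mem {f : ℂ⟦X⟧} (hf : f ∈ overconvergent ℂ r) {z : ℂ} (hz : ‖z‖ ≤ r) :
    Summable fun n => ‖coeff n f * z ^ n‖ := by
  obtain ⟨ρ, -, hrρ, hf⟩ := hf
  exact summable_norm_coeff_mul_pow hf (hz.trans hrρ.le)

theorem sumAt_add {f g : ℂ⟦X⟧} (hf : f ∈ overconvergent ℂ r) (hg : g ∈ overconvergent ℂ r)
    {z : ℂ} (hz : ‖z‖ ≤ r) : sumAt (f + g) z = sumAt f z + sumAt g z := by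
  rw [sumAt, sumAt, sumAt,
    ← (summable_of_mem hf hz).of_norm.tsum_add (summable_of_mem hg hz).of_norm]
  simp [add_mul]

theorem sumAt_neg (f : ℂ⟦X⟧) (z : ℂ) : sumAt (-f) z = -sumAt f z := by
  simp [sumAt, tsum_neg]

theorem sumAt_sub {f g : ℂ⟦X⟧} (hf : f ∈ overconvergent ℂ r) (hg : g ∈ overconvergent ℂ r)
    {z : ℂ} (hz : ‖z‖ ≤ r) : sumAt (f - g) z = sumAt f z - sumAt g z := by
  rw [sub_eq_add_neg, sumAt_add hf (neg_mem hg) hz, sumAt_neg, sub_eq_add_neg]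

theorem sumAt_mul {f g : ℂ⟦X⟧} (hf : f ∈ overconvergent ℂ r) (hg : g ∈ overconvergent ℂ r)
    {z : ℂ} (hz : ‖z‖ ≤ r) : sumAt (f * g) z = sumAt f z * sumAt g z := by
  rw [sumAt, sumAt, sumAt, tsum_mul_tsum_eq_tsum_sum_antidiagonal_of_summable_norm
    (summable_of_mem hf hz) (summable_of_mem hg hz)]
  refine tsum_congr fun n => ?_
  rw [coeff_mul, Finset.sum_mul]
  refine Finset.sum_congr rfl fun p hp => ?_
  rw [← Finset.HasAntidiagonal.mem_antidiagonal.mp hp, pow_add]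
  ring

theorem sumAt_polynomial (p : Polynomial ℂ) (z : ℂ) : sumAt (p : ℂ⟦X⟧) z = p.eval z := by
  rw [sumAt, Polynomial.eval_eq_sum, Polynomial.sum, tsum_eq_sum (s := p.support)]
  · simp
  · intro n hn
    simp [Polynomial.notMem_support_iff.mp hn]

theorem sumAt_C (a z : ℂ) : sumAt (C a) z = a := by
  simpa using sumAt_polynomial (Polynomial.C a) z

theorem sumAt_X (z : ℂ) : sumAt X z = z := by
  simpa using sumAt_polynomial Polynomial.X z

theorem hasFPowerSeriesOnBall_sumAt {f : ℂ⟦X⟧} (hf : f ∈ overconvergent ℂ r) :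
    ∃ ρ : NNReal, r < ρ ∧ HasFPowerSeriesOnBall (sumAt f)
      (FormalMultilinearSeries.ofScalars ℂ fun n => coeff n f) 0 ρ := by
  obtain ⟨ρ, hρ, hrρ, hf⟩ := hf
  lift ρ to NNReal using hρ.le
  refine ⟨ρ, hrρ, ?_⟩
  have hrad : (ρ : ENNReal) ≤ (FormalMultilinearSeries.ofScalars ℂ fun n => coeff n f).radius := by
    refine FormalMultilinearSeries.le_radius_of_summable_norm _ ?_
    simpa [FormalMultilinearSeries.ofScalars_norm] using hf
  have hρ' : (0 : ENNReal) < ρ := by exact_mod_cast hρ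
  have := (FormalMultilinearSeries.hasFPowerSeriesOnBall _ (hρ'.trans_le hrad)).mono hρ' hrad
  refine this.congr fun z _ => ?_
  change FormalMultilinearSeries.ofScalarsSum _ z = _
  rw [FormalMultilinearSeries.ofScalarsSum_eq_tsum]
  simp [sumAt]

theorem analyticOnNhd_sumAt {f : ℂ⟦X⟧} (hf : f ∈ overconvergent ℂ r) :
    AnalyticOnNhd ℂ (sumAt f) (Metric.closedBall 0 r) := by
  obtain ⟨ρ, hrρ, h⟩ := hasFPowerSeriesOnBall_sumAt hf
  refine h.analyticOnNhd.mono fun z hz => ?_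
  rw [Metric.eball_coe]
  exact Metric.closedBall_subset_ball hrρ hz

theorem eq_of_sumAt_eventuallyEq {f g : ℂ⟦X⟧} (hf : f ∈ overconvergent ℂ r)
    (hg : g ∈ overconvergent ℂ r) (h : sumAt f =ᶠ[nhds 0] sumAt g) : f = g := by
  obtain ⟨ρ, hrρ, hf⟩ := hasFPowerSeriesOnBall_sumAt hf
  obtain ⟨σ, hrσ, hg⟩ := hasFPowerSeriesOnBall_sumAt hg
  have := hf.hasFPowerSeriesAt.eq_formalMultilinearSeries_of_eventually hg.hasFPowerSeriesAt h
  have := FormalMultilinearSeries.ofScalars_series_injective ℂ ℂ this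
  ext n
  exact congrFun this n

theorem exists_sumAt_eqOn {F : ℂ → ℂ} (hr : 0 ≤ r)
    (hF : AnalyticOnNhd ℂ F (Metric.closedBall 0 r)) :
    ∃ f ∈ overconvergent ℂ r, Set.EqOn (sumAt f) F (Metric.closedBall 0 r) := by
  obtain ⟨δ, hδ, hsub⟩ := (isCompact_closedBall (0 : ℂ) r).exists_thickening_subset_open
    (isOpen_analyticAt ℂ F) hF
  rw [thickening_closedBall hδ hr] at hsub
  have hdiff : DifferentiableOn ℂ F (Metric.closedBall 0 (δ / 2 + r)) := fun z hz =>
    (hsub (Metric.closedBall_subset_ball (by linarith) hz)).differentiableAt.differentiableWithinAt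
  obtain ⟨R, hR⟩ : ∃ R : NNReal, (R : ℝ) = δ / 2 + r := ⟨⟨δ / 2 + r, by positivity⟩, rfl⟩
  obtain ⟨ρ, hρ⟩ : ∃ ρ : NNReal, (ρ : ℝ) = δ / 4 + r := ⟨⟨δ / 4 + r, by positivity⟩, rfl⟩
  have hR0 : 0 < R := by
    rw [← NNReal.coe_pos, hR]
    positivity
  rw [← hR] at hdiff
  have hps := hdiff.hasFPowerSeriesOnBall hR0
  set p := cauchyPowerSeries F 0 R
  refine ⟨PowerSeries.mk p.coeff, ⟨ρ, by rw [hρ]; positivity, by rw [hρ]; linarith, ?_⟩, ?_⟩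
  · have hlt : (ρ : ENNReal) < p.radius := by
      refine lt_of_lt_of_le ?_ hps.r_le
      have : (ρ : ℝ) < R := by rw [hρ, hR]; linarith
      exact_mod_cast this
    simpa using p.summable_norm_mul_pow hlt
  · intro z hz
    have hz' : z ∈ Metric.eball (0 : ℂ) R := by
      rw [Metric.eball_coe]
      exact Metric.closedBall_subset_ball (by rw [hR]; linarith) hz
    have := hps.hasSum hz'
    rw [zero_add] at this
    rw [sumAt, ← this.tsum_eq]
    refine tsum_congr fun n => ?_
    simp [mul_comm]

end Complex

section ComplexDivision

variable {r : ℝ}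

theorem exists_mul_eq_of_sumAt {f P : ℂ⟦X⟧} (hr : 0 < r) (hf : f ∈ overconvergent ℂ r)
    (hP : P ∈ overconvergent ℂ r) {G : ℂ → ℂ}
    (hG : AnalyticOnNhd ℂ G (Metric.closedBall 0 r))
    (h : sumAt P =ᶠ[nhdsWithin 0 {0}ᶜ] fun z => sumAt f z * G z) :
    ∃ s ∈ overconvergent ℂ r, P = f * s := by
  obtain ⟨s, hs, hsG⟩ := exists_sumAt_eqOn hr.le hG
  have h0 : (0 : ℂ) ∈ Metric.closedBall (0 : ℂ) r := Metric.mem_closedBall_self hr.le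
  refine ⟨s, hs, eq_of_sumAt_eventuallyEq hP (mul_mem hf hs) ?_⟩
  rw [← (analyticOnNhd_sumAt hP 0 h0).continuousAt.eventuallyEq_nhds_iff_eventuallyEq_nhdsNE
    (analyticOnNhd_sumAt (mul_mem hf hs) 0 h0).continuousAt]
  filter_upwards [h, nhdsWithin_le_nhds (Metric.closedBall_mem_nhds (0 : ℂ) hr)] with z hz hzr
  rw [hz, sumAt_mul hf hs (by simpa using hzr), hsG hzr]

theorem exists_eq_X_sub_C_mul_add {g : ℂ⟦X⟧} (hr : 0 < r) (hg : g ∈ overconvergent ℂ r) (x : ℂ) :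
    ∃ q ∈ overconvergent ℂ r, ∃ c : ℂ, g = (X - C x) * q + C c := by
  have hXx : (X - C x : ℂ⟦X⟧) ∈ overconvergent ℂ r := sub_mem X_mem (C_mem x)
  suffices ∃ c : ℂ, ∃ s ∈ overconvergent ℂ r, g - C c = (X - C x) * s by
    obtain ⟨c, s, hs, h⟩ := this
    exact ⟨s, hs, c, by rw [← h]; ring⟩
  have hsum : ∀ z : ℂ, ‖z‖ ≤ r → sumAt (X - C x) z = z - x := fun z hz => by
    rw [sumAt_sub X_mem (C_mem x) hz, sumAt_X, sumAt_C]
  have hga := analyticOnNhd_sumAt hg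
  have hmem : ∀ᶠ z in nhdsWithin (0 : ℂ) {0}ᶜ, ‖z‖ ≤ r := by
    filter_upwards [nhdsWithin_le_nhds (Metric.closedBall_mem_nhds (0 : ℂ) hr)] with z hz
    simpa using hz
  by_cases hx : ‖x‖ ≤ r
  · refine ⟨sumAt g x, exists_mul_eq_of_sumAt (G := dslope (sumAt g) x) hr hXx
      (sub_mem hg (C_mem _)) ?_ ?_⟩
    · obtain ⟨δ, hδ, hsub⟩ := (isCompact_closedBall (0 : ℂ) r).exists_thickening_subset_open
        (isOpen_analyticAt ℂ (sumAt g)) hga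
      rw [thickening_closedBall hδ hr.le] at hsub
      have hopen : IsOpen (Metric.ball (0 : ℂ) (δ + r)) := Metric.isOpen_ball
      have hlt : Metric.closedBall (0 : ℂ) r ⊆ Metric.ball 0 (δ + r) :=
        Metric.closedBall_subset_ball (by linarith)
      have hd : DifferentiableOn ℂ (dslope (sumAt g) x) (Metric.ball 0 (δ + r)) :=
        (Complex.differentiableOn_dslope (hopen.mem_nhds (hlt (by simpa using hx)))).mpr
          fun z hz => (hsub hz).differentiableAt.differentiableWithinAt
      exact (hd.analyticOnNhd hopen).mono hlt
    · filter_upwards [hmem] with z hz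
      rw [sumAt_sub hg (C_mem _) hz, sumAt_C, hsum z hz, ← smul_eq_mul, sub_smul_dslope]
  · refine ⟨0, exists_mul_eq_of_sumAt (G := fun z => (z - x)⁻¹ * sumAt g z) hr hXx
      (sub_mem hg (C_mem _)) ?_ ?_⟩
    · intro z hz
      have hzx : z - x ≠ 0 := by
        rw [sub_ne_zero]
        rintro rfl
        exact hx (by simpa using hz)
      exact ((analyticAt_id.sub analyticAt_const).inv hzx).mul (hga z hz)
    · filter_upwards [hmem] with z hz
      have hzx : z - x ≠ 0 := by
        rw [sub_ne_zero]
        rintro rfl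
        exact hx hz
      rw [sumAt_sub hg (C_mem _) hz, sumAt_C, hsum z hz]
      field_simp
      ring

theorem exists_eq_polynomial_mul_add (hr : 0 < r) {Q : Polynomial ℂ} (hQ : Q ≠ 0) {g : ℂ⟦X⟧}
    (hg : g ∈ overconvergent ℂ r) :
    ∃ q ∈ overconvergent ℂ r, ∃ p : Polynomial ℂ, g = Q * q + p := by
  have hprod : ∀ s : Multiset ℂ, ∀ g ∈ overconvergent ℂ r,
      ∃ q ∈ overconvergent ℂ r, ∃ p : Polynomial ℂ,
        g = ((s.map fun a => Polynomial.X - Polynomial.C a).prod : Polynomial ℂ) * q + p := by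
    intro s
    induction s using Multiset.induction with
    | empty => exact fun g hg => ⟨g, hg, 0, by simp⟩
    | cons a s ih =>
      intro g hg
      obtain ⟨q₁, hq₁, c, h₁⟩ := exists_eq_X_sub_C_mul_add hr hg a
      obtain ⟨q₂, hq₂, p, h₂⟩ := ih q₁ hq₁
      refine ⟨q₂, hq₂, (Polynomial.X - Polynomial.C a) * p + Polynomial.C c, ?_⟩
      rw [h₁]
      nth_rewrite 1 [h₂]
      simp only [Multiset.map_cons, Multiset.prod_cons, Polynomial.coe_mul, Polynomial.coe_add,
        Polynomial.coe_sub, Polynomial.coe_X, Polynomial.coe_C]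
      ring
  obtain ⟨q, hq, p, h⟩ := hprod Q.roots g hg
  have hlead : Q.leadingCoeff ≠ 0 := Polynomial.leadingCoeff_ne_zero.mpr hQ
  refine ⟨C (Q.leadingCoeff)⁻¹ * q, mul_mem (C_mem _) hq, p, ?_⟩
  have hQ' := (IsAlgClosed.splits Q).eq_prod_roots
  have hC : (C Q.leadingCoeff * C (Q.leadingCoeff)⁻¹ : ℂ⟦X⟧) = 1 := by
    rw [← map_mul, mul_inv_cancel₀ hlead, map_one]
  nth_rewrite 1 [hQ']
  rw [h, Polynomial.coe_mul, Polynomial.coe_C]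
  linear_combination (-(((Q.roots.map fun a => Polynomial.X - Polynomial.C a).prod :
    Polynomial ℂ) : ℂ⟦X⟧) * q) * hC

theorem exists_inverse_of_sumAt_ne_zero (hr : 0 < r) {w : ℂ⟦X⟧} (hw : w ∈ overconvergent ℂ r)
    (h : ∀ z : ℂ, ‖z‖ ≤ r → sumAt w z ≠ 0) : ∃ s ∈ overconvergent ℂ r, 1 = w * s := by
  refine exists_mul_eq_of_sumAt (G := fun z => (sumAt w z)⁻¹) hr hw (one_mem _) ?_ ?_
  · exact (analyticOnNhd_sumAt hw).inv fun z hz => h z (by simpa using hz)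
  · filter_upwards [nhdsWithin_le_nhds (Metric.closedBall_mem_nhds (0 : ℂ) hr)] with z hz
    rw [mul_inv_cancel₀ (h z (by simpa using hz))]
    simpa using sumAt_C 1 z

theorem exists_monic_multiple (hr : 0 < r) {f : ℂ⟦X⟧} (hf : f ∈ overconvergent ℂ r)
    (hf0 : f ≠ 0) : ∃ P : Polynomial ℂ, P.Monic ∧ ∃ s ∈ overconvergent ℂ r, (P : ℂ⟦X⟧) = f * s := by
  set U := Metric.closedBall (0 : ℂ) r
  have h0 : (0 : ℂ) ∈ U := Metric.mem_closedBall_self hr.le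
  have han : AnalyticOnNhd ℂ (sumAt f) U := analyticOnNhd_sumAt hf
  have hpre : IsPreconnected U := (convex_closedBall (0 : ℂ) r).isPreconnected
  have hord : ∀ u : U, meromorphicOrderAt (sumAt f) u ≠ ⊤ := by
    intro u hu
    rw [meromorphicOrderAt_eq_top_iff] at hu
    have hzero := han.eqOn_zero_of_preconnected_of_frequently_eq_zero hpre u.2 hu.frequently
    refine hf0 (eq_of_sumAt_eventuallyEq hf (zero_mem _) ?_)
    filter_upwards [Metric.closedBall_mem_nhds (0 : ℂ) hr] with z hz
    rw [hzero hz]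
    simp [sumAt]
  have hfin := (MeromorphicOn.divisor (sumAt f) U).finiteSupport (isCompact_closedBall _ _)
  obtain ⟨g, hg, hg0, hfg⟩ := MeromorphicOn.extract_zeros_poles han.meromorphicOn hord hfin
  set D := MeromorphicOn.divisor (sumAt f) U with hD
  have hDnn : ∀ u, 0 ≤ D u := fun u => MeromorphicOn.AnalyticOnNhd.divisor_nonneg han u
  let P : Polynomial ℂ :=
    ∏ u ∈ hfin.toFinset, (Polynomial.X - Polynomial.C u) ^ (D u).toNat
  have hPeval : ∀ z, P.eval z = (∏ᶠ u, (· - u) ^ D u : ℂ → ℂ) z := by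
    intro z
    rw [Function.FactorizedRational.finprod_eq_fun hfin]
    simp only
    rw [finprod_eq_prod_of_mulSupport_subset (s := hfin.toFinset) (f := fun u => (z - u) ^ D u)]
    · rw [Polynomial.eval_prod]
      refine Finset.prod_congr rfl fun u _ => ?_
      have : D u = ((D u).toNat : ℤ) := (Int.toNat_of_nonneg (hDnn u)).symm
      conv_rhs => rw [this, zpow_natCast]
      simp
    · intro u hu
      simp only [Set.Finite.coe_toFinset, Function.mem_support]
      intro hDu
      exact hu (by simp [hDu])
  refine ⟨P, Polynomial.monic_prod_of_monic _ _ fun u _ => (Polynomial.monic_X_sub_C u).pow _, ?_⟩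
  refine exists_mul_eq_of_sumAt (G := fun z => (g z)⁻¹) hr hf (polynomial_mem P)
    (hg.inv fun z hz => hg0 ⟨z, hz⟩) ?_
  have hacc : AccPt (0 : ℂ) (Filter.principal U) := by
    rw [accPt_iff_frequently_nhdsNE]
    exact Filter.Eventually.frequently
      (nhdsWithin_le_nhds (Metric.closedBall_mem_nhds (0 : ℂ) hr))
  have hP : (∏ᶠ u, (· - u) ^ D u : ℂ → ℂ) = fun z => P.eval z := funext fun z => (hPeval z).symm
  rw [hP] at hfg
  have hPan : AnalyticAt ℂ (fun z => P.eval z) 0 := P.differentiable.analyticAt 0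
  have := (han 0 h0).meromorphicAt.eventuallyEq_nhdsNE_of_eventuallyEq_codiscreteWithin
    (hPan.meromorphicAt.smul (hg 0 h0).meromorphicAt) h0 hacc hfg
  filter_upwards [this, nhdsWithin_le_nhds (Metric.closedBall_mem_nhds (0 : ℂ) hr)] with z hz hzU
  rw [hz, sumAt_polynomial]
  have := hg0 ⟨z, hzU⟩
  simp only [Pi.smul_apply', smul_eq_mul]
  field_simp

end ComplexDivision

section Real

variable {r : ℝ}

/-- A real power series regarded as a complex one. -/
noncomputable def complexify : ℝ⟦X⟧ →+* ℂ⟦X⟧ := PowerSeries.map Complex.ofRealHom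

/-- The coefficientwise real part of a complex power series. -/
noncomputable def realPart : ℂ⟦X⟧ →+ ℝ⟦X⟧ where
  toFun f := PowerSeries.mk fun n => (coeff n f).re
  map_zero' := by ext; simp
  map_add' f g := by ext; simp

@[simp]
theorem coeff_complexify (f : ℝ⟦X⟧) (n : ℕ) : coeff n (complexify f) = ((coeff n f : ℝ) : ℂ) := by
  simp [complexify]

@[simp]
theorem coeff_realPart (f : ℂ⟦X⟧) (n : ℕ) : coeff n (realPart f) = (coeff n f).re := by
  simp [realPart]

theorem realPart_complexify (f : ℝ⟦X⟧) : realPart (complexify f) = f := by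
  ext; simp

theorem complexify_injective : Function.Injective complexify :=
  Function.LeftInverse.injective realPart_complexify

theorem realPart_complexify_mul (f : ℝ⟦X⟧) (g : ℂ⟦X⟧) :
    realPart (complexify f * g) = f * realPart g := by
  ext n
  simp [coeff_mul]

theorem complexify_mem {f : ℝ⟦X⟧} (hf : f ∈ overconvergent ℝ r) :
    complexify f ∈ overconvergent ℂ r :=
  of_norm_coeff_le hf fun n => by simp

theorem realPart_mem {f : ℂ⟦X⟧} (hf : f ∈ overconvergent ℂ r) :
    realPart f ∈ overconvergent ℝ r :=
  of_norm_coeff_le hf fun n => by simpa using Complex.abs_re_le_norm _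

theorem exists_realPart_eq_polynomial (P : Polynomial ℂ) :
    ∃ Q : Polynomial ℝ, realPart P = Q := by
  refine ⟨trunc (P.natDegree + 1) (realPart P), ?_⟩
  ext n
  rw [Polynomial.coeff_coe, coeff_trunc]
  split_ifs with h
  · rfl
  · simp [Polynomial.coeff_eq_zero_of_natDegree_lt (by omega : P.natDegree < n)]

theorem complexify_polynomial (Q : Polynomial ℝ) :
    complexify (Q : ℝ⟦X⟧) = (Q.map Complex.ofRealHom : Polynomial ℂ) := by
  ext n
  simp

theorem exists_real_inverse (hr : 0 < r) {w : ℝ⟦X⟧} (hw : w ∈ overconvergent ℝ r)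
    (h : ∀ z : ℂ, ‖z‖ ≤ r → sumAt (complexify w) z ≠ 0) :
    ∃ s ∈ overconvergent ℝ r, w * s = 1 := by
  obtain ⟨s, hs, h1⟩ := exists_inverse_of_sumAt_ne_zero hr (complexify_mem hw) h
  refine ⟨realPart s, realPart_mem hs, ?_⟩
  rw [← realPart_complexify_mul, ← h1, ← map_one complexify, realPart_complexify]

theorem exists_polynomial_multiple (hr : 0 < r) {f : ℝ⟦X⟧} (hf : f ∈ overconvergent ℝ r)
    (hf0 : f ≠ 0) : ∃ Q : Polynomial ℝ, Q ≠ 0 ∧ ∃ s ∈ overconvergent ℝ r, (Q : ℝ⟦X⟧) = f * s := by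
  obtain ⟨P, hP, s, hs, h⟩ := exists_monic_multiple hr (complexify_mem hf)
    ((map_ne_zero_iff complexify complexify_injective).mpr hf0)
  obtain ⟨Q, hQ⟩ := exists_realPart_eq_polynomial P
  refine ⟨Q, ?_, realPart s, realPart_mem hs, by rw [← hQ, h, realPart_complexify_mul]⟩
  rintro rfl
  have := congrArg (coeff P.natDegree) hQ
  simp [hP.coeff_natDegree] at this

theorem exists_eq_real_polynomial_mul_add (hr : 0 < r) {Q : Polynomial ℝ} (hQ : Q ≠ 0)
    {g : ℝ⟦X⟧} (hg : g ∈ overconvergent ℝ r) :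
    ∃ q ∈ overconvergent ℝ r, ∃ p : Polynomial ℝ, g = Q * q + p := by
  obtain ⟨q, hq, p, h⟩ := exists_eq_polynomial_mul_add hr
    ((Polynomial.map_ne_zero_iff Complex.ofRealHom.injective).mpr hQ) (complexify_mem hg)
  obtain ⟨p', hp'⟩ := exists_realPart_eq_polynomial p
  refine ⟨realPart q, realPart_mem hq, p', ?_⟩
  rw [← realPart_complexify g, h, ← complexify_polynomial, map_add, realPart_complexify_mul, hp']

/-- Polynomials as elements of the ring of overconvergent series. -/
noncomputable def ofPolynomial (r : ℝ) : Polynomial ℝ →+* overconvergent ℝ r :=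
  (Polynomial.coeToPowerSeries.ringHom (R := ℝ)).codRestrict _ polynomial_mem

@[simp]
theorem coe_ofPolynomial (p : Polynomial ℝ) : (ofPolynomial r p : ℝ⟦X⟧) = p := rfl

theorem isPrincipalIdealRing_real (hr : 0 < r) : IsPrincipalIdealRing (overconvergent ℝ r) := by
  refine ⟨fun J => ?_⟩
  by_cases hJ : J = ⊥
  · rw [hJ]
    infer_instance
  obtain ⟨f, hfJ, hf0⟩ := Submodule.exists_mem_ne_zero_of_ne_bot hJ
  obtain ⟨Q, hQ, s, hs, hQf⟩ := exists_polynomial_multiple hr f.2 (by simpa using hf0)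
  have hQJ : ofPolynomial r Q ∈ J := by
    have : ofPolynomial r Q = f * ⟨s, hs⟩ := Subtype.ext hQf
    rw [this]
    exact J.mul_mem_right _ hfJ
  obtain ⟨p, hp⟩ := IsPrincipalIdealRing.principal (J.comap (ofPolynomial r))
  have hpJ : ofPolynomial r p ∈ J := by
    rw [← Ideal.mem_comap, hp]
    exact Submodule.mem_span_singleton_self p
  have hdvd : ∀ t : Polynomial ℝ, ofPolynomial r t ∈ J → ofPolynomial r p ∣ ofPolynomial r t := by
    intro t ht
    rw [← Ideal.mem_comap, hp] at ht
    exact map_dvd _ (Ideal.mem_span_singleton.mp ht)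
  refine ⟨ofPolynomial r p, le_antisymm (fun g hg => ?_) ?_⟩
  · obtain ⟨q, hq, t, h⟩ := exists_eq_real_polynomial_mul_add hr hQ g.2
    have hg' : g = ofPolynomial r Q * ⟨q, hq⟩ + ofPolynomial r t := Subtype.ext h
    have ht : ofPolynomial r t ∈ J := by
      have : ofPolynomial r t = g - ofPolynomial r Q * ⟨q, hq⟩ := by rw [hg']; ring
      rw [this]
      exact J.sub_mem hg (J.mul_mem_right _ hQJ)
    refine Ideal.mem_span_singleton.mpr ?_
    rw [hg']
    exact dvd_add ((hdvd Q hQJ).mul_right _) (hdvd t ht)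
  · exact (Ideal.span_singleton_le_iff_mem _).mpr hpJ

end Real

section Rounding

variable {r : ℝ}

theorem norm_sumAt_le_of_norm_coeff_le_one (hr0 : 0 ≤ r) (hr1 : r < 1) {f : ℂ⟦X⟧}
    (h : ∀ n, ‖coeff n f‖ ≤ 1) {z : ℂ} (hz : ‖z‖ ≤ r) : ‖sumAt f z‖ ≤ (1 - r)⁻¹ := by
  refine tsum_of_norm_bounded (hasSum_geometric_of_lt_one hr0 hr1) fun n => ?_
  rw [norm_mul, norm_pow, ← one_mul (r ^ n)]
  gcongr
  exact h n

theorem sumAt_X_pow_mul {f : ℂ⟦X⟧} (hf : f ∈ overconvergent ℂ r) (k : ℕ) {z : ℂ} (hz : ‖z‖ ≤ r) :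
    sumAt (X ^ k * f) z = z ^ k * sumAt f z := by
  rw [sumAt_mul (pow_mem X_mem k) hf hz]
  congr 1
  simpa using sumAt_polynomial (Polynomial.X ^ k) z

theorem exists_inverse_one_add_X_pow_mul (hr : 0 < r) {e : ℝ⟦X⟧} (he : e ∈ overconvergent ℝ r)
    {k : ℕ} {M : ℝ} (hM : ∀ z : ℂ, ‖z‖ ≤ r → ‖sumAt (complexify e) z‖ ≤ M) (hk : r ^ k * M < 1) :
    ∃ s ∈ overconvergent ℝ r, (1 + X ^ k * e) * s = 1 := by
  have hXe : X ^ k * complexify e ∈ overconvergent ℂ r :=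
    mul_mem (pow_mem X_mem k) (complexify_mem he)
  refine exists_real_inverse hr (add_mem (one_mem _) (mul_mem (pow_mem X_mem k) he))
    fun z hz h0 => ?_
  have hmap : complexify (1 + X ^ k * e) = C 1 + X ^ k * complexify e := by
    simp [complexify]
  rw [hmap, sumAt_add (C_mem 1) hXe hz, sumAt_C, sumAt_X_pow_mul (complexify_mem he) k hz] at h0
  have h1 : ‖z ^ k * sumAt (complexify e) z‖ = 1 := by
    rw [← norm_neg, ← eq_neg_of_add_eq_zero_left h0, norm_one]
  have h2 : ‖z ^ k * sumAt (complexify e) z‖ ≤ r ^ k * M := by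
    rw [norm_mul, norm_pow]
    gcongr
    exact hM z hz
  linarith

/-- Integral power series regarded as real ones. -/
noncomputable def ofInt : ℤ⟦X⟧ →+* ℝ⟦X⟧ := PowerSeries.map (Int.castRingHom ℝ)

@[simp]
theorem coeff_ofInt (f : ℤ⟦X⟧) (n : ℕ) : coeff n (ofInt f) = ((coeff n f : ℤ) : ℝ) := by
  simp [ofInt]

@[simp]
theorem ofInt_X : ofInt X = X := by
  simp [ofInt]

@[simp]
theorem ofInt_C (k : ℤ) : ofInt (C k) = C (k : ℝ) := by
  simp [ofInt]

theorem ofInt_injective : Function.Injective ofInt := by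
  intro f g h
  ext n
  have := congrArg (coeff n) h
  simpa using this

theorem ofInt_mem_iff {f : ℤ⟦X⟧} : ofInt f ∈ overconvergent ℝ r ↔ f ∈ overconvergent ℤ r :=
  ⟨fun h => of_norm_coeff_le h fun n => by simp [Int.norm_eq_abs],
    fun h => of_norm_coeff_le h fun n => by simp [Int.norm_eq_abs]⟩

theorem exists_ofInt_eq {f : ℝ⟦X⟧} (h : ∀ n, ∃ k : ℤ, coeff n f = k) : ∃ q : ℤ⟦X⟧, ofInt q = f := by
  choose k hk using h
  exact ⟨PowerSeries.mk k, by ext n; simp [hk]⟩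

theorem exists_int_approx (b : ℝ⟦X⟧) :
    ∃ q : ℤ⟦X⟧, ∀ n, ‖coeff n (b - ofInt q)‖ ≤ 1 := by
  refine ⟨PowerSeries.mk fun n => ⌊coeff n b⌋, fun n => ?_⟩
  simp only [map_sub, coeff_ofInt, coeff_mk, Int.self_sub_floor]
  rw [Real.norm_of_nonneg (Int.fract_nonneg _)]
  exact (Int.fract_lt_one _).le

/-- The sequence `e` with values in `[0, 1)` that makes the coefficients of `T + H * e` integral,
for `H` with constant coefficient `1`. -/
noncomputable def roundingSeq (H T : ℝ⟦X⟧) : ℕ → ℝ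
  | n =>
    let x := coeff n T + ∑ i : Fin n, roundingSeq H T i * coeff (n - i) H
    ⌈x⌉ - x
decreasing_by exact i.2

theorem exists_bounded_integral_correction {H : ℝ⟦X⟧} (hH : coeff 0 H = 1) (T : ℝ⟦X⟧) :
    ∃ e : ℝ⟦X⟧, (∀ n, ‖coeff n e‖ ≤ 1) ∧ ∃ q : ℤ⟦X⟧, ofInt q = T + H * e := by
  refine ⟨PowerSeries.mk (roundingSeq H T), fun n => ?_, exists_ofInt_eq fun n => ?_⟩
  · rw [coeff_mk, roundingSeq, Real.norm_of_nonneg (sub_nonneg.mpr (Int.le_ceil _))]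
    linarith [Int.ceil_lt_add_one
      (coeff n T + ∑ i : Fin n, roundingSeq H T i * coeff (n - i) H)]
  · refine ⟨⌈coeff n T + ∑ i : Fin n, roundingSeq H T i * coeff (n - i) H⌉, ?_⟩
    have hn : roundingSeq H T n = ⌈coeff n T + ∑ i : Fin n, roundingSeq H T i * coeff (n - i) H⌉ -
        (coeff n T + ∑ i : Fin n, roundingSeq H T i * coeff (n - i) H) := by
      rw [roundingSeq]
    rw [map_add, mul_comm, coeff_mul, Finset.Nat.sum_antidiagonal_eq_sum_range_succ_mk,
      Finset.sum_range_succ]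
    simp only [coeff_mk, Nat.sub_self, hH, mul_one]
    rw [hn, Finset.sum_range fun i => roundingSeq H T i * coeff (n - i) H]
    ring

theorem coeff_zero_mul {K : Type*} [CommRing K] (f g : K⟦X⟧) :
    coeff 0 (f * g) = coeff 0 f * coeff 0 g := by
  simp [coeff_mul]

theorem exists_unit_mul_integral_below (hr0 : 0 < r) (hr1 : r < 1) {G : ℝ⟦X⟧}
    (hG : coeff 0 G = 1) (m : ℕ) :
    ∃ v ∈ overconvergent ℝ r, coeff 0 v = 1 ∧ (∃ s ∈ overconvergent ℝ r, v * s = 1) ∧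
      ∀ n < m + 1, ∃ k : ℤ, coeff n (G * v) = k := by
  induction m with
  | zero =>
    refine ⟨1, one_mem _, by simp, ⟨1, one_mem _, by simp⟩, fun n hn => ⟨1, ?_⟩⟩
    obtain rfl : n = 0 := by omega
    simp [hG]
  | succ m ih =>
    obtain ⟨v, hv, hv0, ⟨s, hs, hvs⟩, hint⟩ := ih
    set c := coeff (m + 1) (G * v)
    have ha : ‖(⌈c⌉ - c : ℝ)‖ ≤ 1 := by
      rw [Real.norm_of_nonneg (sub_nonneg.mpr (Int.le_ceil _))]
      linarith [Int.ceil_lt_add_one c]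
    obtain ⟨s', hs', hs1⟩ := exists_inverse_one_add_X_pow_mul (k := m + 1) (M := 1) hr0
      (C_mem (⌈c⌉ - c : ℝ)) (fun z _ => by
        have : complexify (C (⌈c⌉ - c : ℝ)) = C ((⌈c⌉ - c : ℝ) : ℂ) := by simp [complexify]
        rw [this, sumAt_C, Complex.norm_real]
        exact ha) (by rw [mul_one]; exact pow_lt_one₀ hr0.le hr1 (by omega))
    refine ⟨v * (1 + X ^ (m + 1) * C (⌈c⌉ - c : ℝ)), mul_mem hv
      (add_mem (one_mem _) (mul_mem (pow_mem X_mem _) (C_mem _))), ?_,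
      ⟨s * s', mul_mem hs hs', ?_⟩, fun n hn => ?_⟩
    · simp [coeff_zero_eq_constantCoeff] at hv0 ⊢
      exact hv0
    · linear_combination ((1 + X ^ (m + 1) * C (⌈c⌉ - c : ℝ)) * s') * hvs + hs1
    · have hexp : G * (v * (1 + X ^ (m + 1) * C (⌈c⌉ - c : ℝ))) =
          G * v + X ^ (m + 1) * (G * v * C (⌈c⌉ - c : ℝ)) := by ring
      rw [hexp, map_add, coeff_X_pow_mul']
      rcases Nat.lt_succ_iff_lt_or_eq.mp hn with h | rfl
      · rw [if_neg (by omega), add_zero]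
        exact hint n h
      · refine ⟨⌈c⌉, ?_⟩
        rw [if_pos le_rfl, Nat.sub_self, coeff_mul_C]
        have : coeff 0 (G * v) = 1 := by
          rw [coeff_zero_mul, hG, hv0, one_mul]
        rw [this]
        ring

theorem exists_unit_mul_integral (hr0 : 0 < r) (hr1 : r < 1) {G : ℝ⟦X⟧} (hG : coeff 0 G = 1) :
    ∃ u ∈ overconvergent ℝ r, coeff 0 u = 1 ∧ (∃ s ∈ overconvergent ℝ r, u * s = 1) ∧
      ∃ q : ℤ⟦X⟧, ofInt q = G * u := by
  obtain ⟨m, hm⟩ := exists_pow_lt_of_lt_one (sub_pos.mpr hr1) hr1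
  obtain ⟨v, hv, hv0, ⟨s, hs, hvs⟩, hint⟩ := exists_unit_mul_integral_below hr0 hr1 hG m
  have hH : coeff 0 (G * v) = 1 := by
    rw [coeff_zero_mul, hG, hv0, one_mul]
  choose k hk using hint
  obtain ⟨p, hp⟩ := exists_ofInt_eq (f := (trunc (m + 1) (G * v) : Polynomial ℝ)) fun n => by
    rw [Polynomial.coeff_coe, coeff_trunc]
    split_ifs with h
    · exact ⟨k n h, hk n h⟩
    · exact ⟨0, by simp⟩
  have hT := eq_X_pow_mul_shift_add_trunc (m + 1) (G * v)
  set T := PowerSeries.mk fun i => coeff (i + (m + 1)) (G * v)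
  obtain ⟨e, he, q, hq⟩ := exists_bounded_integral_correction hH T
  have heA : e ∈ overconvergent ℝ r := of_bounded hr0 hr1 1 he
  obtain ⟨s', hs', hs1⟩ := exists_inverse_one_add_X_pow_mul (k := m + 1) hr0 heA
    (fun z hz => norm_sumAt_le_of_norm_coeff_le_one hr0.le hr1 (fun n => by simpa using he n) hz)
    (by
      rw [mul_inv_lt_iff₀ (sub_pos.mpr hr1), one_mul]
      exact (pow_le_pow_of_le_one hr0.le hr1.le (Nat.le_succ m)).trans_lt hm)
  refine ⟨v * (1 + X ^ (m + 1) * e), mul_mem hv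
    (add_mem (one_mem _) (mul_mem (pow_mem X_mem _) heA)), ?_, ⟨s * s', mul_mem hs hs', ?_⟩,
    p + X ^ (m + 1) * q, ?_⟩
  · simp [coeff_zero_eq_constantCoeff] at hv0 ⊢
    exact hv0
  · linear_combination ((1 + X ^ (m + 1) * e) * s') * hvs + hs1
  · rw [map_add, map_mul, map_pow, ofInt_X, hp, hq]
    linear_combination -hT

end Rounding

section Integral

variable {r : ℝ}

/-- The inclusion of the integral overconvergent series into the real ones. -/
noncomputable def toReal (r : ℝ) : overconvergent ℤ r →+* overconvergent ℝ r :=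
  (ofInt.comp (overconvergent ℤ r).subtype).codRestrict _ fun f => ofInt_mem_iff.mpr f.2

@[simp]
theorem coe_toReal (f : overconvergent ℤ r) : (toReal r f : ℝ⟦X⟧) = ofInt (f : ℤ⟦X⟧) := rfl

/-- The variable as an overconvergent series. -/
noncomputable def var (r : ℝ) : overconvergent ℤ r := ⟨X, X_mem⟩

@[simp]
theorem coe_var : (var r : ℤ⟦X⟧) = X := rfl

theorem exists_bound_sumAt {f : ℂ⟦X⟧} (hf : f ∈ overconvergent ℂ r) :
    ∃ M : ℝ, ∀ z : ℂ, ‖z‖ ≤ r → ‖sumAt f z‖ ≤ M := by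
  obtain ⟨M, hM⟩ := (isCompact_closedBall (0 : ℂ) r).exists_bound_of_continuousOn
    (analyticOnNhd_sumAt hf).continuousOn
  exact ⟨M, fun z hz => hM z (by simpa using hz)⟩

theorem exists_bounded_approx (hr0 : 0 < r) (hr1 : r < 1) {I : Ideal (overconvergent ℤ r)}
    {h : overconvergent ℝ r} (hI : ∀ g ∈ I, h ∣ toReal r g) {s : overconvergent ℝ r}
    (hs : s ∈ I.map (toReal r)) :
    ∃ M : ℝ, ∀ b : overconvergent ℝ r, ∃ y ∈ I, ∃ e : overconvergent ℝ r,
      b * s - toReal r y = h * e ∧ ∀ z : ℂ, ‖z‖ ≤ r → ‖sumAt (complexify e) z‖ ≤ M := by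
  induction hs using Submodule.span_induction with
  | mem s hs =>
    obtain ⟨g, hg, rfl⟩ := hs
    obtain ⟨g', hg'⟩ := hI g hg
    obtain ⟨M, hM⟩ := exists_bound_sumAt (complexify_mem g'.2)
    refine ⟨(1 - r)⁻¹ * M, fun b => ?_⟩
    obtain ⟨q, hq⟩ := exists_int_approx (b : ℝ⟦X⟧)
    have hfrac : (b : ℝ⟦X⟧) - ofInt q ∈ overconvergent ℝ r := of_bounded hr0 hr1 1 hq
    have hqA : ofInt q ∈ overconvergent ℝ r := by
      simpa using sub_mem b.2 hfrac
    refine ⟨⟨q, ofInt_mem_iff.mp hqA⟩ * g, I.mul_mem_left _ hg, ⟨_, hfrac⟩ * g', ?_,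
      fun z hz => ?_⟩
    · have : toReal r ⟨q, ofInt_mem_iff.mp hqA⟩ = b - ⟨_, hfrac⟩ := Subtype.ext (by simp)
      rw [map_mul, this, hg']
      ring
    · have h1 := norm_sumAt_le_of_norm_coeff_le_one hr0.le hr1
        (f := complexify ((b : ℝ⟦X⟧) - ofInt q))
        (fun n => by rw [coeff_complexify, Complex.norm_real]; exact hq n) hz
      rw [Subring.coe_mul, map_mul, sumAt_mul (complexify_mem hfrac) (complexify_mem g'.2) hz,
        norm_mul]
      gcongr
      exact hM z hz
  | zero => exact ⟨0, fun b => ⟨0, zero_mem _, 0, by simp, fun z _ => by simp [sumAt]⟩⟩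
  | add s t _ _ hs ht =>
    obtain ⟨M, hM⟩ := hs
    obtain ⟨N, hN⟩ := ht
    refine ⟨M + N, fun b => ?_⟩
    obtain ⟨y, hy, e, he, heM⟩ := hM b
    obtain ⟨y', hy', e', he', heN⟩ := hN b
    refine ⟨y + y', add_mem hy hy', e + e', ?_, fun z hz => ?_⟩
    · rw [map_add]
      linear_combination he + he'
    · rw [Subring.coe_add, map_add, sumAt_add (complexify_mem e.2) (complexify_mem e'.2) hz]
      exact (norm_add_le _ _).trans (add_le_add (heM z hz) (heN z hz))
  | smul a s _ hs =>
    obtain ⟨M, hM⟩ := hs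
    refine ⟨M, fun b => ?_⟩
    obtain ⟨y, hy, e, he, heM⟩ := hM (b * a)
    exact ⟨y, hy, e, by rw [← he, smul_eq_mul]; ring, heM⟩

theorem exists_eq_var_mul {g : overconvergent ℤ r} (hg : coeff 0 (g : ℤ⟦X⟧) = 0) :
    ∃ g', g = var r * g' := by
  obtain ⟨p, hp⟩ : X ∣ (g : ℤ⟦X⟧) := by
    rwa [X_dvd_iff, ← coeff_zero_eq_constantCoeff_apply]
  have hpB : p ∈ overconvergent ℤ r := of_X_pow_mul (k := 1) (by rw [pow_one, ← hp]; exact g.2)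
  exact ⟨⟨p, hpB⟩, Subtype.ext hp⟩

theorem exists_minimal_constant_coeff {I : Ideal (overconvergent ℤ r)} (hI : I ≠ ⊥)
    (hsat : ∀ g, var r * g ∈ I → g ∈ I) :
    ∃ f ∈ I, coeff 0 (f : ℤ⟦X⟧) ≠ 0 ∧ ∀ g ∈ I, coeff 0 (f : ℤ⟦X⟧) ∣ coeff 0 (g : ℤ⟦X⟧) := by
  let φ : overconvergent ℤ r →+* ℤ := constantCoeff.comp (overconvergent ℤ r).subtype
  have hφ : ∀ g : overconvergent ℤ r, φ g = coeff 0 (g : ℤ⟦X⟧) := fun g =>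
    (coeff_zero_eq_constantCoeff_apply _).symm
  have hsurj : Function.Surjective φ := fun k => ⟨⟨C k, C_mem k⟩, by simp [φ]⟩
  obtain ⟨d, hd⟩ := IsPrincipalIdealRing.principal (I.map φ)
  have hdmem : d ∈ I.map φ := by
    rw [hd]
    exact Submodule.mem_span_singleton_self d
  obtain ⟨f, hfI, hfd⟩ := (Ideal.mem_map_iff_of_surjective φ hsurj).mp hdmem
  have hdvd : ∀ g ∈ I, coeff 0 (f : ℤ⟦X⟧) ∣ coeff 0 (g : ℤ⟦X⟧) := by
    intro g hg
    rw [← hφ, ← hφ, hfd]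
    have := Ideal.mem_map_of_mem φ hg
    rw [hd] at this
    exact Ideal.mem_span_singleton.mp this
  refine ⟨f, hfI, fun h0 => hI ?_, hdvd⟩
  have hzero : ∀ n, ∀ g ∈ I, coeff n (g : ℤ⟦X⟧) = 0 := by
    intro n
    induction n with
    | zero => exact fun g hg => zero_dvd_iff.mp (h0 ▸ hdvd g hg)
    | succ n ih =>
      intro g hg
      obtain ⟨g', rfl⟩ := exists_eq_var_mul (zero_dvd_iff.mp (h0 ▸ hdvd g hg))
      rw [Subring.coe_mul, coe_var, coeff_succ_X_mul]
      exact ih g' (hsat g' hg)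
  rw [eq_bot_iff]
  exact fun g hg => (Submodule.mem_bot _).mpr (Subtype.ext (PowerSeries.ext fun n => by
    simpa using hzero n g hg))

theorem coeff_quotient_integral {I : Ideal (overconvergent ℤ r)}
    (hsat : ∀ g, var r * g ∈ I → g ∈ I) {f : overconvergent ℤ r} (hfI : f ∈ I)
    (hf0 : coeff 0 (f : ℤ⟦X⟧) ≠ 0)
    (hdvd : ∀ g ∈ I, coeff 0 (f : ℤ⟦X⟧) ∣ coeff 0 (g : ℤ⟦X⟧)) (n : ℕ) :
    ∀ g ∈ I, ∀ t : ℝ⟦X⟧, ofInt (g : ℤ⟦X⟧) = ofInt (f : ℤ⟦X⟧) * t → ∃ k : ℤ, coeff n t = k := by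
  have hzero : ∀ g ∈ I, ∀ t : ℝ⟦X⟧, ofInt (g : ℤ⟦X⟧) = ofInt (f : ℤ⟦X⟧) * t →
      ∃ k : ℤ, coeff 0 t = k ∧ coeff 0 (g : ℤ⟦X⟧) = coeff 0 (f : ℤ⟦X⟧) * k := by
    intro g hg t ht
    obtain ⟨k, hk⟩ := hdvd g hg
    refine ⟨k, ?_, hk⟩
    have h := congrArg (coeff 0) ht
    rw [coeff_zero_mul, coeff_ofInt, coeff_ofInt, hk, Int.cast_mul] at h
    exact (mul_left_cancel₀ (Int.cast_ne_zero.mpr hf0) h).symm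
  induction n with
  | zero =>
    intro g hg t ht
    obtain ⟨k, hk, -⟩ := hzero g hg t ht
    exact ⟨k, hk⟩
  | succ n ih =>
    intro g hg t ht
    obtain ⟨k, hk, hgk⟩ := hzero g hg t ht
    obtain ⟨g', hg'⟩ := exists_eq_var_mul (r := r) (g := g - f * ⟨C k, C_mem k⟩) (by
      rw [AddSubgroupClass.coe_sub, Subring.coe_mul, map_sub, coeff_zero_mul, hgk, coeff_zero_C,
        sub_self])
    obtain ⟨t', ht'⟩ : X ∣ t - C (k : ℝ) := by
      rw [X_dvd_iff, ← coeff_zero_eq_constantCoeff_apply, map_sub, hk, coeff_zero_C, sub_self]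
    have hg'I : g' ∈ I := hsat g' (hg' ▸ I.sub_mem hg (I.mul_mem_right _ hfI))
    have hg'' := congrArg (fun p : overconvergent ℤ r => ofInt (p : ℤ⟦X⟧)) hg'
    simp only [AddSubgroupClass.coe_sub, Subring.coe_mul, coe_var, map_sub, map_mul, ofInt_C,
      ofInt_X]
      at hg''
    have hquot : ofInt (g' : ℤ⟦X⟧) = ofInt (f : ℤ⟦X⟧) * t' := by
      refine mul_left_cancel₀ (X_ne_zero (R := ℝ)) ?_
      linear_combination -hg'' + ht + ofInt (f : ℤ⟦X⟧) * ht'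
    obtain ⟨l, hl⟩ := ih g' hg'I t' hquot
    refine ⟨l, ?_⟩
    have : t = C (k : ℝ) + X * t' := by rw [← ht']; ring
    rw [this, map_add, coeff_succ_X_mul, hl, coeff_C, if_neg n.succ_ne_zero, zero_add]

end Integral

section Generator

variable {r : ℝ}

/-- `h` generates the extension of `I` to real coefficients, and `f₀ = h * F`. A unit multiple of
`F` is integral, and after truncation this multiple is corrected by an element of `I`. -/
theorem exists_mem_associated (hr0 : 0 < r) (hr1 : r < 1) {I : Ideal (overconvergent ℤ r)}
    {h : overconvergent ℝ r} (hI : ∀ g ∈ I, h ∣ toReal r g) (hh : h ∈ I.map (toReal r))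
    {f₀ : overconvergent ℤ r} (hf₀I : f₀ ∈ I) (hf₀ : coeff 0 (f₀ : ℤ⟦X⟧) ≠ 0) :
    ∃ f ∈ I, coeff 0 (f : ℤ⟦X⟧) = coeff 0 (f₀ : ℤ⟦X⟧) ∧ toReal r f ∣ h := by
  obtain ⟨F, hF⟩ := hI f₀ hf₀I
  have hF0 : coeff 0 (F : ℝ⟦X⟧) ≠ 0 := by
    intro h0
    have := congrArg (fun p : overconvergent ℝ r => coeff 0 (p : ℝ⟦X⟧)) hF
    simp only [coe_toReal, Subring.coe_mul, coeff_zero_mul, h0, mul_zero, coeff_ofInt,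
      Int.cast_eq_zero] at this
    exact hf₀ this
  set c := coeff 0 (F : ℝ⟦X⟧) with hc
  have hcc : (C c : ℝ⟦X⟧) * C c⁻¹ = 1 := by rw [← map_mul, mul_inv_cancel₀ hF0, map_one]
  have hFinv : (F : ℝ⟦X⟧) * (F : ℝ⟦X⟧)⁻¹ = 1 :=
    PowerSeries.mul_inv_cancel _ (by rwa [← coeff_zero_eq_constantCoeff_apply])
  obtain ⟨u, hu, hu0, ⟨s, hs, hus⟩, q, hq⟩ := exists_unit_mul_integral hr0 hr1
    (G := C c * (F : ℝ⟦X⟧)⁻¹) (by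
      have := congrArg (coeff 0) hFinv
      rw [coeff_zero_mul, coeff_zero_one, ← hc] at this
      rw [coeff_zero_mul, coeff_zero_C, this])
  have hq0 : coeff 0 q = 1 := by
    have := congrArg (coeff 0) hq
    rw [coeff_ofInt, coeff_zero_mul, coeff_zero_mul, hu0, coeff_zero_C, mul_one] at this
    have h1 := congrArg (coeff 0) hFinv
    rw [coeff_zero_mul, coeff_zero_one, ← hc] at h1
    rw [h1] at this
    exact_mod_cast this
  have hFq : (F : ℝ⟦X⟧) * ofInt q = C c * u := by
    rw [hq]
    linear_combination C c * u * hFinv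
  let s₁ : ℝ⟦X⟧ := C c⁻¹ * s
  have hs₁ : s₁ ∈ overconvergent ℝ r := mul_mem (C_mem _) hs
  have hus₁ : C c * u * s₁ = 1 := by
    linear_combination C c * C c⁻¹ * hus + hcc
  obtain ⟨M, hM⟩ := exists_bounded_approx hr0 hr1 hI hh
  obtain ⟨M₁, hM₁⟩ := exists_bound_sumAt (complexify_mem hs₁)
  have hM₁0 : 0 ≤ M₁ := (norm_nonneg _).trans (hM₁ 0 (by simpa using hr0.le))
  obtain ⟨N, hN⟩ : ∃ N : ℕ, r ^ (N + 1) * (M₁ * M) < 1 := by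
    have : Tendsto (fun n : ℕ => r ^ (n + 1) * (M₁ * M)) atTop (nhds (0 * (M₁ * M))) :=
      ((tendsto_pow_atTop_nhds_zero_of_lt_one hr0.le hr1).comp
        (tendsto_add_atTop_nat 1)).mul_const (M₁ * M)
    rw [zero_mul] at this
    exact (this.eventually_lt_const one_pos).exists
  obtain ⟨t, ht⟩ : ∃ t : ℤ⟦X⟧, q = X ^ (N + 1) * t + (q.trunc (N + 1) : ℤ⟦X⟧) :=
    ⟨_, eq_X_pow_mul_shift_add_trunc _ _⟩
  set p : overconvergent ℤ r := ⟨(q.trunc (N + 1) : ℤ⟦X⟧), polynomial_mem _⟩ with hp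
  have hqt : ofInt q = X ^ (N + 1) * ofInt t + ofInt (p : ℤ⟦X⟧) := by
    conv_lhs => rw [ht]
    rw [map_add, map_mul, map_pow, ofInt_X]
  have hbA : (F : ℝ⟦X⟧) * ofInt t ∈ overconvergent ℝ r := by
    refine of_X_pow_mul (k := N + 1) ?_
    have : X ^ (N + 1) * ((F : ℝ⟦X⟧) * ofInt t) = C c * u - (F : ℝ⟦X⟧) * ofInt (p : ℤ⟦X⟧) := by
      rw [← hFq, hqt]
      ring
    rw [this]
    exact sub_mem (mul_mem (C_mem _) hu) (mul_mem F.2 (ofInt_mem_iff.mpr p.2))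
  obtain ⟨y, hyI, e, he, heM⟩ := hM ⟨_, hbA⟩
  have he' := congrArg (Subtype.val) he
  simp only [AddSubgroupClass.coe_sub, Subring.coe_mul, coe_toReal] at he'
  obtain ⟨v, hv, hev⟩ := exists_inverse_one_add_X_pow_mul (k := N + 1) (M := M₁ * M) hr0
    (neg_mem (mul_mem hs₁ e.2)) (fun z hz => by
      rw [map_neg, sumAt_neg, norm_neg, map_mul,
        sumAt_mul (complexify_mem hs₁) (complexify_mem e.2) hz, norm_mul]
      exact mul_le_mul (hM₁ z hz) (heM z hz) (norm_nonneg _) hM₁0) hN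
  have hF' := congrArg (Subtype.val) hF
  simp only [Subring.coe_mul, coe_toReal] at hF'
  refine ⟨f₀ * p + var r ^ (N + 1) * y, I.add_mem (I.mul_mem_right _ hf₀I) (I.mul_mem_left _ hyI),
    ?_, ⟨⟨s₁ * v, mul_mem hs₁ hv⟩, Subtype.ext ?_⟩⟩
  · have hp0 : coeff 0 (p : ℤ⟦X⟧) = 1 := by
      rw [← hq0, hp, Polynomial.coeff_coe, coeff_trunc, if_pos N.succ_pos]
    rw [Subring.coe_add, Subring.coe_mul, Subring.coe_mul, map_add, coeff_zero_mul, coeff_zero_mul,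
      hp0, SubmonoidClass.coe_pow, coe_var, pow_succ, coeff_zero_mul, coeff_zero_X]
    simp
  · simp only [Subring.coe_mul, coe_toReal, Subring.coe_add, SubmonoidClass.coe_pow, coe_var,
      map_add, map_mul, map_pow, ofInt_X]
    rw [hF']
    have hpoly : (F : ℝ⟦X⟧) * ofInt (p : ℤ⟦X⟧) =
        C c * u - X ^ (N + 1) * ((F : ℝ⟦X⟧) * ofInt t) := by
      rw [← hFq, hqt]
      ring
    linear_combination (-(h : ℝ⟦X⟧) * s₁ * v) * hpoly + X ^ (N + 1) * s₁ * v * he'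
      - (h : ℝ⟦X⟧) * hev - (h : ℝ⟦X⟧) * v * hus₁

theorem exists_generator (hr0 : 0 < r) (hr1 : r < 1) {I : Ideal (overconvergent ℤ r)}
    (hI : I ≠ ⊥) (hsat : ∀ g, var r * g ∈ I → g ∈ I) : ∃ f ∈ I, ∀ g ∈ I, f ∣ g := by
  obtain ⟨f₀, hf₀I, hf₀, hmin⟩ := exists_minimal_constant_coeff hI hsat
  obtain ⟨h, hh⟩ := (isPrincipalIdealRing_real hr0).principal (I.map (toReal r))
  have hhmem : h ∈ I.map (toReal r) := by
    rw [hh]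
    exact Submodule.mem_span_singleton_self h
  have hdvd : ∀ g ∈ I, h ∣ toReal r g := by
    intro g hg
    have := Ideal.mem_map_of_mem (toReal r) hg
    rw [hh] at this
    exact Ideal.mem_span_singleton.mp this
  obtain ⟨f, hfI, hf, hfh⟩ := exists_mem_associated hr0 hr1 hdvd hhmem hf₀I hf₀
  refine ⟨f, hfI, fun g hg => ?_⟩
  obtain ⟨t, ht⟩ := hfh.trans (hdvd g hg)
  have ht' := congrArg Subtype.val ht
  simp only [Subring.coe_mul, coe_toReal] at ht'
  obtain ⟨q, hq⟩ := exists_ofInt_eq fun n =>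
    coeff_quotient_integral hsat hfI (hf ▸ hf₀) (fun g hg => hf ▸ hmin g hg) n g hg t ht'
  refine ⟨⟨q, ofInt_mem_iff.mp (hq ▸ t.2)⟩, Subtype.ext (ofInt_injective ?_)⟩
  rw [ht', Subring.coe_mul, map_mul, hq]

end Generator

section Laurent

open HahnSeries

variable {r : ℝ}

theorem single_natCast_add (k l : ℕ) : (single ((k + l : ℕ) : ℤ) 1 : LaurentSeries ℤ) =
    single (k : ℤ) 1 * single (l : ℤ) 1 := by
  rw [single_mul_single, mul_one, Nat.cast_add]

/-- The overconvergent integral power series with powers of the variable inverted. -/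
def laurent (r : ℝ) : Subring (LaurentSeries ℤ) where
  carrier := {f | ∃ k : ℕ, ∃ p ∈ overconvergent ℤ r, single (k : ℤ) 1 * f = ofPowerSeries ℤ ℤ p}
  mul_mem' := by
    rintro f g ⟨k, p, hp, hf⟩ ⟨l, q, hq, hg⟩
    refine ⟨k + l, p * q, mul_mem hp hq, ?_⟩
    rw [single_natCast_add, map_mul, ← hf, ← hg]
    ring
  add_mem' := by
    rintro f g ⟨k, p, hp, hf⟩ ⟨l, q, hq, hg⟩
    refine ⟨k + l, X ^ l * p + X ^ k * q,
      add_mem (mul_mem (pow_mem X_mem _) hp) (mul_mem (pow_mem X_mem _) hq), ?_⟩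
    rw [single_natCast_add, map_add, map_mul, map_mul, ← hf, ← hg, ofPowerSeries_X_pow,
      ofPowerSeries_X_pow]
    ring
  neg_mem' := by
    rintro f ⟨k, p, hp, hf⟩
    exact ⟨k, -p, neg_mem hp, by rw [map_neg, ← hf, mul_neg]⟩
  one_mem' := ⟨0, 1, one_mem _, by simp⟩
  zero_mem' := ⟨0, 0, zero_mem _, by simp⟩

/-- An overconvergent power series regarded as a Laurent series. -/
noncomputable def toLaurent (r : ℝ) : overconvergent ℤ r →+* laurent r :=
  ((ofPowerSeries ℤ ℤ).comp (overconvergent ℤ r).subtype).codRestrict _ fun p =>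
    ⟨0, p, p.2, by simp⟩

@[simp]
theorem coe_toLaurent (p : overconvergent ℤ r) :
    (toLaurent r p : LaurentSeries ℤ) = ofPowerSeries ℤ ℤ p := rfl

theorem isUnit_toLaurent_var : IsUnit (toLaurent r (var r)) := by
  refine IsUnit.of_mul_eq_one ⟨single (-1) 1, 1, 1, one_mem _, ?_⟩ (Subtype.ext ?_)
  · rw [single_mul_single]
    simp
  · simp [ofPowerSeries_X, single_mul_single]

theorem exists_toLaurent_eq (x : laurent r) :
    ∃ k : ℕ, ∃ p, toLaurent r (var r) ^ k * x = toLaurent r p := by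
  obtain ⟨k, p, hp, h⟩ := x.2
  refine ⟨k, ⟨p, hp⟩, Subtype.ext ?_⟩
  rw [Subring.coe_mul, SubmonoidClass.coe_pow, coe_toLaurent, coe_var, ← map_pow,
    ofPowerSeries_X_pow, h, coe_toLaurent]

theorem isPrincipalIdealRing_laurent (hr0 : 0 < r) (hr1 : r < 1) :
    IsPrincipalIdealRing (laurent r) := by
  refine ⟨fun J => ?_⟩
  by_cases hJ : J = ⊥
  · rw [hJ]
    infer_instance
  obtain ⟨x, hxJ, hx⟩ := Submodule.exists_mem_ne_zero_of_ne_bot hJ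
  have hunit (k : ℕ) := (isUnit_toLaurent_var (r := r)).pow k
  have hI : J.comap (toLaurent r) ≠ ⊥ := by
    intro h
    obtain ⟨k, p, hp⟩ := exists_toLaurent_eq x
    have hpI : p ∈ J.comap (toLaurent r) := by
      rw [Ideal.mem_comap, ← hp]
      exact J.mul_mem_left _ hxJ
    rw [h, Ideal.mem_bot] at hpI
    rw [hpI, map_zero, (hunit k).mul_right_eq_zero] at hp
    exact hx hp
  obtain ⟨f, hfI, hf⟩ := exists_generator hr0 hr1 hI fun g hg => by
    rw [Ideal.mem_comap, map_mul] at hg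
    exact (Ideal.unit_mul_mem_iff_mem J isUnit_toLaurent_var).mp hg
  refine ⟨toLaurent r f, le_antisymm (fun y hy => ?_) ?_⟩
  · obtain ⟨k, p, hp⟩ := exists_toLaurent_eq y
    have hpI : p ∈ J.comap (toLaurent r) := by
      rw [Ideal.mem_comap, ← hp]
      exact J.mul_mem_left _ hy
    rw [← Ideal.span, Ideal.mem_span_singleton, ← (hunit k).dvd_mul_left, hp]
    exact map_dvd _ (hf p hpI)
  · exact (Ideal.span_singleton_le_iff_mem J).mpr hfI

theorem exists_single_mul_eq (f : LaurentSeries ℤ) :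
    ∃ k : ℕ, ∃ p : ℤ⟦X⟧, single (k : ℤ) 1 * f = ofPowerSeries ℤ ℤ p := by
  obtain ⟨l, hl⟩ := Int.eq_ofNat_of_zero_le
    (show 0 ≤ ((-f.order).toNat : ℤ) + f.order by have := Int.self_le_toNat (-f.order); omega)
  refine ⟨(-f.order).toNat, X ^ l * f.powerSeriesPart, ?_⟩
  rw [map_mul, ofPowerSeries_X_pow, LaurentSeries.ofPowerSeries_powerSeriesPart, ← mul_assoc,
    single_mul_single, ← hl, add_neg_cancel_right, mul_one]

theorem tendsto_iff_of_single_mul_eq {f : LaurentSeries ℤ} {k : ℕ} {p : ℤ⟦X⟧}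
    (hp : single (k : ℤ) 1 * f = ofPowerSeries ℤ ℤ p) {ρ : ℝ} (hρ : 0 < ρ) :
    Tendsto (fun n : ℤ => |((f.coeff n : ℤ) : ℝ)| * ρ ^ n) atTop (nhds 0) ↔
      Tendsto (fun n : ℕ => ‖coeff n p‖ * ρ ^ n) atTop (nhds 0) := by
  have hcoeff (n : ℕ) : coeff n p = f.coeff ((n : ℤ) - k) := by
    rw [← LaurentSeries.coeff_coe_powerSeries, ← hp, ← sub_add_cancel (n : ℤ) k, mul_comm,
      coeff_mul_single_add, mul_one, sub_add_cancel]
  have hterm (n : ℕ) : |((f.coeff ((n : ℤ) - k) : ℤ) : ℝ)| * ρ ^ ((n : ℤ) - k) =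
      ‖coeff n p‖ * ρ ^ n * (ρ ^ k)⁻¹ := by
    rw [hcoeff, Int.norm_eq_abs, zpow_sub₀ hρ.ne', zpow_natCast, zpow_natCast, div_eq_mul_inv,
      mul_assoc]
  rw [← (OrderIso.subRight (k : ℤ)).map_atTop, tendsto_map'_iff, ← Nat.map_cast_int_atTop,
    tendsto_map'_iff]
  simp only [Function.comp_def, OrderIso.subRight_apply, hterm]
  constructor
  · intro h
    simpa [mul_assoc, hρ.ne'] using h.mul_const (ρ ^ k)
  · intro h
    simpa using h.mul_const (ρ ^ k)⁻¹

theorem mem_laurent_of_mem_ZTgt (hr0 : 0 < r) {f : LaurentSeries ℤ} (hf : f ∈ ZTgt r) :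
    f ∈ laurent r := by
  obtain ⟨r', hr', -, ht⟩ := hf
  have hr'0 := hr0.trans hr'
  obtain ⟨k, p, hp⟩ := exists_single_mul_eq f
  rw [tendsto_iff_of_single_mul_eq hp hr'0] at ht
  obtain ⟨ρ, hρ, hρ'⟩ := exists_between hr'
  obtain ⟨B, hB⟩ := ht.bddAbove_range
  have hρ0 := hr0.trans hρ
  refine ⟨k, p, ⟨ρ, hρ0, hρ, Summable.of_nonneg_of_le (fun n => by positivity) (fun n => ?_)
    ((summable_geometric_of_lt_one (by positivity) ((div_lt_one hr'0).mpr hρ')).mul_left B)⟩, hp⟩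
  calc ‖coeff n p‖ * ρ ^ n = ‖coeff n p‖ * r' ^ n * (ρ / r') ^ n := by
        rw [div_pow]
        field_simp
    _ ≤ B * (ρ / r') ^ n := by
        gcongr
        exact hB ⟨n, rfl⟩

theorem mem_ZTgt_of_mem_laurent (hr0 : 0 < r) (hr1 : r < 1) {f : LaurentSeries ℤ}
    (hf : f ∈ laurent r) : f ∈ ZTgt r := by
  obtain ⟨k, p, ⟨ρ, -, hrρ, hs⟩, hp⟩ := hf
  obtain ⟨r', hr', hr'ρ⟩ := exists_between (lt_min hrρ hr1)
  have hr'0 := hr0.trans hr'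
  refine ⟨r', hr', hr'ρ.trans_le (min_le_right _ _), ?_⟩
  rw [tendsto_iff_of_single_mul_eq hp hr'0]
  have hs' : Summable fun n => ‖coeff n p‖ * r' ^ n :=
    hs.of_nonneg_of_le (fun n => by positivity) fun n => by
      gcongr
      exact (hr'ρ.trans_le (min_le_left _ _)).le
  exact hs'.tendsto_atTop_zero

end Laurent

end overconvergent

/-- For every `0 < r < 1`, the set `ℤ((T))_{>r}` is a subring of the ring of formal
Laurent series over `ℤ`, and this subring is a principal ideal domain. -/
theorem ZTgt_is_subring_and_pid (r : ℝ) (hr0 : 0 < r) (hr1 : r < 1) :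
    ∃ S : Subring (LaurentSeries ℤ),
      (S : Set (LaurentSeries ℤ)) = ZTgt r ∧ IsDomain S ∧ IsPrincipalIdealRing S :=
  ⟨overconvergent.laurent r,
    Set.ext fun _ => ⟨overconvergent.mem_ZTgt_of_mem_laurent hr0 hr1,
      overconvergent.mem_laurent_of_mem_ZTgt hr0⟩,
    inferInstance, overconvergent.isPrincipalIdealRing_laurent hr0 hr1⟩
end

section
/- Let 0 < r < 1 and let p be a prime number. The map sending f ∈ ℤ((T))_{>r} to the Laurent series over ℤ/pℤ whose n-th coefficient is the reduction of f.coeff n modulo p is a well-defined ring homomorphism from ℤ((T))_{>r} onto the field of formal Laurent series 𝔽_p((T)) (LaurentSeries (ZMod p)); it is surjective, and its kernel is the principal ideal of ℤ((T))_{>r} generated by p. -/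
open Filter

/-- The ring homomorphism on Hahn series induced by a ring homomorphism of coefficients. -/
def HahnSeries.mapCoeffRingHom {Γ R S : Type*} [AddCommMonoid Γ] [PartialOrder Γ]
    [IsOrderedCancelAddMonoid Γ] [Semiring R] [Semiring S] (f : R →+* S) :
    HahnSeries Γ R →+* HahnSeries Γ S where
  toFun x := x.map f
  map_zero' := by ext; simp
  map_one' := by
    ext n
    simp only [HahnSeries.map_coeff, HahnSeries.coeff_one]
    split_ifs <;> simp
  map_add' x y := by ext; simp
  map_mul' x y := HahnSeries.map_mul (f : R →ₙ+* S)

theorem tendsto_zpow_atTop_nhds_zero_of_lt_one {x : ℝ} (h0 : 0 ≤ x) (h1 : x < 1) :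
    Tendsto (fun n : ℤ => x ^ n) atTop (nhds 0) := by
  have h : Tendsto Int.toNat atTop atTop :=
    tendsto_atTop_atTop.2 fun b => ⟨b, fun a ha => by omega⟩
  refine ((tendsto_pow_atTop_nhds_zero_of_lt_one h0 h1).comp h).congr' ?_
  filter_upwards [eventually_ge_atTop 0] with n hn
  rw [Function.comp_apply, ← zpow_natCast, Int.toNat_of_nonneg hn]

/-- Laurent series with bounded integer coefficients lie in `ℤ((T))_{>r}`. -/
theorem mem_ZTgt_of_abs_coeff_le {r : ℝ} (hr0 : 0 < r) (hr1 : r < 1) {f : LaurentSeries ℤ}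
    {C : ℤ} (hf : ∀ n, |f.coeff n| ≤ C) : f ∈ ZTgt r := by
  obtain ⟨x, hrx, hx1⟩ := exists_between hr1
  have hx0 : 0 < x := hr0.trans hrx
  refine ⟨x, hrx, hx1, ?_⟩
  have h := (tendsto_zpow_atTop_nhds_zero_of_lt_one hx0.le hx1).const_mul (C : ℝ)
  rw [mul_zero] at h
  refine squeeze_zero (fun n => by positivity) (fun n => ?_) h
  gcongr
  exact_mod_cast hf n

/-- A Laurent series whose coefficients are dominated by those of an element of
`ℤ((T))_{>r}` lies in `ℤ((T))_{>r}`. -/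
theorem mem_ZTgt_of_abs_coeff_le_abs_coeff {r : ℝ} (hr0 : 0 < r) {f g : LaurentSeries ℤ}
    (hg : g ∈ ZTgt r) (hfg : ∀ n, |f.coeff n| ≤ |g.coeff n|) : f ∈ ZTgt r := by
  obtain ⟨x, hrx, hx1, h⟩ := hg
  have hx0 : 0 < x := hr0.trans hrx
  refine ⟨x, hrx, hx1, squeeze_zero (fun n => by positivity) (fun n => ?_) h⟩
  exact mul_le_mul_of_nonneg_right (by exact_mod_cast hfg n) (by positivity)

theorem LaurentSeries.coeff_natCast_mul (m : ℕ) (f : LaurentSeries ℤ) (n : ℤ) :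
    ((m : LaurentSeries ℤ) * f).coeff n = m * f.coeff n := by
  rw [← nsmul_eq_mul, HahnSeries.coeff_nsmul, Pi.smul_apply, nsmul_eq_mul]

/-- For `0 < r < 1` and a prime `p`, coefficientwise reduction mod `p` gives a
well-defined surjective ring homomorphism `ℤ((T))_{>r} → 𝔽_p((T))` whose kernel is
the principal ideal generated by `p`. -/
theorem reduction_mod_p_surjective_ker_span_p
    (r : ℝ) (hr0 : 0 < r) (hr1 : r < 1) (p : ℕ) (hp : p.Prime)
    (S : Subring (LaurentSeries ℤ)) (hS : (S : Set (LaurentSeries ℤ)) = ZTgt r) :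
    ∃ φ : S →+* LaurentSeries (ZMod p),
      (∀ (f : S) (n : ℤ),
        (φ f).coeff n = (((f : LaurentSeries ℤ).coeff n : ℤ) : ZMod p)) ∧
      Function.Surjective φ ∧
      RingHom.ker φ = Ideal.span {((p : ℕ) : S)} := by
  have : Fact p.Prime := ⟨hp⟩
  have hmem (f : LaurentSeries ℤ) : f ∈ S ↔ f ∈ ZTgt r := by rw [← hS, SetLike.mem_coe]
  refine ⟨(HahnSeries.mapCoeffRingHom (Int.castRingHom (ZMod p))).comp S.subtype,
    fun f n => rfl, fun g => ?_, ?_⟩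
  · let lift : ZeroHom (ZMod p) ℤ := ⟨fun x => x.val, by simp⟩
    refine ⟨⟨g.map lift, (hmem _).2 <| mem_ZTgt_of_abs_coeff_le hr0 hr1 (C := p) fun n => ?_⟩, ?_⟩
    · change |((g.coeff n).val : ℤ)| ≤ p
      rw [Nat.abs_cast]
      exact_mod_cast (ZMod.val_lt _).le
    · ext n
      change (((g.coeff n).val : ℤ) : ZMod p) = g.coeff n
      simp
  · ext f
    rw [RingHom.mem_ker, Ideal.mem_span_singleton]
    constructor
    · intro hf
      have hdvd (n : ℤ) : (p : ℤ) ∣ (f : LaurentSeries ℤ).coeff n :=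
        (ZMod.intCast_zmod_eq_zero_iff_dvd _ p).1 (congrArg (fun g => HahnSeries.coeff g n) hf)
      let quot : ZeroHom ℤ ℤ := ⟨fun x => x / p, by simp⟩
      refine ⟨⟨(f : LaurentSeries ℤ).map quot, (hmem _).2 <|
        mem_ZTgt_of_abs_coeff_le_abs_coeff hr0 ((hmem _).1 f.2) fun n => ?_⟩, ?_⟩
      · exact Int.abs_ediv_le_abs _ _
      · apply Subtype.ext
        ext n
        rw [Subring.coe_mul, Subring.coe_natCast, LaurentSeries.coeff_natCast_mul]
        exact (Int.mul_ediv_cancel' (hdvd n)).symm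
    · rintro ⟨g, rfl⟩
      ext n
      change ((((p : S) * g : S) : LaurentSeries ℤ).coeff n : ZMod p) = 0
      rw [Subring.coe_mul, Subring.coe_natCast, LaurentSeries.coeff_natCast_mul]
      simp
end

section
/- Let 0 < r < 1, let p be a prime number, and let x ∈ ℚ_p with 0 < ‖x‖ < 1 (a topologically nilpotent unit of the p-adic numbers). Then: (a) for every f ∈ ℤ((T))_{>r}, the family n ↦ (f.coeff n : ℚ_p)·xⁿ (n ∈ ℤ) is summable in ℚ_p, and the map θ_x sending f to its sum is a ring homomorphism ℤ((T))_{>r} → ℚ_p; (b) θ_x is surjective; (c) there exists a nonzerodivisor g ∈ ℤ((T))_{>r} such that the kernel of θ_x equals the principal ideal generated by g. -/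
open Filter

/-- Strong recursion in existential form. -/
theorem exists_seq_of_forall_exists_of_local {α : Type*} [Inhabited α]
    (P : ℕ → (ℕ → α) → α → Prop)
    (hloc : ∀ n s t a, (∀ m < n, s m = t m) → P n s a → P n t a)
    (hex : ∀ n s, (∀ m < n, P m s (s m)) → ∃ a, P n s a) :
    ∃ s : ℕ → α, ∀ n, P n s (s n) := by
  classical
  choose! c hc using hex
  let u : ℕ → ℕ → α := fun n => Nat.rec (fun _ => default) (fun n v => Function.update v n (c n v)) n
  have hu : ∀ n, u (n + 1) = Function.update (u n) n (c n (u n)) := fun n => rfl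
  have hstab : ∀ m n, m < n → u n m = u (m + 1) m := by
    intro m n h
    induction n, h using Nat.le_induction with
    | base => rfl
    | succ n h ih => rw [hu, Function.update_of_ne (by omega), ih]
  refine ⟨fun m => u (m + 1) m, fun n => ?_⟩
  induction n using Nat.strong_induction_on with
  | _ n ih =>
    have hn : P n (u n) (c n (u n)) := by
      apply hc
      intro m hm
      rw [hstab m n hm]
      exact hloc m _ _ _ (fun l hl => (hstab l n (hl.trans hm)).symm) (ih m hm)
    have h : u (n + 1) n = c n (u n) := by rw [hu, Function.update_self]
    change P n _ (u (n + 1) n)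
    rw [h]
    exact hloc n _ _ _ (fun m hm => hstab m n hm) hn

/-- A `p`-adic integer is congruent modulo `p ^ k` to an integer in any prescribed real window
of radius `p ^ k`. -/
theorem exists_int_norm_add_le_abs_add_le {p : ℕ} [Fact p.Prime] (k : ℕ) {y : ℚ_[p]}
    (hy : ‖y‖ ≤ 1) (t : ℝ) :
    ∃ b : ℤ, ‖y + b‖ ≤ (p : ℝ) ^ (-k : ℤ) ∧ |(b : ℝ) + t| ≤ (p : ℝ) ^ k := by
  have hp : (0 : ℝ) < (p : ℝ) ^ k := pow_pos (mod_cast (Fact.out : p.Prime).pos) k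
  let z : ℤ_[p] := -⟨y, hy⟩
  set a : ℕ := z.appr k
  have ha : ‖(a : ℚ_[p]) + y‖ ≤ (p : ℝ) ^ (-k : ℤ) := by
    have h := (PadicInt.norm_le_pow_iff_mem_span_pow _ k).2 (PadicInt.appr_spec k z)
    rw [← norm_neg] at h
    convert h using 1
    rw [PadicInt.norm_def]
    congr 1
    rw [neg_sub, PadicInt.coe_sub, PadicInt.coe_natCast, show (z : ℚ_[p]) = -y from rfl,
      sub_neg_eq_add]
  refine ⟨a - p ^ k * ⌊(a + t) / (p : ℝ) ^ k⌋, ?_, ?_⟩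
  · have h2 : ‖((-((p : ℤ) ^ k * ⌊(a + t) / (p : ℝ) ^ k⌋) : ℤ) : ℚ_[p])‖ ≤ (p : ℝ) ^ (-k : ℤ) := by
      rw [Padic.norm_int_le_pow_iff_dvd]
      exact (dvd_mul_right _ _).neg_right
    have h3 := (Padic.nonarchimedean _ _).trans (max_le ha h2)
    rwa [Int.cast_neg, add_comm (a : ℚ_[p]) y, add_assoc, ← sub_eq_add_neg, ← Int.cast_natCast a,
      ← Int.cast_sub] at h3
  · have h1 := Int.floor_le ((a + t) / (p : ℝ) ^ k)
    have h2 := (Int.lt_floor_add_one ((a + t) / (p : ℝ) ^ k)).le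
    rw [le_div_iff₀ hp] at h1
    rw [div_le_iff₀ hp] at h2
    push_cast
    rw [abs_le]
    constructor <;> nlinarith

/-- Power series solutions of `A' = K * A` grow subexponentially if `K` has linear growth. -/
theorem exists_bound_of_derivative_eq_mul {A K : PowerSeries ℝ}
    (hA : PowerSeries.derivative ℝ A = K * A)
    (hK : ∀ n, |K.coeff n| ≤ n + 1) {ρ : ℝ} (h0 : 0 < ρ) (h1 : ρ < 1) :
    ∃ C, ∀ n, |A.coeff n| * ρ ^ n ≤ C := by
  have hs : Summable fun n : ℕ => ((n : ℝ) + 1) * ρ ^ n := by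
    have h2 := summable_pow_mul_geometric_of_norm_lt_one 1 (r := ρ)
      (by rwa [Real.norm_of_nonneg h0.le])
    simp only [pow_one] at h2
    simpa [add_mul] using h2.add (summable_geometric_of_lt_one h0.le h1)
  set B := ∑' n : ℕ, ((n : ℝ) + 1) * ρ ^ n
  obtain ⟨M, hM⟩ := exists_nat_ge B
  set C := ∑ i ∈ Finset.range (M + 1), |A.coeff i| * ρ ^ i
  have hC : 0 ≤ C := Finset.sum_nonneg fun i _ => by positivity
  refine ⟨C, fun n => ?_⟩
  induction n using Nat.strong_induction_on with
  | _ n ih =>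
    by_cases hn : n < M + 1
    · exact Finset.single_le_sum (f := fun i => |A.coeff i| * ρ ^ i)
        (fun i _ => by positivity) (Finset.mem_range.2 hn)
    obtain ⟨m, rfl⟩ : ∃ m, n = m + 1 := ⟨n - 1, by omega⟩
    have h := congrArg (PowerSeries.coeff m) hA
    rw [PowerSeries.coeff_derivative, PowerSeries.coeff_mul] at h
    have hm : (M : ℝ) ≤ m + 1 := by exact_mod_cast (by omega : M ≤ m + 1)
    have key : |A.coeff (m + 1)| * ρ ^ (m + 1) * (m + 1) ≤ C * (m + 1) := by
      calc |A.coeff (m + 1)| * ρ ^ (m + 1) * (m + 1)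
          = |∑ q ∈ Finset.HasAntidiagonal.antidiagonal m, K.coeff q.1 * A.coeff q.2| * ρ ^ (m + 1) := by
            rw [← h, abs_mul, abs_of_nonneg (by positivity : (0 : ℝ) ≤ m + 1)]; ring
        _ ≤ (∑ q ∈ Finset.HasAntidiagonal.antidiagonal m, |K.coeff q.1| * |A.coeff q.2|) * ρ ^ (m + 1) := by
            gcongr
            simpa only [abs_mul] using Finset.abs_sum_le_sum_abs
              (fun q : ℕ × ℕ => K.coeff q.1 * A.coeff q.2) (Finset.HasAntidiagonal.antidiagonal m)
        _ ≤ (∑ q ∈ Finset.HasAntidiagonal.antidiagonal m, |K.coeff q.1| * |A.coeff q.2|) * ρ ^ m :=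
            mul_le_mul_of_nonneg_left (pow_le_pow_of_le_one h0.le h1.le (Nat.le_succ m))
              (Finset.sum_nonneg fun i _ => by positivity)
        _ ≤ ∑ q ∈ Finset.HasAntidiagonal.antidiagonal m, (((q.1 : ℝ) + 1) * ρ ^ q.1) * C := by
            rw [Finset.sum_mul]
            refine Finset.sum_le_sum fun q hq => ?_
            have hq' := Finset.HasAntidiagonal.mem_antidiagonal.1 hq
            calc |K.coeff q.1| * |A.coeff q.2| * ρ ^ m
                = (|K.coeff q.1| * ρ ^ q.1) * (|A.coeff q.2| * ρ ^ q.2) := by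
                  rw [← hq', pow_add]; ring
              _ ≤ _ := by
                  gcongr
                  · exact hK _
                  · exact ih _ (by omega)
        _ = (∑ i ∈ Finset.range (m + 1), ((i : ℝ) + 1) * ρ ^ i) * C := by
            rw [← Finset.sum_mul, Finset.Nat.sum_antidiagonal_eq_sum_range_succ_mk]
        _ ≤ B * C := by
            gcongr
            exact hs.sum_le_tsum _ fun i _ => by positivity
        _ ≤ C * (m + 1) := by
            rw [mul_comm]; gcongr; linarith
    exact le_of_mul_le_mul_right key (by positivity)

section Evaluation

variable {p : ℕ} [Fact p.Prime] {x : ℚ_[p]}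

theorem summable_norm_coeff_mul_zpow (hx0 : 0 < ‖x‖) (hx1 : ‖x‖ < 1) (f : LaurentSeries ℤ) :
    Summable fun n : ℤ => ‖((f.coeff n : ℤ) : ℚ_[p]) * x ^ n‖ := by
  have hx : x ≠ 0 := norm_pos_iff.1 hx0
  rw [← (Equiv.addRight f.order).summable_iff,
    ← (Nat.cast_injective (R := ℤ)).summable_iff]
  · refine Summable.of_nonneg_of_le (fun _ => norm_nonneg _) (fun n => ?_)
      ((summable_geometric_of_lt_one hx0.le hx1).mul_left (‖x‖ ^ f.order))
    simp only [Function.comp_apply, Equiv.coe_addRight, norm_mul, norm_zpow]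
    rw [zpow_add₀ hx0.ne', zpow_natCast, mul_comm (‖x‖ ^ f.order)]
    exact mul_le_of_le_one_left (by positivity) (Padic.norm_int_le_one _)
  · intro n hn
    have : n < 0 := by
      by_contra! h
      exact hn ⟨n.toNat, Int.toNat_of_nonneg h⟩
    simp [HahnSeries.coeff_eq_zero_of_lt_order (show n + f.order < f.order by omega)]

theorem LaurentSeries.exists_finset_coeff_mul_eq {R : Type*} [Semiring R]
    (f g : LaurentSeries R) (n : ℤ) :
    ∃ s : Finset ℤ, (∀ i ∉ s, f.coeff i * g.coeff (n - i) = 0) ∧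
      (f * g).coeff n = ∑ i ∈ s, f.coeff i * g.coeff (n - i) := by
  classical
  have hmem : ∀ q ∈ Finset.antidiagonal f.isPWO_support g.isPWO_support n, q.2 = n - q.1 := by
    intro q hq
    rw [← (Finset.mem_antidiagonal.1 hq).2.2, add_sub_cancel_left]
  refine ⟨(Finset.antidiagonal f.isPWO_support g.isPWO_support n).image Prod.fst, ?_, ?_⟩
  · intro i hi
    by_contra h
    refine hi (Finset.mem_image.2 ⟨(i, n - i), ?_, rfl⟩)
    rw [Finset.mem_antidiagonal]
    exact ⟨left_ne_zero_of_mul h, right_ne_zero_of_mul h, by simp⟩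
  · rw [HahnSeries.coeff_mul, Finset.sum_image]
    · exact Finset.sum_congr rfl fun q hq => by rw [hmem q hq]
    · intro a ha b hb hab
      exact Prod.ext hab (by rw [hmem a ha, hmem b hb, hab])

/-- Evaluation of integral Laurent series at a topologically nilpotent unit of `ℚ_[p]`. -/
noncomputable def padicEval (hx0 : 0 < ‖x‖) (hx1 : ‖x‖ < 1) : LaurentSeries ℤ →+* ℚ_[p] where
  toFun f := ∑' n : ℤ, ((f.coeff n : ℤ) : ℚ_[p]) * x ^ n
  map_zero' := by simp
  map_one' := by
    rw [tsum_eq_single 0]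
    · simp
    · intro n hn
      simp [HahnSeries.coeff_one, hn]
  map_add' f g := by
    rw [← (summable_norm_coeff_mul_zpow hx0 hx1 f).of_norm.tsum_add
      (summable_norm_coeff_mul_zpow hx0 hx1 g).of_norm]
    simp [add_mul]
  map_mul' f g := by
    have hx : x ≠ 0 := norm_pos_iff.1 hx0
    have hf := summable_norm_coeff_mul_zpow hx0 hx1 f
    have hg := summable_norm_coeff_mul_zpow hx0 hx1 g
    let e : ℤ × ℤ ≃ ℤ × ℤ :=
      { toFun := fun q => (q.2, q.1 - q.2)
        invFun := fun q => (q.1 + q.2, q.1)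
        left_inv := fun q => by simp
        right_inv := fun q => by simp }
    have hs := summable_mul_of_summable_norm hf hg
    have hse := (e.summable_iff).2 hs
    rw [Function.comp_def] at hse
    rw [tsum_mul_tsum_of_summable_norm hf hg, ← e.tsum_eq, hse.tsum_prod]
    refine tsum_congr fun n => ?_
    obtain ⟨s, hs0, hs1⟩ := LaurentSeries.exists_finset_coeff_mul_eq f g n
    have hterm : ∀ i : ℤ, ((f.coeff i : ℤ) : ℚ_[p]) * x ^ i * (((g.coeff (n - i) : ℤ) : ℚ_[p])
        * x ^ (n - i)) = ((f.coeff i * g.coeff (n - i) : ℤ) : ℚ_[p]) * x ^ n := by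
      intro i
      have hxn : x ^ n = x ^ i * x ^ (n - i) := by rw [← zpow_add₀ hx, add_sub_cancel]
      rw [hxn]
      push_cast
      ring
    simp only [e, Equiv.coe_fn_mk, hterm]
    rw [tsum_eq_sum (s := s) fun i hi => by rw [hs0 i hi]; simp, hs1, ← Finset.sum_mul,
      ← Int.cast_sum]

theorem padicEval_apply (hx0 : 0 < ‖x‖) (hx1 : ‖x‖ < 1) (f : LaurentSeries ℤ) :
    padicEval hx0 hx1 f = ∑' n : ℤ, ((f.coeff n : ℤ) : ℚ_[p]) * x ^ n := rfl

theorem padicEval_single (hx0 : 0 < ‖x‖) (hx1 : ‖x‖ < 1) (m a : ℤ) :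
    padicEval hx0 hx1 (HahnSeries.single m a) = a * x ^ m := by
  rw [padicEval_apply, tsum_eq_single m]
  · simp
  · intro n hn
    simp [HahnSeries.coeff_single_of_ne hn]

theorem hasSum_padicEval_coe (hx0 : 0 < ‖x‖) (hx1 : ‖x‖ < 1) (F : PowerSeries ℤ) :
    HasSum (fun n : ℕ => ((F.coeff n : ℤ) : ℚ_[p]) * x ^ n)
      (padicEval hx0 hx1 (F : LaurentSeries ℤ)) := by
  have h := (summable_norm_coeff_mul_zpow hx0 hx1 (F : LaurentSeries ℤ)).of_norm.hasSum
  rw [← (Nat.cast_injective (R := ℤ)).hasSum_iff] at h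
  · simpa [Function.comp_def, padicEval_apply] using h
  · intro n hn
    have : n < 0 := by
      by_contra! h
      exact hn ⟨n.toNat, Int.toNat_of_nonneg h⟩
    simp [PowerSeries.coeff_coe, this]

theorem norm_padicEval_coe_le_one (hx0 : 0 < ‖x‖) (hx1 : ‖x‖ < 1) (F : PowerSeries ℤ) :
    ‖padicEval hx0 hx1 (F : LaurentSeries ℤ)‖ ≤ 1 := by
  rw [← (hasSum_padicEval_coe hx0 hx1 F).tsum_eq]
  refine IsUltrametricDist.norm_tsum_le_of_forall_le_of_nonneg zero_le_one fun n => ?_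
  rw [norm_mul, norm_pow]
  exact mul_le_one₀ (Padic.norm_int_le_one _) (by positivity) (pow_le_one₀ hx0.le hx1.le)

/-- A power series is determined to evaluate to `y` by partial sums approximating `y`. -/
theorem padicEval_coe_eq_of_norm_sub_le (hx0 : 0 < ‖x‖) (hx1 : ‖x‖ < 1) {F : PowerSeries ℤ}
    {y : ℚ_[p]} (h : ∀ n, ‖∑ i ∈ Finset.range n, ((F.coeff i : ℤ) : ℚ_[p]) * x ^ i - y‖
      ≤ ‖x‖ ^ n) : padicEval hx0 hx1 (F : LaurentSeries ℤ) = y := by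
  refine tendsto_nhds_unique (hasSum_padicEval_coe hx0 hx1 F).tendsto_sum_nat ?_
  rw [tendsto_iff_norm_sub_tendsto_zero]
  exact squeeze_zero (fun _ => norm_nonneg _) h (tendsto_pow_atTop_nhds_zero_of_lt_one hx0.le hx1)

/-- An integral power series with constant coefficient `p ^ k = ‖x‖⁻¹` vanishing at `x` divides
every integral power series vanishing at `x`. -/
theorem exists_mul_eq_of_padicEval_eq_zero (hx0 : 0 < ‖x‖) (hx1 : ‖x‖ < 1) {k : ℕ}
    (hk : ‖x‖ = (p : ℝ) ^ (-k : ℤ)) {G : PowerSeries ℤ} (hG0 : G.constantCoeff = (p : ℤ) ^ k)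
    (hG : padicEval hx0 hx1 (G : LaurentSeries ℤ) = 0) {F : PowerSeries ℤ}
    (hF : padicEval hx0 hx1 (F : LaurentSeries ℤ) = 0) :
    ∃ Q : PowerSeries ℤ, F = Q * G := by
  have hx : x ≠ 0 := norm_pos_iff.1 hx0
  have step : ∀ F : PowerSeries ℤ, padicEval hx0 hx1 (F : LaurentSeries ℤ) = 0 →
      ∃ (q : ℤ) (F' : PowerSeries ℤ), padicEval hx0 hx1 (F' : LaurentSeries ℤ) = 0 ∧
        F = PowerSeries.C q * G + PowerSeries.X * F' := by
    intro F hF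
    have hX : padicEval hx0 hx1 ((PowerSeries.X : PowerSeries ℤ) : LaurentSeries ℤ) = x := by
      rw [PowerSeries.coe_X, padicEval_single]; simp
    have hC : ∀ a : ℤ, padicEval hx0 hx1 ((PowerSeries.C a : PowerSeries ℤ) : LaurentSeries ℤ)
        = a := fun a => by simp
    obtain ⟨F1, hF1⟩ : PowerSeries.X ∣ F - PowerSeries.C F.constantCoeff := by
      rw [PowerSeries.X_dvd_iff]; simp
    have h1 : ((F.constantCoeff : ℤ) : ℚ_[p])
        = -(x * padicEval hx0 hx1 (F1 : LaurentSeries ℤ)) := by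
      have h := congrArg (fun H : PowerSeries ℤ => padicEval hx0 hx1 (H : LaurentSeries ℤ)) hF1
      simp only [map_sub, map_mul, hF, hX, hC] at h
      rw [← h]; ring
    have h2 : ‖((F.constantCoeff : ℤ) : ℚ_[p])‖ ≤ (p : ℝ) ^ (-k : ℤ) := by
      rw [h1, norm_neg, norm_mul, ← hk]
      exact mul_le_of_le_one_right hx0.le (norm_padicEval_coe_le_one hx0 hx1 F1)
    obtain ⟨q, hq⟩ := (Padic.norm_int_le_pow_iff_dvd _ _).1 h2
    obtain ⟨F', hF'⟩ : PowerSeries.X ∣ F - PowerSeries.C q * G := by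
      rw [PowerSeries.X_dvd_iff]; simp [hG0, hq]; ring
    refine ⟨q, F', ?_, by rw [← hF']; ring⟩
    have h := congrArg (fun H : PowerSeries ℤ => padicEval hx0 hx1 (H : LaurentSeries ℤ)) hF'
    simp only [map_sub, map_mul, hF, hG, hX] at h
    simpa only [sub_self, mul_zero, zero_eq_mul, hx, false_or] using h
  choose! q F' hF' hstep using step
  have hker : ∀ n, padicEval hx0 hx1 ((F'^[n] F : PowerSeries ℤ) : LaurentSeries ℤ) = 0 := by
    intro n
    induction n with
    | zero => exact hF
    | succ n ih => rw [Function.iterate_succ_apply']; exact hF' _ ih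
  have hcoeff : ∀ n m, PowerSeries.coeff n
      (F'^[m] F - PowerSeries.mk (fun i => q (F'^[m + i] F)) * G) = 0 := by
    have hrec : ∀ m, F'^[m] F - PowerSeries.mk (fun i => q (F'^[m + i] F)) * G
        = PowerSeries.X * (F'^[m + 1] F
          - PowerSeries.mk (fun i => q (F'^[m + 1 + i] F)) * G) := by
      intro m
      have hmk : PowerSeries.mk (fun i => q (F'^[m + i] F)) = PowerSeries.C (q (F'^[m] F))
          + PowerSeries.X * PowerSeries.mk (fun i => q (F'^[m + 1 + i] F)) := by
        ext (_ | n)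
        · simp
        · rw [map_add, PowerSeries.coeff_succ_X_mul, PowerSeries.coeff_mk, PowerSeries.coeff_mk,
            PowerSeries.coeff_C, if_neg n.succ_ne_zero, zero_add, add_right_comm, add_assoc]
      rw [hmk, Function.iterate_succ_apply']
      linear_combination hstep _ (hker m)
    intro n
    induction n with
    | zero => intro m; rw [hrec]; simp
    | succ n ih => intro m; rw [hrec, PowerSeries.coeff_succ_X_mul, ih]
  refine ⟨PowerSeries.mk fun i => q (F'^[0 + i] F), sub_eq_zero.1 ?_⟩
  exact PowerSeries.ext fun n => hcoeff n 0

end Evaluation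

section Generator

variable {p : ℕ} [Fact p.Prime] {x : ℚ_[p]}

theorem exists_int_norm_add_mul_pow_sub_le (hx0 : 0 < ‖x‖) {k : ℕ}
    (hk : ‖x‖ = (p : ℝ) ^ (-k : ℤ)) {n : ℕ} {s y : ℚ_[p]} (h : ‖s - y‖ ≤ ‖x‖ ^ n) (t : ℝ) :
    ∃ b : ℤ, ‖s + b * x ^ n - y‖ ≤ ‖x‖ ^ (n + 1) ∧ |(b : ℝ) + t| ≤ (p : ℝ) ^ k := by
  have hx : x ≠ 0 := norm_pos_iff.1 hx0
  obtain ⟨b, hb, hbt⟩ := exists_int_norm_add_le_abs_add_le (p := p) k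
    (y := (s - y) / x ^ n) (by rw [norm_div, norm_pow]; exact div_le_one_of_le₀ h (by positivity)) t
  refine ⟨b, ?_, hbt⟩
  have he : s + b * x ^ n - y = ((s - y) / x ^ n + b) * x ^ n := by
    field_simp
    ring
  rw [he, norm_mul, norm_pow, pow_succ', hk]
  gcongr

/-- Every `p`-adic integer is the value at `x` of a power series with bounded coefficients. -/
theorem exists_padicEval_coe_eq (hx0 : 0 < ‖x‖) (hx1 : ‖x‖ < 1) {k : ℕ}
    (hk : ‖x‖ = (p : ℝ) ^ (-k : ℤ)) {y : ℚ_[p]} (hy : ‖y‖ ≤ 1) :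
    ∃ F : PowerSeries ℤ, padicEval hx0 hx1 (F : LaurentSeries ℤ) = y ∧
      ∀ n, |((F.coeff n : ℤ) : ℝ)| ≤ (p : ℝ) ^ k := by
  obtain ⟨s, hs⟩ := exists_seq_of_forall_exists_of_local
    (fun n (s : ℕ → ℤ) a => ‖∑ i ∈ Finset.range n, (s i : ℚ_[p]) * x ^ i + a * x ^ n - y‖
      ≤ ‖x‖ ^ (n + 1) ∧ |(a : ℝ)| ≤ (p : ℝ) ^ k)
    (by
      intro n s t a hst h
      rwa [Finset.sum_congr rfl fun i hi => by rw [hst i (Finset.mem_range.1 hi)]] at h)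
    (by
      intro n s hs
      have hn : ‖∑ i ∈ Finset.range n, (s i : ℚ_[p]) * x ^ i - y‖ ≤ ‖x‖ ^ n := by
        rcases n with _ | n
        · simpa using hy
        · rw [Finset.sum_range_succ]
          exact (hs n n.lt_succ_self).1
      simpa using exists_int_norm_add_mul_pow_sub_le hx0 hk hn 0)
  refine ⟨PowerSeries.mk s, padicEval_coe_eq_of_norm_sub_le hx0 hx1 fun n => ?_, fun n => ?_⟩
  · simp only [PowerSeries.coeff_mk]
    rcases n with _ | n
    · simpa using hy
    · rw [Finset.sum_range_succ]
      exact (hs n).1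
  · rw [PowerSeries.coeff_mk]
    exact (hs n).2

/-- There is an integral power series with constant coefficient `‖x‖⁻¹` vanishing at `x` which is
holomorphic without zeros on the complex open unit disc. -/
theorem exists_padicEval_coe_eq_zero (hx0 : 0 < ‖x‖) (hx1 : ‖x‖ < 1) {k : ℕ}
    (hk : ‖x‖ = (p : ℝ) ^ (-k : ℤ)) :
    ∃ G : PowerSeries ℤ, padicEval hx0 hx1 (G : LaurentSeries ℤ) = 0 ∧
      G.constantCoeff = (p : ℤ) ^ k ∧
      (∀ ρ : ℝ, 0 < ρ → ρ < 1 → ∃ C, ∀ n, |((G.coeff n : ℤ) : ℝ)| * ρ ^ n ≤ C) ∧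
      (∀ ρ : ℝ, 0 < ρ → ρ < 1 →
        ∃ C, ∀ n, |(G.map (Int.castRingHom ℝ))⁻¹.coeff n| * ρ ^ n ≤ C) := by
  have hN : (0 : ℝ) < (p : ℝ) ^ k := pow_pos (mod_cast (Fact.out : p.Prime).pos) k
  obtain ⟨s, hs⟩ := exists_seq_of_forall_exists_of_local
    (fun n (s : ℕ → ℤ × ℝ) a =>
      ‖∑ i ∈ Finset.range n, ((s i).1 : ℚ_[p]) * x ^ i + a.1 * x ^ n - 0‖ ≤ ‖x‖ ^ (n + 1) ∧
      (p : ℝ) ^ k * a.2 = n * a.1 - ∑ j ∈ Finset.Ico 1 n, (s j).2 * (s (n - j)).1 ∧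
      |a.2| ≤ n ∧ (n = 0 → a.1 = (p : ℤ) ^ k))
    (by
      intro n s t a hst h
      rwa [Finset.sum_congr rfl fun i hi => by rw [hst i (Finset.mem_range.1 hi)],
        Finset.sum_congr (g := fun j => (t j).2 * ((t (n - j)).1 : ℝ)) rfl fun j hj => by
          have := Finset.mem_Ico.1 hj
          rw [hst j this.2, hst (n - j) (by omega)]] at h)
    (by
      intro n s hs
      rcases n with _ | n
      · refine ⟨((p : ℤ) ^ k, 0), ?_, by simp, by simp, fun _ => rfl⟩
        simp [hk]
      have hn := (hs n n.lt_succ_self).1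
      rw [← Finset.sum_range_succ (fun i => ((s i).1 : ℚ_[p]) * x ^ i)] at hn
      set t : ℝ := ∑ j ∈ Finset.Ico 1 (n + 1), (s j).2 * (s (n + 1 - j)).1
      obtain ⟨b, hb, hbt⟩ := exists_int_norm_add_mul_pow_sub_le hx0 hk hn (-t / (n + 1))
      refine ⟨(b, (n + 1) * (b + -t / (n + 1)) / (p : ℝ) ^ k), hb, ?_, ?_, by simp⟩
      · push_cast
        field_simp
        ring
      · rw [abs_div, abs_mul, abs_of_pos hN, div_le_iff₀ hN,
          abs_of_nonneg (by positivity : (0 : ℝ) ≤ n + 1)]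
        push_cast
        gcongr)
  set G : PowerSeries ℤ := PowerSeries.mk fun n => (s n).1
  set A : PowerSeries ℝ := G.map (Int.castRingHom ℝ)
  set H : PowerSeries ℝ := PowerSeries.mk fun n => (s (n + 1)).2
  have hG0 : (s 0).1 = (p : ℤ) ^ k := (hs 0).2.2.2 rfl
  have hAcoeff : ∀ n, A.coeff n = ((s n).1 : ℝ) := fun n => by simp [A, G]
  have hder : PowerSeries.derivative ℝ A = H * A := by
    ext n
    rw [PowerSeries.coeff_derivative, PowerSeries.coeff_mul,
      Finset.Nat.sum_antidiagonal_eq_sum_range_succ_mk, Finset.sum_range_succ]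
    simp only [hAcoeff, H, PowerSeries.coeff_mk]
    have h := (hs (n + 1)).2.1
    rw [Finset.sum_Ico_eq_sum_range] at h
    rw [Nat.sub_self, hG0]
    have hsum : ∑ i ∈ Finset.range (n + 1 - 1), (s (1 + i)).2 * ((s (n + 1 - (1 + i))).1 : ℝ)
        = ∑ i ∈ Finset.range n, (s (i + 1)).2 * ((s (n - i)).1 : ℝ) := by
      refine Finset.sum_congr (by simp) fun i _ => ?_
      rw [add_comm 1 i, Nat.add_sub_add_right]
    rw [hsum] at h
    push_cast at h ⊢
    linarith
  have hH : ∀ n, |H.coeff n| ≤ n + 1 := fun n => by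
    simpa [H] using (hs (n + 1)).2.2.1
  have hA0 : A.constantCoeff ≠ 0 := by
    rw [← PowerSeries.coeff_zero_eq_constantCoeff_apply, hAcoeff, hG0]
    exact_mod_cast hN.ne'
  have hderinv : PowerSeries.derivative ℝ A⁻¹ = -H * A⁻¹ := by
    rw [PowerSeries.derivative_inv', hder]
    linear_combination (-H * A⁻¹) * PowerSeries.mul_inv_cancel A hA0
  refine ⟨G, padicEval_coe_eq_of_norm_sub_le hx0 hx1 fun n => ?_, ?_, fun ρ h0 h1 => ?_,
    fun ρ h0 h1 => exists_bound_of_derivative_eq_mul hderinv (fun n => by simpa using hH n) h0 h1⟩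
  · simp only [G, PowerSeries.coeff_mk]
    rcases n with _ | n
    · simp
    · rw [Finset.sum_range_succ]
      exact (hs n).1
  · rw [← PowerSeries.coeff_zero_eq_constantCoeff_apply, PowerSeries.coeff_mk, hG0]
  · simpa [A] using exists_bound_of_derivative_eq_mul hder hH h0 h1

end Generator

section Convergence

theorem coe_mem_ZTgt_of_bound {r ρ C : ℝ} (hr0 : 0 < r) (hr : r < ρ) (hρ : ρ < 1)
    {F : PowerSeries ℤ} (hF : ∀ n, |((F.coeff n : ℤ) : ℝ)| * ρ ^ n ≤ C) :
    (F : LaurentSeries ℤ) ∈ ZTgt r := by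
  obtain ⟨σ, hσ, hσρ⟩ := exists_between hr
  have hσ0 := hr0.trans hσ
  have hρ0 := hσ0.trans hσρ
  refine ⟨σ, hσ, hσρ.trans hρ, ?_⟩
  rw [← Nat.map_cast_int_atTop, tendsto_map'_iff]
  have hlim : Tendsto (fun n : ℕ => C * (σ / ρ) ^ n) atTop (nhds 0) := by
    simpa using (tendsto_pow_atTop_nhds_zero_of_lt_one (by positivity)
      ((div_lt_one hρ0).2 hσρ)).const_mul C
  refine squeeze_zero (fun n => by simp only [Function.comp_apply]; positivity) (fun n => ?_) hlim
  simp only [Function.comp_apply, LaurentSeries.coeff_coe_powerSeries, zpow_natCast]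
  calc |((F.coeff n : ℤ) : ℝ)| * σ ^ n = |((F.coeff n : ℤ) : ℝ)| * ρ ^ n * (σ / ρ) ^ n := by
        rw [div_pow]; field_simp
    _ ≤ _ := by gcongr; exact hF n

theorem exists_bound_powerSeriesPart_of_mem_ZTgt {r : ℝ} (hr0 : 0 < r) {f : LaurentSeries ℤ}
    (hf : f ∈ ZTgt r) :
    ∃ ρ C : ℝ, r < ρ ∧ ρ < 1 ∧ ∀ n, |((f.powerSeriesPart.coeff n : ℤ) : ℝ)| * ρ ^ n ≤ C := by
  obtain ⟨ρ, hr, hρ, hlim⟩ := hf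
  have hρ0 := hr0.trans hr
  have hlim' := (hlim.comp (tendsto_atTop_add_const_left atTop f.order
    tendsto_natCast_atTop_atTop)).div_const (ρ ^ f.order)
  obtain ⟨C, hC⟩ := hlim'.bddAbove_range
  refine ⟨ρ, C, hr, hρ, fun n => ?_⟩
  refine le_of_eq_of_le ?_ (hC ⟨n, rfl⟩)
  simp only [Function.comp_apply, LaurentSeries.powerSeriesPart_coeff]
  rw [zpow_add₀ hρ0.ne', zpow_natCast]
  field_simp

theorem single_mem_ZTgt {r : ℝ} (hr1 : r < 1) (m a : ℤ) :
    (HahnSeries.single m a : LaurentSeries ℤ) ∈ ZTgt r := by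
  obtain ⟨ρ, hr, hρ⟩ := exists_between hr1
  refine ⟨ρ, hr, hρ, tendsto_const_nhds.congr' ?_⟩
  filter_upwards [eventually_gt_atTop m] with n hn
  simp [HahnSeries.coeff_single_of_ne hn.ne']

theorem PowerSeries.exists_bound_coeff_mul {A B : PowerSeries ℝ} {ρ σ C D : ℝ} (hρ : 0 < ρ)
    (hρσ : ρ < σ) (hA : ∀ n, |A.coeff n| * ρ ^ n ≤ C) (hB : ∀ n, |B.coeff n| * σ ^ n ≤ D) :
    ∃ E, ∀ n, |(A * B).coeff n| * ρ ^ n ≤ E := by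
  have hσ := hρ.trans hρσ
  have hC : 0 ≤ C := le_trans (by positivity) (hA 0)
  have hD : 0 ≤ D := le_trans (by positivity) (hB 0)
  have hs : Summable fun n : ℕ => D * (ρ / σ) ^ n :=
    (summable_geometric_of_lt_one (by positivity) ((div_lt_one hσ).2 hρσ)).mul_left D
  refine ⟨C * ∑' n : ℕ, D * (ρ / σ) ^ n, fun n => ?_⟩
  rw [PowerSeries.coeff_mul, Finset.Nat.sum_antidiagonal_eq_sum_range_succ_mk]
  calc |∑ i ∈ Finset.range (n + 1), A.coeff i * B.coeff (n - i)| * ρ ^ n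
      ≤ (∑ i ∈ Finset.range (n + 1), |A.coeff i * B.coeff (n - i)|) * ρ ^ n := by
        gcongr
        exact Finset.abs_sum_le_sum_abs _ _
    _ ≤ ∑ i ∈ Finset.range (n + 1), C * (D * (ρ / σ) ^ (n - i)) := by
        rw [Finset.sum_mul]
        refine Finset.sum_le_sum fun i hi => ?_
        have hi' : i + (n - i) = n := by have := Finset.mem_range.1 hi; omega
        calc |A.coeff i * B.coeff (n - i)| * ρ ^ n
            = (|A.coeff i| * ρ ^ i) * ((|B.coeff (n - i)| * σ ^ (n - i)) * (ρ / σ) ^ (n - i)) := by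
              rw [abs_mul, div_pow]
              nth_rewrite 2 [← hi']
              rw [pow_add]
              field_simp
          _ ≤ _ := by
              gcongr
              · exact hA i
              · exact hB _
    _ = C * ∑ i ∈ Finset.range (n + 1), D * (ρ / σ) ^ i := by
        rw [← Finset.mul_sum, ← Finset.sum_range_reflect (fun i => D * (ρ / σ) ^ i)]
        simp
    _ ≤ _ := by
        gcongr
        exact hs.sum_le_tsum _ fun i _ => by positivity

end Convergence

/-- For `0 < r < 1`, a prime `p`, and a topologically nilpotent unit `x ∈ ℚ_p`
(`0 < ‖x‖ < 1`): (a) for every `f ∈ ℤ((T))_{>r}` the family `n ↦ (f.coeff n)·xⁿ` is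
summable in `ℚ_p` and evaluation at `x` is a ring homomorphism
`θ_x : ℤ((T))_{>r} → ℚ_p`; (b) `θ_x` is surjective; (c) its kernel is a principal
ideal generated by a nonzerodivisor. -/
theorem padic_evaluation_surjective_ker_principal
    (r : ℝ) (hr0 : 0 < r) (hr1 : r < 1) (p : ℕ) [Fact p.Prime]
    (x : ℚ_[p]) (hx0 : 0 < ‖x‖) (hx1 : ‖x‖ < 1)
    (S : Subring (LaurentSeries ℤ)) (hS : (S : Set (LaurentSeries ℤ)) = ZTgt r) :
    (∀ f : S, Summable (fun n : ℤ => (((f : LaurentSeries ℤ).coeff n : ℤ) : ℚ_[p]) * x ^ n)) ∧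
    ∃ θ : S →+* ℚ_[p],
      (∀ f : S, θ f = ∑' n : ℤ, (((f : LaurentSeries ℤ).coeff n : ℤ) : ℚ_[p]) * x ^ n) ∧
      Function.Surjective θ ∧
      ∃ g : S, g ∈ nonZeroDivisors S ∧ RingHom.ker θ = Ideal.span {g} := by
  have hx : x ≠ 0 := norm_pos_iff.1 hx0
  have hp1 : (1 : ℝ) < p := mod_cast (Fact.out : p.Prime).one_lt
  obtain ⟨k, hk⟩ : ∃ k : ℕ, ‖x‖ = (p : ℝ) ^ (-k : ℤ) := by
    lift x.valuation to ℕ using (Padic.norm_le_one_iff_val_nonneg x).1 hx1.le with k hk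
    exact ⟨k, by rw [Padic.norm_eq_zpow_neg_valuation hx, hk]⟩
  have hmem : ∀ f : LaurentSeries ℤ, f ∈ S ↔ f ∈ ZTgt r := fun f => by rw [← hS, SetLike.mem_coe]
  have hsingle : ∀ m a : ℤ, (HahnSeries.single m a : LaurentSeries ℤ) ∈ S :=
    fun m a => (hmem _).2 (single_mem_ZTgt hr1 m a)
  obtain ⟨ρ₀, hrρ₀, hρ₀⟩ := exists_between hr1
  have hρ₀0 := hr0.trans hrρ₀
  refine ⟨fun f => (summable_norm_coeff_mul_zpow hx0 hx1 _).of_norm,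
    (padicEval hx0 hx1).comp S.subtype, fun f => rfl, fun y => ?_, ?_⟩
  · obtain ⟨m, hm⟩ : ∃ m : ℕ, ‖y * x ^ m‖ ≤ 1 := by
      have h := (tendsto_pow_atTop_nhds_zero_of_lt_one hx0.le hx1).const_mul ‖y‖
      rw [mul_zero] at h
      obtain ⟨m, hm⟩ := (h.eventually_le_const one_pos).exists
      exact ⟨m, by rwa [norm_mul, norm_pow]⟩
    obtain ⟨F, hF, hFb⟩ := exists_padicEval_coe_eq hx0 hx1 hk hm
    have hFS : (F : LaurentSeries ℤ) ∈ S := (hmem _).2 <|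
      coe_mem_ZTgt_of_bound hr0 hrρ₀ hρ₀ (C := (p : ℝ) ^ k) fun n =>
        (mul_le_of_le_one_right (abs_nonneg _) (pow_le_one₀ hρ₀0.le hρ₀.le)).trans (hFb n)
    refine ⟨⟨_, S.mul_mem (hsingle (-m) 1) hFS⟩, ?_⟩
    simp only [RingHom.comp_apply, Subring.subtype_apply, map_mul, hF, padicEval_single]
    rw [zpow_neg, zpow_natCast]
    field_simp
    simp
  · obtain ⟨G, hG, hG0, hGb, hGinv⟩ := exists_padicEval_coe_eq_zero hx0 hx1 hk
    obtain ⟨C, hC⟩ := hGb ρ₀ hρ₀0 hρ₀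
    have hGS : (G : LaurentSeries ℤ) ∈ S := (hmem _).2 (coe_mem_ZTgt_of_bound hr0 hrρ₀ hρ₀ hC)
    have hpk : (p : ℤ) ^ k ≠ 0 := pow_ne_zero _ (mod_cast (Fact.out : p.Prime).ne_zero)
    have hGne : G ≠ 0 := by
      rintro rfl
      exact hpk (by simpa using hG0.symm)
    refine ⟨⟨G, hGS⟩, mem_nonZeroDivisors_of_ne_zero ?_, le_antisymm ?_ ?_⟩
    · intro h
      have h' : (G : LaurentSeries ℤ) = 0 := congrArg Subtype.val h
      exact hGne (HahnSeries.ofPowerSeries_injective (by rw [h', map_zero]))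
    · intro f hf
      have hf0 : padicEval hx0 hx1 (f : LaurentSeries ℤ) = 0 := hf
      have hfact := LaurentSeries.single_order_mul_powerSeriesPart (f : LaurentSeries ℤ)
      have hF : padicEval hx0 hx1
          ((f : LaurentSeries ℤ).powerSeriesPart : LaurentSeries ℤ) = 0 := by
        rw [← hfact, map_mul, padicEval_single, Int.cast_one, one_mul] at hf0
        exact (mul_eq_zero.1 hf0).resolve_left (zpow_ne_zero _ hx)
      obtain ⟨Q, hQ⟩ := exists_mul_eq_of_padicEval_eq_zero hx0 hx1 hk hG0 hG hF
      obtain ⟨ρ, B, hrρ, hρ1, hB⟩ :=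
        exists_bound_powerSeriesPart_of_mem_ZTgt hr0 ((hmem _).1 f.2)
      obtain ⟨σ, hρσ, hσ1⟩ := exists_between hρ1
      have hρ0 := hr0.trans hrρ
      obtain ⟨D, hD⟩ := hGinv σ (hρ0.trans hρσ) hσ1
      have hQmap : Q.map (Int.castRingHom ℝ)
          = (f : LaurentSeries ℤ).powerSeriesPart.map (Int.castRingHom ℝ)
            * (G.map (Int.castRingHom ℝ))⁻¹ := by
        rw [hQ, map_mul, mul_assoc, PowerSeries.mul_inv_cancel, mul_one]
        rw [← PowerSeries.coeff_zero_eq_constantCoeff_apply, PowerSeries.coeff_map,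
          PowerSeries.coeff_zero_eq_constantCoeff_apply, hG0]
        simpa using hpk
      obtain ⟨E, hE⟩ := PowerSeries.exists_bound_coeff_mul
        (A := (f : LaurentSeries ℤ).powerSeriesPart.map (Int.castRingHom ℝ)) hρ0 hρσ
        (fun n => by simpa using hB n) hD
      rw [← hQmap] at hE
      have hQS : (Q : LaurentSeries ℤ) ∈ S :=
        (hmem _).2 (coe_mem_ZTgt_of_bound hr0 hrρ hρ1 (fun n => by simpa using hE n))
      refine Ideal.mem_span_singleton'.2
        ⟨⟨_, S.mul_mem (hsingle (f : LaurentSeries ℤ).order 1) hQS⟩, Subtype.ext ?_⟩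
      change HahnSeries.single (f : LaurentSeries ℤ).order 1 * (Q : LaurentSeries ℤ)
        * (G : LaurentSeries ℤ) = (f : LaurentSeries ℤ)
      rw [mul_assoc, ← map_mul, ← hQ, hfact]
    · rw [Ideal.span_singleton_le_iff_mem, RingHom.mem_ker]
      exact hG
end

section
/- Let 0 < r' < r < 1 and let p := (log r)/(log r'), so that (r')^p = r and 0 < p < 1. Then for every real number z there exists a function a : ℤ → ℤ such that: (i) there is n₀ ∈ ℤ with a(n) = 0 for all n < n₀; (ii) |a(n)| ≤ 1/r' for all n; (iii) the family n ↦ (a(n) : ℝ)·(r')ⁿ has sum z; and (iv) the family n ↦ |a(n)|·rⁿ is summable with sum at most (1/(r'·(1−r)))·|z|^p. -/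
/-- Digit expansion in the (possibly non-integral) base `s⁻¹` of a number in `[0, s⁻¹)`. -/
theorem exists_digit_expansion_s4 {s u : ℝ} (hs0 : 0 < s) (hs1 : s < 1)
    (hu0 : 0 ≤ u) (hu1 : u < 1 / s) :
    ∃ d : ℕ → ℤ, (∀ k, |(d k : ℝ)| ≤ 1 / s) ∧ HasSum (fun k => (d k : ℝ) * s ^ k) u := by
  set v : ℕ → ℝ := fun k => (fun y => Int.fract y / s)^[k] u with hv
  have v_zero : v 0 = u := rfl
  have v_succ (k : ℕ) : v (k + 1) = Int.fract (v k) / s := Function.iterate_succ_apply' _ _ _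
  have v_mem (k : ℕ) : 0 ≤ v k ∧ v k < 1 / s := by
    cases k with
    | zero => exact ⟨hu0, hu1⟩
    | succ k =>
      rw [v_succ]
      exact ⟨div_nonneg (Int.fract_nonneg _) hs0.le,
        div_lt_div_of_pos_right (Int.fract_lt_one _) hs0⟩
  have floor_nonneg (k : ℕ) : (0 : ℝ) ≤ ⌊v k⌋ := by
    exact_mod_cast Int.floor_nonneg.2 (v_mem k).1
  have sum_eq (m : ℕ) : ∑ k ∈ Finset.range m, (⌊v k⌋ : ℝ) * s ^ k = u - v m * s ^ m := by
    induction m with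
    | zero => simp [v_zero]
    | succ m ih =>
      rw [Finset.sum_range_succ, ih, v_succ, Int.fract]
      field_simp
      ring
  refine ⟨fun k => ⌊v k⌋, fun k => ?_, ?_⟩
  · rw [abs_of_nonneg (floor_nonneg k)]
    exact (Int.floor_le _).trans (v_mem k).2.le
  · rw [hasSum_iff_tendsto_nat_of_nonneg
      fun k => mul_nonneg (floor_nonneg k) (pow_nonneg hs0.le k)]
    simp_rw [sum_eq]
    have remainder : Filter.Tendsto (fun m => v m * s ^ m) Filter.atTop (nhds 0) := by
      refine squeeze_zero (fun m => mul_nonneg (v_mem m).1 (pow_nonneg hs0.le m))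
        (fun m => mul_le_mul_of_nonneg_right (v_mem m).2.le (pow_nonneg hs0.le m)) ?_
      simpa using (tendsto_pow_atTop_nhds_zero_of_lt_one hs0.le hs1).const_mul (1 / s)
    simpa using remainder.const_sub u

/-- A family on `ℤ` supported on `[N, ∞)` has the sum of the corresponding family on `ℕ`. -/
theorem hasSum_int_of_eq_zero_of_lt {f : ℤ → ℝ} {N : ℤ} {x : ℝ} (hf : ∀ n < N, f n = 0)
    (h : HasSum (fun k : ℕ => f (N + k)) x) : HasSum f x := by
  have inj : Function.Injective fun k : ℕ => N + (k : ℤ) := fun a b hab => by simpa using hab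
  refine (inj.hasSum_iff fun n hn => hf n ?_).1 h
  by_contra hlt
  exact hn ⟨(n - N).toNat, by simp only; omega⟩

theorem exists_bounded_expansion_with_lp_bound_of_pos
    {r r' : ℝ} (h0 : 0 < r') (h1 : r' < r) (h2 : r < 1)
    {p : ℝ} (hp : p = Real.log r / Real.log r') {z : ℝ} (hz : 0 < z) :
    ∃ a : ℤ → ℤ,
      (∃ n₀ : ℤ, ∀ n : ℤ, n < n₀ → a n = 0) ∧
      (∀ n : ℤ, |(a n : ℝ)| ≤ 1 / r') ∧
      HasSum (fun n : ℤ => (a n : ℝ) * r' ^ n) z ∧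
      ∃ C : ℝ, HasSum (fun n : ℤ => |(a n : ℝ)| * r ^ n) C ∧
        C ≤ (1 / (r' * (1 - r))) * |z| ^ p := by
  have hr : 0 < r := h0.trans h1
  have hr' : r' < 1 := h1.trans h2
  have log_r' : Real.log r' < 0 := Real.log_neg h0 hr'
  have hp0 : 0 < p := hp ▸ div_pos_of_neg_of_neg (Real.log_neg hr h2) log_r'
  have rpow_p : r' ^ p = r := by
    rw [Real.rpow_def_of_pos h0, hp, mul_div_cancel₀ _ log_r'.ne, Real.exp_log hr]
  obtain ⟨N, hN, hN'⟩ : ∃ N : ℤ, r' ^ N ≤ z ∧ z / r' ^ N < 1 / r' := by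
    obtain ⟨m, hm, hm'⟩ := exists_mem_Ico_zpow hz ((one_lt_inv₀ h0).2 hr')
    refine ⟨-m, by simpa using hm, ?_⟩
    rw [zpow_add₀ (inv_ne_zero h0.ne'), zpow_one, inv_zpow] at hm'
    rw [div_lt_iff₀ (zpow_pos h0 _), zpow_neg, one_div, mul_comm]
    exact hm'
  obtain ⟨d, hd, hsum⟩ :=
    exists_digit_expansion_s4 h0 hr' (div_nonneg hz.le (zpow_pos h0 N).le) hN'
  have rpow_N : r ^ N ≤ z ^ p := by
    calc r ^ N = (r' ^ N) ^ p := by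
          rw [← rpow_p, ← Real.rpow_intCast, ← Real.rpow_intCast, ← Real.rpow_mul h0.le,
            ← Real.rpow_mul h0.le, mul_comm]
      _ ≤ z ^ p := Real.rpow_le_rpow (zpow_pos h0 N).le hN hp0.le
  have geom : HasSum (fun k : ℕ => 1 / r' * r ^ k) (1 / r' * (1 - r)⁻¹) :=
    (hasSum_geometric_of_lt_one hr.le h2).mul_left _
  have le_geom (k : ℕ) : |(d k : ℝ)| * r ^ k ≤ 1 / r' * r ^ k :=
    mul_le_mul_of_nonneg_right (hd k) (pow_nonneg hr.le k)
  have summ : Summable fun k : ℕ => |(d k : ℝ)| * r ^ k :=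
    geom.summable.of_nonneg_of_le (fun k => by positivity) le_geom
  let a : ℤ → ℤ := fun n => if n < N then 0 else d (n - N).toNat
  have a_lt : ∀ n < N, a n = 0 := fun n hn => if_pos hn
  have a_add (k : ℕ) : a (N + k) = d k := by simp [a]
  refine ⟨a, ⟨N, a_lt⟩, fun n => ?_, ?_, r ^ N * ∑' k : ℕ, |(d k : ℝ)| * r ^ k, ?_, ?_⟩
  · by_cases hn : n < N
    · simp [a_lt n hn, h0.le]
    · simpa [a, hn] using hd (n - N).toNat
  · refine hasSum_int_of_eq_zero_of_lt (N := N) (fun n hn => by simp [a_lt n hn]) ?_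
    have scaled := hsum.mul_left (r' ^ N)
    rw [mul_div_cancel₀ _ (zpow_pos h0 N).ne'] at scaled
    refine (congrArg (HasSum · z) (funext fun k => ?_)).mpr scaled
    rw [a_add, zpow_add₀ h0.ne', zpow_natCast]
    ring
  · refine hasSum_int_of_eq_zero_of_lt (N := N) (fun n hn => by simp [a_lt n hn]) ?_
    refine (congrArg (HasSum · _) (funext fun k => ?_)).mpr (summ.hasSum.mul_left (r ^ N))
    rw [a_add, zpow_add₀ hr.ne', zpow_natCast]
    ring
  · have h1r : 0 < 1 - r := sub_pos.2 h2
    calc r ^ N * ∑' k : ℕ, |(d k : ℝ)| * r ^ k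
        ≤ z ^ p * (1 / r' * (1 - r)⁻¹) :=
          mul_le_mul rpow_N (hasSum_le le_geom summ.hasSum geom)
            (tsum_nonneg fun k => by positivity) (by positivity)
      _ = 1 / (r' * (1 - r)) * |z| ^ p := by
          rw [abs_of_pos hz]
          field_simp

/-- Let `0 < r' < r < 1` and `p := log r / log r'` (so `(r')^p = r` and `0 < p < 1`).
Every real `z` admits an integer-coefficient expansion `z = ∑_{n ∈ ℤ} aₙ (r')ⁿ` with
coefficients vanishing below some `n₀`, `|aₙ| ≤ 1/r'`, and with
`∑ |aₙ| rⁿ ≤ (1/(r'(1−r)))·|z|^p`. -/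
theorem exists_bounded_expansion_with_lp_bound
    (r r' : ℝ) (h0 : 0 < r') (h1 : r' < r) (h2 : r < 1)
    (p : ℝ) (hp : p = Real.log r / Real.log r') (z : ℝ) :
    ∃ a : ℤ → ℤ,
      (∃ n₀ : ℤ, ∀ n : ℤ, n < n₀ → a n = 0) ∧
      (∀ n : ℤ, |(a n : ℝ)| ≤ 1 / r') ∧
      HasSum (fun n : ℤ => (a n : ℝ) * r' ^ n) z ∧
      ∃ C : ℝ, HasSum (fun n : ℤ => |(a n : ℝ)| * r ^ n) C ∧
        C ≤ (1 / (r' * (1 - r))) * |z| ^ p := by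
  rcases lt_trichotomy z 0 with hz | rfl | hz
  · obtain ⟨a, ⟨n₀, hn₀⟩, ha, hsum, C, hC, hle⟩ :=
      exists_bounded_expansion_with_lp_bound_of_pos h0 h1 h2 hp (neg_pos.2 hz)
    refine ⟨-a, ⟨n₀, fun n hn => by simp [hn₀ n hn]⟩, fun n => by simpa using ha n, ?_, C, ?_, ?_⟩
    · simpa using hsum.neg
    · simpa using hC
    · simpa using hle
  · have h1r : 0 < 1 - r := sub_pos.2 h2
    refine ⟨0, ⟨0, fun _ _ => rfl⟩, fun n => by simp [h0.le], by simp [hasSum_zero],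
      0, by simp [hasSum_zero], by positivity⟩
  · exact exists_bounded_expansion_with_lp_bound_of_pos h0 h1 h2 hp hz
end

section
/- Let 0 < r' < r < 1 and let p := (log r)/(log r'), so that (r')^p = r and 0 < p < 1. Let c > 0 and let a : ℤ → ℤ be a function whose support is bounded below (there is n₀ ∈ ℤ with a(n) = 0 for all n < n₀) and such that the family n ↦ |a(n)|·rⁿ is summable with sum at most c. Then the family n ↦ (a(n) : ℝ)·(r')ⁿ is summable, and its sum g satisfies |g|^p ≤ c. -/
theorem Real.rpow_sum_le_sum_rpow_of_le_one {ι : Type*} (s : Finset ι) {f : ι → ℝ} {p : ℝ}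
    (hf : ∀ i ∈ s, 0 ≤ f i) (hp : 0 < p) (hp1 : p ≤ 1) :
    (∑ i ∈ s, f i) ^ p ≤ ∑ i ∈ s, f i ^ p := by
  classical
  induction s using Finset.induction_on with
  | empty => simp [Real.zero_rpow hp.ne']
  | insert i s hi ih =>
    rw [Finset.sum_insert hi, Finset.sum_insert hi]
    have hs : ∀ j ∈ s, 0 ≤ f j := fun j hj => hf j (Finset.mem_insert_of_mem hj)
    exact (Real.rpow_add_le_add_rpow (hf i (Finset.mem_insert_self i s))
      (Finset.sum_nonneg hs) hp.le hp1).trans (add_le_add_right (ih hs) _)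

theorem Int.rpow_abs_le_abs (m : ℤ) {p : ℝ} (hp : 0 < p) (hp1 : p ≤ 1) :
    |(m : ℝ)| ^ p ≤ |(m : ℝ)| := by
  rcases eq_or_ne m 0 with rfl | hm
  · simp [Real.zero_rpow hp.ne']
  · have h : (1 : ℝ) ≤ |(m : ℝ)| := by exact_mod_cast Int.one_le_abs hm
    simpa using Real.rpow_le_rpow_of_exponent_le h hp1

/-- Let `0 < r' < r < 1` and `p := log r / log r'` (so `(r')^p = r` and `0 < p < 1`).
If `a : ℤ → ℤ` has support bounded below and `∑ |aₙ| rⁿ` is summable with sum at most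
`c`, then `∑ aₙ (r')ⁿ` is summable and its sum `g` satisfies `|g|^p ≤ c`. -/
theorem rpow_abs_tsum_le_of_sum_abs_le
    (r r' : ℝ) (h0 : 0 < r') (h1 : r' < r) (h2 : r < 1)
    (p : ℝ) (hp : p = Real.log r / Real.log r')
    (c : ℝ) (hc : 0 < c) (a : ℤ → ℤ)
    (hsupp : ∃ n₀ : ℤ, ∀ n : ℤ, n < n₀ → a n = 0)
    (hsum : ∃ C : ℝ, HasSum (fun n : ℤ => |(a n : ℝ)| * r ^ n) C ∧ C ≤ c) :
    Summable (fun n : ℤ => (a n : ℝ) * r' ^ n) ∧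
    |∑' n : ℤ, (a n : ℝ) * r' ^ n| ^ p ≤ c := by
  obtain ⟨C, hC, hCc⟩ := hsum
  have hr : 0 < r := h0.trans h1
  have hlogr' : Real.log r' < 0 := Real.log_neg h0 (h1.trans h2)
  have hp0 : 0 < p := hp ▸ div_pos_of_neg_of_neg (Real.log_neg hr h2) hlogr'
  have hp1 : p ≤ 1 := by
    rw [hp, div_le_one_of_neg hlogr']
    exact (Real.log_lt_log h0 h1).le
  have hrp : r' ^ p = r := by
    rw [Real.rpow_def_of_pos h0, hp, mul_div_cancel₀ _ hlogr'.ne, Real.exp_log hr]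
  have hzpow (n : ℤ) : (r' ^ n) ^ p = r ^ n := by
    rw [← Real.rpow_intCast, ← Real.rpow_mul h0.le, mul_comm, Real.rpow_mul h0.le, hrp,
      Real.rpow_intCast]
  have hnonneg (n : ℤ) : 0 ≤ |(a n : ℝ)| * r' ^ n := by positivity
  have hbound (s : Finset ℤ) : ∑ n ∈ s, |(a n : ℝ)| * r' ^ n ≤ c ^ p⁻¹ := by
    rw [Real.le_rpow_inv_iff_of_pos (Finset.sum_nonneg fun n _ => hnonneg n) hc.le hp0]
    calc (∑ n ∈ s, |(a n : ℝ)| * r' ^ n) ^ p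
        ≤ ∑ n ∈ s, (|(a n : ℝ)| * r' ^ n) ^ p :=
          Real.rpow_sum_le_sum_rpow_of_le_one s (fun n _ => hnonneg n) hp0 hp1
      _ ≤ ∑ n ∈ s, |(a n : ℝ)| * r ^ n := by
          refine Finset.sum_le_sum fun n _ => ?_
          rw [Real.mul_rpow (abs_nonneg _) (by positivity), hzpow]
          exact mul_le_mul_of_nonneg_right (Int.rpow_abs_le_abs _ hp0 hp1) (by positivity)
      _ ≤ c := (sum_le_hasSum s (fun n _ => by positivity) hC).trans hCc
  have hnorm (n : ℤ) : ‖(a n : ℝ) * r' ^ n‖ = |(a n : ℝ)| * r' ^ n := by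
    rw [norm_mul, Real.norm_eq_abs, Real.norm_of_nonneg (by positivity)]
  have habs : Summable fun n : ℤ => ‖(a n : ℝ) * r' ^ n‖ := by
    simpa only [hnorm] using summable_of_sum_le hnonneg hbound
  refine ⟨habs.of_norm, ?_⟩
  rw [← Real.le_rpow_inv_iff_of_pos (abs_nonneg _) hc.le hp0]
  refine (norm_tsum_le_tsum_norm habs).trans ?_
  simpa only [hnorm] using Real.tsum_le_of_sum_le hnonneg hbound
end

section
/- Let x be a real number with 0 < x < 1 and let N be a positive integer with 1/N ≤ x. Then every real number y ≥ 0 admits a 'digit expansion in base x': there exist n₀ ∈ ℤ and a : ℤ → ℕ such that a(n) ≤ N−1 for all n, a(n) = 0 for all n < n₀, and the family n ↦ (a(n) : ℝ)·xⁿ (n ∈ ℤ) has sum y. -/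
open Filter Topology in
/-- Greedy (Rényi) expansion: for `0 < x < 1`, every `z ∈ [0, 1)` is a sum `∑ dᵢ xⁱ⁺¹` with
digits `dᵢ < N` as soon as `1 / x ≤ N`. -/
theorem exists_hasSum_digits_of_lt_one {x : ℝ} (hx0 : 0 < x) (hx1 : x < 1) {N : ℕ}
    (hNx : 1 / x ≤ N) {z : ℝ} (hz0 : 0 ≤ z) (hz1 : z < 1) :
    ∃ d : ℕ → ℕ, (∀ i, d i < N) ∧ HasSum (fun i => (d i : ℝ) * x ^ (i + 1)) z := by
  let f : ℝ → ℝ := fun s => s / x - ⌊s / x⌋₊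
  let t : ℕ → ℝ := fun i => f^[i] z
  have ht_succ (i : ℕ) : t (i + 1) = t i / x - ⌊t i / x⌋₊ :=
    Function.iterate_succ_apply' f i z
  have ht (i : ℕ) : 0 ≤ t i ∧ t i < 1 := by
    induction i with
    | zero => exact ⟨hz0, hz1⟩
    | succ i ih =>
      rw [ht_succ]
      have h1 := Nat.floor_le (div_nonneg ih.1 hx0.le)
      have h2 := Nat.lt_floor_add_one (t i / x)
      constructor <;> linarith
  refine ⟨fun i => ⌊t i / x⌋₊, fun i => ?_, ?_⟩
  · rw [Nat.floor_lt (div_nonneg (ht i).1 hx0.le)]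
    exact (div_lt_div_of_pos_right (ht i).2 hx0).trans_le hNx
  · have hpartial (m : ℕ) :
        ∑ i ∈ Finset.range m, (⌊t i / x⌋₊ : ℝ) * x ^ (i + 1) = z - t m * x ^ m := by
      induction m with
      | zero => simp [t]
      | succ m ih =>
        rw [Finset.sum_range_succ, ih, ht_succ]
        field_simp
        ring
    rw [hasSum_iff_tendsto_nat_of_nonneg (fun i => by positivity)]
    simp_rw [hpartial]
    have hrem : Tendsto (fun m => t m * x ^ m) atTop (𝓝 0) :=
      squeeze_zero (fun m => mul_nonneg (ht m).1 (by positivity))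
        (fun m => mul_le_of_le_one_left (by positivity) (ht m).2.le)
        (tendsto_pow_atTop_nhds_zero_of_lt_one hx0.le hx1)
    simpa using tendsto_const_nhds.sub hrem

/-- Digit expansions in base `x`: if `0 < x < 1` and `N` is a positive integer with
`1/N ≤ x`, then every real `y ≥ 0` can be written as `y = ∑_{n ∈ ℤ} aₙ xⁿ` with
digits `aₙ ∈ {0, …, N−1}` vanishing for `n` below some `n₀`. -/
theorem exists_digit_expansion (x : ℝ) (hx0 : 0 < x) (hx1 : x < 1)
    (N : ℕ) (hN : 0 < N) (hNx : 1 / (N : ℝ) ≤ x) (y : ℝ) (hy : 0 ≤ y) :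
    ∃ (n₀ : ℤ) (a : ℤ → ℕ),
      (∀ n : ℤ, a n ≤ N - 1) ∧
      (∀ n : ℤ, n < n₀ → a n = 0) ∧
      HasSum (fun n : ℤ => (a n : ℝ) * x ^ n) y := by
  obtain ⟨k, hk⟩ : ∃ k : ℕ, x ^ k < 1 / (y + 1) :=
    exists_pow_lt_of_lt_one (by positivity) hx1
  have hz1 : y * x ^ k < 1 := by
    rw [lt_div_iff₀ (by positivity)] at hk
    nlinarith [pow_pos hx0 k]
  have hNx' : 1 / x ≤ N := (one_div_le (by exact_mod_cast hN) hx0).1 hNx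
  obtain ⟨d, hdN, hd⟩ := exists_hasSum_digits_of_lt_one hx0 hx1 hNx' (by positivity) hz1
  refine ⟨1 - k, fun n => if n < 1 - k then 0 else d (n - (1 - k)).toNat,
    fun n => ?_, fun n hn => if_pos hn, ?_⟩
  · dsimp only
    split_ifs
    · exact Nat.zero_le _
    · exact Nat.le_sub_one_of_lt (hdN _)
  · have hinj : Function.Injective (fun i : ℕ => (i : ℤ) + (1 - k)) := fun i j h => by
      simpa using h
    rw [← hinj.hasSum_iff]
    · have hd' := hd.mul_right (x ^ k)⁻¹
      rw [mul_inv_cancel_right₀ (pow_pos hx0 k).ne'] at hd'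
      refine (congrArg (HasSum · y) (funext fun i => ?_)).mpr hd'
      have hi : ¬ ((i : ℤ) + (1 - k) < 1 - k) := by omega
      have hexp : x ^ ((i : ℤ) + (1 - k)) = x ^ (i + 1) * (x ^ k)⁻¹ := by
        rw [← add_sub_assoc, zpow_sub₀ hx0.ne', div_eq_mul_inv]
        norm_cast
      simp only [Function.comp_apply, if_neg hi, add_sub_cancel_right, Int.toNat_natCast, hexp,
        mul_assoc]
    · intro n hn
      have hlt : n < 1 - k := by
        by_contra! h
        exact hn ⟨(n - (1 - k)).toNat, by dsimp only; omega⟩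
      simp [hlt]
end

section
/- Let 0 < r < 1 and c > 0. The set of all functions a : ℤ → ℤ such that ∑_{n∈F} |a(n)|·rⁿ ≤ c for every finite subset F ⊆ ℤ is a compact subset of the product space ∏_{n∈ℤ} ℤ, where ℤ carries the discrete topology and the product carries the product topology. -/
/-- For `0 < r < 1` and `c > 0`, the set of integer-valued functions `a : ℤ → ℤ`
with `∑_{n ∈ F} |aₙ|·rⁿ ≤ c` for every finite `F ⊆ ℤ` is compact in the product
space `∏_{n ∈ ℤ} ℤ` (with `ℤ` discrete and the product topology). -/
theorem isCompact_laurent_ball (r : ℝ) (hr0 : 0 < r) (hr1 : r < 1) (c : ℝ) (hc : 0 < c) :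
    IsCompact {a : ℤ → ℤ | ∀ F : Finset ℤ, (∑ n ∈ F, |(a n : ℝ)| * r ^ n) ≤ c} := by
  have hbox : IsCompact (Set.univ.pi fun n : ℤ ↦ Set.Icc (-⌊c / r ^ n⌋) ⌊c / r ^ n⌋) :=
    isCompact_univ_pi fun n ↦ (Set.finite_Icc _ _).isCompact
  refine hbox.of_isClosed_subset ?_ fun a ha n _ ↦ ?_
  · rw [Set.ofPred_forall]
    refine isClosed_iInter fun F ↦ isClosed_le (continuous_finsetSum F fun n _ ↦ ?_)
      continuous_const
    exact ((continuous_of_discreteTopology (f := fun m : ℤ ↦ |(m : ℝ)|)).comp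
      (continuous_apply n)).mul_const _
  · have hn : |(a n : ℝ)| * r ^ n ≤ c := by simpa using ha {n}
    rw [Set.mem_Icc, ← abs_le, Int.le_floor, Int.cast_abs]
    exact (le_div_iff₀ (zpow_pos hr0 n)).2 hn
end

section
/- For all real numbers s and t, one has |s·log|s| + t·log|t| − (s+t)·log|s+t|| ≤ 2·(log 2)·(|s| + |t|), where the function u ↦ u·log|u| is extended by the value 0 at u = 0 (which is automatic with the convention log 0 = 0). -/
/-- For nonnegative `a` and `b`, the function `u ↦ u * log u` is superadditive. -/
theorem mul_log_add_mul_log_le {a b : ℝ} (ha : 0 ≤ a) (hb : 0 ≤ b) :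
    a * Real.log a + b * Real.log b ≤ (a + b) * Real.log (a + b) := by
  have mul_log_le {x y : ℝ} (hx : 0 ≤ x) (hxy : x ≤ y) :
      x * Real.log x ≤ x * Real.log y := by
    rcases hx.eq_or_lt with rfl | hx
    · simp
    · gcongr
  linarith [mul_log_le ha (by linarith : a ≤ a + b), mul_log_le hb (by linarith : b ≤ a + b)]

/-- For nonnegative `a` and `b`, the superadditivity defect of `u ↦ u * log u` is at most
`log 2 * (a + b)`. -/
theorem mul_log_add_le_mul_log_add_mul_log_add {a b : ℝ} (ha : 0 ≤ a) (hb : 0 ≤ b) :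
    (a + b) * Real.log (a + b) ≤
      a * Real.log a + b * Real.log b + Real.log 2 * (a + b) := by
  rcases (add_nonneg ha hb).eq_or_lt with h | h
  · obtain rfl : a = 0 := by linarith
    obtain rfl : b = 0 := by linarith
    simp
  · have hc := Real.convexOn_mul_log.2 (Set.mem_Ici.2 ha) (Set.mem_Ici.2 hb)
      (by norm_num : (0 : ℝ) ≤ 1 / 2) (by norm_num : (0 : ℝ) ≤ 1 / 2) (by norm_num)
    simp only [smul_eq_mul] at hc
    rw [show 1 / 2 * a + 1 / 2 * b = (a + b) / 2 by ring,
      Real.log_div h.ne' two_ne_zero] at hc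
    linarith

/-- Local almost linearity of the entropy function `u ↦ u * log |u|`:
for all reals `s`, `t`,
`|s·log|s| + t·log|t| − (s+t)·log|s+t|| ≤ 2·log 2·(|s|+|t|)`. -/
theorem entropy_local_almost_linear (s t : ℝ) :
    abs (s * Real.log |s| + t * Real.log |t| - (s + t) * Real.log |s + t|) ≤
      2 * Real.log 2 * (|s| + |t|) := by
  simp only [Real.log_abs]
  have hlog : 0 < Real.log 2 := Real.log_pos one_lt_two
  have hs := mul_nonneg hlog.le (abs_nonneg s)
  have ht := mul_nonneg hlog.le (abs_nonneg t)
  have log_neg_add : Real.log (-s + -t) = Real.log (s + t) := by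
    rw [← neg_add, Real.log_neg_eq_log]
  have bounds {a b : ℝ} (ha : 0 ≤ a) (hb : 0 ≤ b) :=
    And.intro (mul_log_add_mul_log_le ha hb) (mul_log_add_le_mul_log_add_mul_log_add ha hb)
  rw [abs_le]
  rcases le_total 0 s with h₁ | h₁ <;> rcases le_total 0 t with h₂ | h₂ <;>
    simp only [abs_of_nonneg, abs_of_nonpos, h₁, h₂] at hs ht ⊢
  · have := bounds h₁ h₂
    constructor <;> linarith
  · rcases le_total 0 (s + t) with h | h
    · have := bounds h (neg_nonneg.2 h₂)
      simp only [add_neg_cancel_right, Real.log_neg_eq_log] at this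
      constructor <;> linarith
    · have := bounds (neg_nonneg.2 h) h₁
      rw [show -(s + t) + s = -t by ring] at this
      simp only [Real.log_neg_eq_log] at this
      constructor <;> linarith
  · rcases le_total 0 (s + t) with h | h
    · have := bounds h (neg_nonneg.2 h₁)
      rw [show s + t + -s = t by ring] at this
      simp only [Real.log_neg_eq_log] at this
      constructor <;> linarith
    · have := bounds (neg_nonneg.2 h) h₂
      rw [show -(s + t) + t = -s by ring] at this
      simp only [Real.log_neg_eq_log] at this
      constructor <;> linarith
  · have := bounds (neg_nonneg.2 h₁) (neg_nonneg.2 h₂)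
    simp only [Real.log_neg_eq_log, log_neg_add] at this
    constructor <;> linarith
end

section
/- Define H on finitely supported functions v : ℕ →₀ ℝ by H(v) = s·log|s| − ∑_i v(i)·log|v(i)|, where s = ∑_i v(i), and set ‖v‖₁ = ∑_i |v(i)|. Then: (i) H(a·v) = a·H(v) for all a ∈ ℝ and all v; (ii) there is a constant C > 0 such that |H(v+w) − H(v) − H(w)| ≤ C·(‖v‖₁ + ‖w‖₁) for all v, w (local almost linearity); (iii) there do NOT exist an ℝ-linear map f : (ℕ →₀ ℝ) → ℝ and a constant C' such that |f(v) − H(v)| ≤ C'·‖v‖₁ for all v (H is not globally almost linear). -/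
/-- The entropy functional on finitely supported functions `v : ℕ →₀ ℝ`:
`H(v) = s·log|s| − ∑ v(i)·log|v(i)|` where `s = ∑ v(i)`. -/
noncomputable def entropyH (v : ℕ →₀ ℝ) : ℝ :=
  (v.sum fun _ x => x) * Real.log |v.sum fun _ x => x| -
    v.sum fun _ x => x * Real.log |x|

/-- The `ℓ¹`-norm `‖v‖₁ = ∑ |v(i)|` on finitely supported functions. -/
noncomputable def l1Norm (v : ℕ →₀ ℝ) : ℝ := v.sum fun _ x => |x|

/-- The sums defining `entropyH` may be taken over any finite set containing the support. -/
theorem entropyH_eq_of_support_subset {v : ℕ →₀ ℝ} {S : Finset ℕ} (h : v.support ⊆ S) :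
    entropyH v = (∑ i ∈ S, v i) * Real.log |∑ i ∈ S, v i| - ∑ i ∈ S, v i * Real.log |v i| := by
  unfold entropyH
  rw [Finsupp.sum_of_support_subset v h _ (by simp), Finsupp.sum_of_support_subset v h _ (by simp)]

/-- The sum defining `l1Norm` may be taken over any finite set containing the support. -/
theorem l1Norm_eq_of_support_subset {v : ℕ →₀ ℝ} {S : Finset ℕ} (h : v.support ⊆ S) :
    l1Norm v = ∑ i ∈ S, |v i| :=
  Finsupp.sum_of_support_subset v h _ (by simp)

theorem mul_log_abs_mul (a x : ℝ) :
    (a * x) * Real.log |a * x| = a * Real.log |a| * x + a * (x * Real.log |x|) := by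
  rcases eq_or_ne a 0 with rfl | ha
  · simp
  rcases eq_or_ne x 0 with rfl | hx
  · simp
  rw [abs_mul, Real.log_mul (abs_ne_zero.2 ha) (abs_ne_zero.2 hx)]
  ring

theorem abs_mul_log_abs_le_one {x : ℝ} (hx : |x| ≤ 1) : |x * (Real.log |x|)| ≤ 1 := by
  rcases eq_or_ne x 0 with rfl | h
  · simp
  have := Real.abs_log_mul_self_lt |x| (abs_pos.2 h) hx
  rw [abs_mul, abs_abs] at this
  rw [abs_mul, mul_comm]
  exact this.le

/-- The function `x ↦ x log |x|` is almost additive. -/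
theorem abs_mul_log_abs_add_sub_sub_le (a b : ℝ) :
    |(a + b) * Real.log |a + b| - a * Real.log |a| - b * (Real.log |b|)| ≤ 3 * (|a| + |b|) := by
  obtain ⟨M, hM⟩ : ∃ M, M = |a| + |b| := ⟨_, rfl⟩
  rw [← hM]
  have hM0 : 0 ≤ M := hM ▸ by positivity
  rcases hM0.eq_or_lt with h | h
  · have ha : a = 0 := abs_eq_zero.1 (by linarith [abs_nonneg a, abs_nonneg b])
    have hb : b = 0 := abs_eq_zero.1 (by linarith [abs_nonneg a, abs_nonneg b])
    simp [ha, hb, hM0]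
  obtain ⟨x, rfl⟩ : ∃ x, a = M * x := ⟨a / M, by field_simp⟩
  obtain ⟨y, rfl⟩ : ∃ y, b = M * y := ⟨b / M, by field_simp⟩
  have hxy : |x| + |y| = 1 := by
    rw [abs_mul, abs_mul, abs_of_pos h, ← mul_add] at hM
    exact (mul_left_cancel₀ h.ne' (by linarith))
  have h₁ := abs_mul_log_abs_le_one (x := x) (by linarith [abs_nonneg y])
  have h₂ := abs_mul_log_abs_le_one (x := y) (by linarith [abs_nonneg x])
  have h₃ := abs_mul_log_abs_le_one (x := x + y) (hxy ▸ abs_add_le x y)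
  rw [← mul_add, mul_log_abs_mul, mul_log_abs_mul, mul_log_abs_mul]
  rw [abs_le] at *
  constructor <;> nlinarith

theorem entropyH_smul (a : ℝ) (v : ℕ →₀ ℝ) : entropyH (a • v) = a * entropyH v := by
  rw [entropyH_eq_of_support_subset (Finsupp.support_smul (b := a) (g := v)),
    entropyH_eq_of_support_subset subset_rfl]
  simp only [Finsupp.smul_apply, smul_eq_mul, mul_log_abs_mul, Finset.sum_add_distrib,
    ← Finset.mul_sum]
  ring

theorem abs_entropyH_add_sub_sub_le (v w : ℕ →₀ ℝ) :
    |entropyH (v + w) - entropyH v - entropyH w| ≤ 6 * (l1Norm v + l1Norm w) := by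
  classical
  have hv : v.support ⊆ v.support ∪ w.support := Finset.subset_union_left
  have hw : w.support ⊆ v.support ∪ w.support := Finset.subset_union_right
  rw [entropyH_eq_of_support_subset Finsupp.support_add, entropyH_eq_of_support_subset hv,
    entropyH_eq_of_support_subset hw, l1Norm_eq_of_support_subset hv,
    l1Norm_eq_of_support_subset hw]
  generalize v.support ∪ w.support = S
  have h₁ := abs_mul_log_abs_add_sub_sub_le (∑ i ∈ S, v i) (∑ i ∈ S, w i)
  have h₂ := (Finset.abs_sum_le_sum_abs _ S).trans
    (Finset.sum_le_sum fun i _ => abs_mul_log_abs_add_sub_sub_le (v i) (w i))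
  have h₃ := Finset.abs_sum_le_sum_abs v S
  have h₄ := Finset.abs_sum_le_sum_abs w S
  simp only [Finsupp.add_apply, Finset.sum_sub_distrib, ← Finset.mul_sum,
    Finset.sum_add_distrib] at h₂ ⊢
  rw [abs_le] at h₁ h₂ ⊢
  constructor <;> linarith

theorem support_sum_single_subset (n : ℕ) :
    (∑ i ∈ Finset.range n, Finsupp.single i (1 : ℝ)).support ⊆ Finset.range n := by
  intro j hj
  contrapose! hj
  simpa [Finsupp.finsetSum_apply, Finsupp.single_apply] using hj

theorem sum_single_apply_of_mem {n j : ℕ} (hj : j ∈ Finset.range n) :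
    (∑ i ∈ Finset.range n, Finsupp.single i (1 : ℝ)) j = 1 := by
  simpa [Finsupp.finsetSum_apply, Finsupp.single_apply] using hj

theorem entropyH_sum_single (n : ℕ) :
    entropyH (∑ i ∈ Finset.range n, Finsupp.single i (1 : ℝ)) = n * Real.log n := by
  rw [entropyH_eq_of_support_subset (support_sum_single_subset n),
    Finset.sum_congr rfl fun j hj => sum_single_apply_of_mem hj,
    Finset.sum_congr rfl fun j hj =>
      congrArg (fun x : ℝ => x * Real.log |x|) (sum_single_apply_of_mem hj)]
  simp

theorem l1Norm_sum_single (n : ℕ) :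
    l1Norm (∑ i ∈ Finset.range n, Finsupp.single i (1 : ℝ)) = n := by
  rw [l1Norm_eq_of_support_subset (support_sum_single_subset n),
    Finset.sum_congr rfl fun j hj => by rw [sum_single_apply_of_mem hj]]
  simp

theorem not_exists_linearMap_abs_sub_entropyH_le :
    ¬∃ (f : (ℕ →₀ ℝ) →ₗ[ℝ] ℝ) (C' : ℝ),
      ∀ v : ℕ →₀ ℝ, |f v - entropyH v| ≤ C' * l1Norm v := by
  rintro ⟨f, C, hf⟩
  have hsingle (i : ℕ) : f (Finsupp.single i 1) ≤ C := by
    have h := hf (Finsupp.single i 1)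
    simp only [entropyH, l1Norm, Finsupp.sum_single_index, abs_zero, abs_one, Real.log_zero,
      Real.log_one, mul_zero, mul_one, sub_zero] at h
    exact (le_abs_self _).trans h
  have hlog (n : ℕ) (hn : 0 < n) : Real.log n ≤ 2 * C := by
    have h := hf (∑ i ∈ Finset.range n, Finsupp.single i (1 : ℝ))
    rw [entropyH_sum_single, l1Norm_sum_single, map_sum, abs_le] at h
    have hsum : ∑ i ∈ Finset.range n, f (Finsupp.single i 1) ≤ n * C := by
      simpa using Finset.sum_le_sum fun i (_ : i ∈ Finset.range n) => hsingle i
    have hn' : (0 : ℝ) < n := by exact_mod_cast hn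
    exact le_of_mul_le_mul_left (by linarith [h.1]) hn'
  obtain ⟨n, hn, hn0⟩ := (((Real.tendsto_log_atTop.comp
    (tendsto_natCast_atTop_atTop (R := ℝ))).eventually_gt_atTop (2 * C)).and
      (Filter.eventually_gt_atTop 0)).exists
  exact (hlog n hn0).not_gt hn

/-- The entropy functional `H` is (i) homogeneous: `H(a·v) = a·H(v)`;
(ii) locally almost linear: `|H(v+w) − H(v) − H(w)| ≤ C(‖v‖₁ + ‖w‖₁)` for some
`C > 0`; but (iii) not globally almost linear: no linear functional `f` satisfies
`|f(v) − H(v)| ≤ C'·‖v‖₁` for all `v`. -/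
theorem entropy_locally_but_not_globally_almost_linear :
    (∀ (a : ℝ) (v : ℕ →₀ ℝ), entropyH (a • v) = a * entropyH v) ∧
    (∃ C : ℝ, 0 < C ∧ ∀ v w : ℕ →₀ ℝ,
      |entropyH (v + w) - entropyH v - entropyH w| ≤ C * (l1Norm v + l1Norm w)) ∧
    ¬∃ (f : (ℕ →₀ ℝ) →ₗ[ℝ] ℝ) (C' : ℝ),
      ∀ v : ℕ →₀ ℝ, |f v - entropyH v| ≤ C' * l1Norm v :=
  ⟨entropyH_smul, ⟨6, by norm_num, abs_entropyH_add_sub_sub_le⟩,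
    not_exists_linearMap_abs_sub_entropyH_le⟩
end

section
/- Let M₀, M₁, M₂, M₃ be seminormed abelian groups, and let d₀ : M₀ → M₁, d₁ : M₁ → M₂, d₂ : M₂ → M₃ be bounded additive maps with d₁ ∘ d₀ = 0 and d₂ ∘ d₁ = 0. Let C, D > 0 be constants such that: for every y ∈ M₁ with d₁(y) = 0 there is x ∈ M₀ with d₀(x) = y and ‖x‖ ≤ C·‖y‖; and for every z ∈ M₂ with d₂(z) = 0 there is y ∈ M₁ with d₁(y) = z and ‖y‖ ≤ D·‖z‖. Then, writing d̂ᵢ for the induced bounded additive maps between the completions M̂ᵢ, one has d̂₁ ∘ d̂₀ = 0, and for every ŷ ∈ M̂₁ with d̂₁(ŷ) = 0 and every ε > 0 there exists x̂ ∈ M̂₀ with d̂₀(x̂) = ŷ and ‖x̂‖ ≤ (C+ε)·‖ŷ‖. -/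
open UniformSpace

/-- Quantitative exactness passes to completions: given a four-term complex
`M₀ → M₁ → M₂ → M₃` of seminormed abelian groups and bounded additive maps in which
kernels can be lifted with norm control (constants `C` and `D`), the induced
complex of completions satisfies: for every `yhat ∈ M̂₁` killed by `d̂₁` and every
`ε > 0` there is `xhat ∈ M̂₀` with `d̂₀(xhat) = yhat` and `‖xhat‖ ≤ (C+ε)·‖yhat‖`. -/
theorem completion_of_normed_complex_exact
    (M₀ M₁ M₂ M₃ : Type*)
    [SeminormedAddCommGroup M₀] [SeminormedAddCommGroup M₁]
    [SeminormedAddCommGroup M₂] [SeminormedAddCommGroup M₃]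
    (d₀ : NormedAddGroupHom M₀ M₁) (d₁ : NormedAddGroupHom M₁ M₂)
    (d₂ : NormedAddGroupHom M₂ M₃)
    (h10 : d₁.comp d₀ = 0) (h21 : d₂.comp d₁ = 0)
    (C D : ℝ) (hC : 0 < C) (hD : 0 < D)
    (hlift₀ : ∀ y : M₁, d₁ y = 0 → ∃ x : M₀, d₀ x = y ∧ ‖x‖ ≤ C * ‖y‖)
    (hlift₁ : ∀ z : M₂, d₂ z = 0 → ∃ y : M₁, d₁ y = z ∧ ‖y‖ ≤ D * ‖z‖) :
    d₁.completion.comp d₀.completion = 0 ∧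
    ∀ yhat : Completion M₁, d₁.completion yhat = 0 → ∀ ε : ℝ, 0 < ε →
      ∃ xhat : Completion M₀, d₀.completion xhat = yhat ∧ ‖xhat‖ ≤ (C + ε) * ‖yhat‖ := by
  refine ⟨by rw [NormedAddGroupHom.completion_comp, h10, NormedAddGroupHom.zero_completion], ?_⟩
  intro yhat hy ε hε
  have hsurj : d₁.SurjectiveOnWith d₁.range D := by
    rintro _ ⟨y, rfl⟩
    exact hlift₁ _ (DFunLike.congr_fun h21 y)
  have hclosure : yhat ∈ closure
      ((NormedAddCommGroup.toCompl.comp (NormedAddGroupHom.incl d₁.ker)).range :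
        Set (Completion M₁)) := by
    rw [← NormedAddGroupHom.ker_completion hsurj]
    exact hy
  refine controlled_closure_range_of_complete
    (j := NormedAddCommGroup.toCompl.comp (NormedAddGroupHom.incl d₁.ker))
    (fun y => Completion.norm_coe (y : M₁)) hC hε ?_ yhat hclosure
  rintro ⟨y, hy⟩
  obtain ⟨x, rfl, hx⟩ := hlift₀ y hy
  exact ⟨x, d₀.completion_coe x, (Completion.norm_coe x).trans_le hx⟩
end

section
/- Fix an integer m ≥ 0 and a constant k ≥ 1, and let c₀ > 0. Let (M^•_c)_{c≥c₀} and (M'^•_c)_{c≥c₀} be admissible systems of complexes of complete normed abelian groups (in degrees 0,…,m+1), and let f^•_c : M^•_c → M'^•_c be norm-nonincreasing maps of complexes commuting with the restriction maps. Assume that for all i = 0,…,m+1, all c ≥ c₀ and all x ∈ M^i_{kc}, one has ‖res^i_{kc,c}(x)‖ ≤ k·‖f^i_{kc}(x)‖. Let N^•_c := M'^•_c / (topological closure of the image of f^•_c), equipped with the quotient norms; this is again an admissible system of complexes of complete normed abelian groups. If both (M^•_c) and (M'^•_c) are ≤k-exact in degrees ≤ m for c ≥ c₀, then (N^•_c)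 is ≤max(k⁴, k³+k+1)-exact in degrees ≤ m−1 for c ≥ c₀. -/
open Metric

/-- A system of complexes `(X^•_c)_c` of normed abelian groups (with differentials
`d` and restriction maps `res`) is `≤k`-exact in degrees `< n` for `c ≥ c₀` if for
all `c ≥ c₀` and all `x ∈ X^i_{kc}` with `i < n` there is `y ∈ X^{i−1}_c` (taken to
be `0` when `i = 0`) such that `‖res(x) − d(y)‖ ≤ k·‖d(x)‖`. -/
def SystemExactLt (X : ℝ → ℕ → Type*) [∀ c i, NormedAddCommGroup (X c i)]
    (d : ∀ c i, X c i →+ X c (i + 1))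
    (res : ∀ c' c : ℝ, ∀ i : ℕ, X c' i →+ X c i)
    (k : ℝ) (n : ℕ) (c₀ : ℝ) : Prop :=
  ∀ c : ℝ, c₀ ≤ c →
    (0 < n → ∀ x : X (k * c) 0,
      ‖res (k * c) c 0 x‖ ≤ k * ‖d (k * c) 0 x‖) ∧
    ∀ i : ℕ, i + 1 < n → ∀ x : X (k * c) (i + 1),
      ∃ y : X c i,
        ‖res (k * c) c (i + 1) x - d c i y‖ ≤ k * ‖d (k * c) (i + 1) x‖

/-- If `r` is controlled by `f` and `g ∘ r = r' ∘ f`, then `r'` maps the closure of the range of `f`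
into the range of `g`, provided the codomain of `r` is complete. -/
theorem exists_map_eq_of_mem_closure_range {G G' H H' : Type*}
    [NormedAddCommGroup G] [NormedAddCommGroup G'] [CompleteSpace G']
    [NormedAddCommGroup H] [NormedAddCommGroup H']
    (f : G →+ H) (g : G' →+ H') (r : G →+ G') (r' : H →+ H') {k : ℝ}
    (hr : ∀ x, ‖r x‖ ≤ k * ‖f x‖) (hg : ∀ x, ‖g x‖ ≤ ‖x‖) (hr' : ∀ x, ‖r' x‖ ≤ ‖x‖)
    (hcomm : ∀ x, g (r x) = r' (f x)) {y : H} (hy : y ∈ closure (Set.range f)) :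
    ∃ p, g p = r' y := by
  have hgc : Continuous g :=
    AddMonoidHomClass.continuous_of_bound g 1 fun x => by simpa using hg x
  have hrc : Continuous r' :=
    AddMonoidHomClass.continuous_of_bound r' 1 fun x => by simpa using hr' x
  obtain ⟨v, hv, hlim⟩ := mem_closure_iff_seq_limit.1 hy
  choose u hu using hv
  have hcau : CauchySeq fun n => r (u n) := by
    rw [Metric.cauchySeq_iff']
    intro ε hε
    obtain ⟨N, hN⟩ := Metric.cauchySeq_iff'.1 hlim.cauchySeq (ε / (|k| + 1)) (by positivity)
    refine ⟨N, fun n hn => ?_⟩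
    have h₁ := hN n hn
    rw [lt_div_iff₀ (by positivity), dist_eq_norm, ← hu, ← hu, ← map_sub] at h₁
    rw [dist_eq_norm, ← map_sub]
    have h₂ := hr (u n - u N)
    have h₃ := mul_le_mul_of_nonneg_right (le_abs_self k) (norm_nonneg (f (u n - u N)))
    nlinarith [norm_nonneg (f (u n - u N))]
  obtain ⟨p, hp⟩ := cauchySeq_tendsto_of_complete hcau
  refine ⟨p, tendsto_nhds_unique ((hgc.tendsto p).comp hp) ?_⟩
  refine ((hrc.tendsto y).comp hlim).congr fun n => ?_
  simp [hcomm, hu]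

/-- The normed snake lemma for systems of complexes: given admissible systems
`M^•_c`, `M'^•_c` of complete normed abelian groups with a norm-nonincreasing map
of systems of complexes `f : M → M'` satisfying
`‖res_{kc,c}(x)‖ ≤ k·‖f(x)‖` in degrees `≤ m+1`, if both `M` and `M'` are
`≤k`-exact in degrees `≤ m` for `c ≥ c₀`, then the quotient system
`N = M'/closure(im f)` (with the quotient norms, expressed below via `infDist` to
`closure (range f)`) is `≤max(k⁴, k³+k+1)`-exact in degrees `≤ m−1` for `c ≥ c₀`. -/
theorem normed_snake_lemma
    (m : ℕ) (k : ℝ) (hk : 1 ≤ k) (c₀ : ℝ) (hc₀ : 0 < c₀)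
    (M M' : ℝ → ℕ → Type)
    [∀ c i, NormedAddCommGroup (M c i)] [∀ c i, CompleteSpace (M c i)]
    [∀ c i, NormedAddCommGroup (M' c i)] [∀ c i, CompleteSpace (M' c i)]
    (dM : ∀ c i, M c i →+ M c (i + 1))
    (resM : ∀ c' c : ℝ, ∀ i : ℕ, M c' i →+ M c i)
    (dM' : ∀ c i, M' c i →+ M' c (i + 1))
    (resM' : ∀ c' c : ℝ, ∀ i : ℕ, M' c' i →+ M' c i)
    -- admissibility of M
    (hdM_norm : ∀ c i (x : M c i), ‖dM c i x‖ ≤ ‖x‖)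
    (hdM_sq : ∀ c i (x : M c i), dM c (i + 1) (dM c i x) = 0)
    (hresM_norm : ∀ c' c : ℝ, c ≤ c' → ∀ i (x : M c' i), ‖resM c' c i x‖ ≤ ‖x‖)
    (hresM_refl : ∀ c i (x : M c i), resM c c i x = x)
    (hresM_trans : ∀ c'' c' c : ℝ, c ≤ c' → c' ≤ c'' → ∀ i (x : M c'' i),
      resM c' c i (resM c'' c' i x) = resM c'' c i x)
    (hresM_d : ∀ c' c : ℝ, c ≤ c' → ∀ i (x : M c' i),
      dM c i (resM c' c i x) = resM c' c (i + 1) (dM c' i x))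
    -- admissibility of M'
    (hdM'_norm : ∀ c i (x : M' c i), ‖dM' c i x‖ ≤ ‖x‖)
    (hdM'_sq : ∀ c i (x : M' c i), dM' c (i + 1) (dM' c i x) = 0)
    (hresM'_norm : ∀ c' c : ℝ, c ≤ c' → ∀ i (x : M' c' i), ‖resM' c' c i x‖ ≤ ‖x‖)
    (hresM'_refl : ∀ c i (x : M' c i), resM' c c i x = x)
    (hresM'_trans : ∀ c'' c' c : ℝ, c ≤ c' → c' ≤ c'' → ∀ i (x : M' c'' i),
      resM' c' c i (resM' c'' c' i x) = resM' c'' c i x)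
    (hresM'_d : ∀ c' c : ℝ, c ≤ c' → ∀ i (x : M' c' i),
      dM' c i (resM' c' c i x) = resM' c' c (i + 1) (dM' c' i x))
    -- a norm-nonincreasing map of systems of complexes
    (f : ∀ c i, M c i →+ M' c i)
    (hf_norm : ∀ c i (x : M c i), ‖f c i x‖ ≤ ‖x‖)
    (hf_res : ∀ c' c : ℝ, c ≤ c' → ∀ i (x : M c' i),
      f c i (resM c' c i x) = resM' c' c i (f c' i x))
    (hf_d : ∀ c i (x : M c i), f c (i + 1) (dM c i x) = dM' c i (f c i x))
    -- the key norm estimate on f in degrees ≤ m+1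
    (hf_key : ∀ i : ℕ, i ≤ m + 1 → ∀ c : ℝ, c₀ ≤ c → ∀ x : M (k * c) i,
      ‖resM (k * c) c i x‖ ≤ k * ‖f (k * c) i x‖)
    -- exactness of M and M' in degrees ≤ m (i.e. < m+1)
    (hM_exact : SystemExactLt M dM resM k (m + 1) c₀)
    (hM'_exact : SystemExactLt M' dM' resM' k (m + 1) c₀) :
    -- conclusion: the quotient system N = M'/closure(im f) is
    -- ≤max(k⁴, k³+k+1)-exact in degrees ≤ m−1 (i.e. < m) for c ≥ c₀,
    -- where the quotient norm of the class of `z` is `infDist z (closure (range f))`.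
    ∀ K : ℝ, K = max (k ^ 4) (k ^ 3 + k + 1) →
      ∀ c : ℝ, c₀ ≤ c →
        (0 < m → ∀ x : M' (K * c) 0,
          infDist (resM' (K * c) c 0 x) (closure (Set.range ⇑(f c 0))) ≤
            K * infDist (dM' (K * c) 0 x) (closure (Set.range ⇑(f (K * c) 1)))) ∧
        ∀ i : ℕ, i + 1 < m → ∀ x : M' (K * c) (i + 1),
          ∃ y : M' c i,
            infDist (resM' (K * c) c (i + 1) x - dM' c i y)
                (closure (Set.range ⇑(f c (i + 1)))) ≤
              K * infDist (dM' (K * c) (i + 1) x)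
                (closure (Set.range ⇑(f (K * c) (i + 2)))) := by
  intro K hK c hc
  have hk0 : 0 < k := one_pos.trans_le hk
  have le_mul : ∀ {a : ℝ}, c₀ ≤ a → a ≤ k * a := fun h =>
    le_mul_of_one_le_left (hc₀.le.trans h) hk
  have h₁ : c ≤ k * c := le_mul hc
  have h₂ : k * c ≤ k * (k * c) := le_mul (hc.trans h₁)
  have h₃ : k * (k * c) ≤ k * (k * (k * c)) := le_mul (hc.trans (h₁.trans h₂))
  have h₄ : k * (k * (k * c)) ≤ k * (k * (k * (k * c))) :=
    le_mul (hc.trans (h₁.trans (h₂.trans h₃)))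
  have h₅ : k * (k * (k * (k * c))) ≤ K * c := by
    have : k ^ 4 * c ≤ K * c :=
      mul_le_mul_of_nonneg_right (hK ▸ le_max_left _ _) (hc₀.le.trans hc)
    linarith
  have hKk : k ^ 3 + k + 1 ≤ K := hK ▸ le_max_right _ _
  -- An approximate preimage of `d x` under `f` yields a correction of `x` with small differential.
  have correct : ∀ j < m, ∀ (x : M' (k * (k * (k * c))) j) (p : M (k * (k * (k * c))) (j + 1)),
      ∃ z : M (k * c) j, ‖dM' _ j (resM' _ _ j x - f _ j z)‖ ≤
        (1 + k ^ 2) * ‖dM' _ j x - f _ (j + 1) p‖ := by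
    intro j hj x p
    obtain ⟨z, hz⟩ := (hM_exact (k * c) (hc.trans h₁)).2 j (by omega)
      (resM (k * (k * (k * c))) (k * (k * c)) (j + 1) p)
    refine ⟨z, ?_⟩
    have e₁ : ‖dM (k * (k * c)) (j + 1) (resM (k * (k * (k * c))) (k * (k * c)) (j + 1) p)‖ ≤
        k * ‖dM' _ j x - f _ (j + 1) p‖ := by
      rw [hresM_d _ _ h₃]
      refine (hf_key (j + 2) (by omega) _ (hc.trans (h₁.trans h₂)) _).trans ?_
      refine mul_le_mul_of_nonneg_left ?_ hk0.le
      have := hdM'_norm _ _ (dM' _ j x - f _ (j + 1) p)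
      rwa [map_sub, hdM'_sq, zero_sub, norm_neg, ← hf_d] at this
    rw [hresM_trans _ _ _ h₂ h₃] at hz
    have e₂ : dM' _ j (resM' (k * (k * (k * c))) (k * c) j x - f _ j z) =
        resM' _ (k * c) (j + 1) (dM' _ j x - f _ (j + 1) p) +
          f _ (j + 1) (resM _ (k * c) (j + 1) p - dM _ j z) := by
      rw [map_sub, map_sub, map_sub, hf_res _ _ (h₂.trans h₃), hresM'_d _ _ (h₂.trans h₃), hf_d]
      abel
    rw [e₂]
    refine (norm_add_le _ _).trans ?_
    have e₃ := hresM'_norm _ _ (h₂.trans h₃) _ (dM' _ j x - f _ (j + 1) p)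
    have e₄ := hf_norm _ _ (resM _ (k * c) (j + 1) p - dM _ j z)
    have e₅ := mul_le_mul_of_nonneg_left e₁ hk0.le
    linarith
  have lift : ∀ j < m, ∀ x : M' (K * c) j, ∃ z : M (k * c) j,
      k * ‖dM' _ j (resM' _ _ j x - f _ j z)‖ ≤
        K * infDist (dM' _ j x) (closure (Set.range (f _ (j + 1)))) := by
    intro j hj x
    rw [infDist_closure]
    obtain ⟨D, hD⟩ : ∃ D, D = infDist (dM' _ j x) (Set.range (f (K * c) (j + 1))) := ⟨_, rfl⟩
    rw [← hD]
    have hne : (Set.range (f (K * c) (j + 1))).Nonempty := Set.range_nonempty _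
    have h₃₅ := h₄.trans h₅
    suffices h : ∃ p : M (k * (k * (k * c))) (j + 1),
        (k + k ^ 3) * ‖dM' _ j (resM' _ _ j x) - f _ (j + 1) p‖ ≤ K * D by
      obtain ⟨p, hp⟩ := h
      obtain ⟨z, hz⟩ := correct j hj (resM' _ _ j x) p
      rw [hresM'_trans _ _ _ (h₂.trans h₃) h₃₅] at hz
      refine ⟨z, (mul_le_mul_of_nonneg_left hz hk0.le).trans (le_trans (le_of_eq ?_) hp)⟩
      ring
    have hpos : 0 < k + k ^ 3 := by positivity
    rcases (hD ▸ infDist_nonneg : 0 ≤ D).eq_or_lt with h0 | h0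
    · have hmem : dM' _ j x ∈ closure (Set.range (f (K * c) (j + 1))) :=
        (mem_closure_iff_infDist_zero hne).2 (h0.trans hD).symm
      obtain ⟨p, hp⟩ := exists_map_eq_of_mem_closure_range (f (K * c) (j + 1))
        (f (k * (k * (k * c))) (j + 1)) (resM _ _ (j + 1)) (resM' _ _ (j + 1)) (k := k)
        (fun y => by
          rw [← hresM_trans _ _ _ h₄ h₅]
          refine (hf_key (j + 1) (by omega) _
            (hc.trans (h₁.trans (h₂.trans h₃))) _).trans ?_
          refine mul_le_mul_of_nonneg_left ?_ hk0.le
          rw [hf_res _ _ h₅]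
          exact hresM'_norm _ _ h₅ _ _)
        (hf_norm _ _) (hresM'_norm _ _ h₃₅ _) (hf_res _ _ h₃₅ _) hmem
      refine ⟨p, ?_⟩
      rw [hresM'_d _ _ h₃₅, hp, sub_self, norm_zero, ← h0, mul_zero, mul_zero]
    · have hlt : D < K * D / (k + k ^ 3) := by
        rw [lt_div_iff₀ hpos]
        nlinarith
      obtain ⟨_, ⟨p, rfl⟩, hp⟩ := (infDist_lt_iff hne).1 (hD.symm.trans_lt hlt)
      rw [lt_div_iff₀ hpos, dist_eq_norm] at hp
      refine ⟨resM _ _ _ p, ?_⟩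
      rw [hresM'_d _ _ h₃₅, hf_res _ _ h₃₅, ← map_sub]
      have := mul_le_mul_of_nonneg_left
        (hresM'_norm _ _ h₃₅ _ (dM' _ j x - f _ (j + 1) p)) hpos.le
      linarith
  have bound : ∀ (j : ℕ) (x : M' (K * c) j) (z : M (k * c) j) (w : M' c j),
      infDist (resM' _ c j x - w) (closure (Set.range (f c j))) ≤
        ‖resM' _ c j (resM' _ (k * c) j x - f _ j z) - w‖ := by
    intro j x z w
    refine (infDist_le_dist_of_mem (subset_closure (Set.mem_range_self (resM _ c j z)))).trans (le_of_eq ?_)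
    rw [dist_eq_norm, map_sub, hresM'_trans _ _ _ h₁ (h₂.trans (h₃.trans (h₄.trans h₅))),
      hf_res _ _ h₁, sub_right_comm]
  refine ⟨fun hm x => ?_, fun i hi x => ?_⟩
  · obtain ⟨z, hz⟩ := lift 0 hm x
    have hb := bound 0 x z 0
    rw [sub_zero, sub_zero] at hb
    exact hb.trans (((hM'_exact c hc).1 (by omega) _).trans hz)
  · obtain ⟨z, hz⟩ := lift (i + 1) hi x
    obtain ⟨y, hy⟩ := (hM'_exact c hc).2 i (by omega) (resM' _ (k * c) (i + 1) x - f _ (i + 1) z)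
    exact ⟨y, (bound (i + 1) x z _).trans (hy.trans hz)⟩
end

section
/- Fix an integer m ≥ 0 and a constant k ≥ 1. Then there exist ε > 0 and a constant k₀ ≥ k, depending only on k and m, with the following property. Let c₀ > 0, let k' ≥ k₀ and H > 0, and let (M^{p,q}_c)_{p,q≥0, c≥c₀} be an admissible system of double complexes of complete normed abelian groups, with vertical differentials d^{p,q}_c : M^{p,q}_c → M^{p+1,q}_c and horizontal differentials d'^{p,q}_c : M^{p,q}_c → M^{p,q+1}_c, such that: (1) for i = 0,…,m+1, the rows (M^{i,•}_c) are ≤k-exact in degrees ≤ m−1 for c ≥ c₀; (2) for j = 0,…,m, the columns (M^{•,j}_c) are ≤k-exact in degrees ≤ m for c ≥ c₀; (3) for q = 0,…,m and c ≥ c₀ there are additive maps h^q_{k'c} : M^{0,q+1}_{k'c} → M^{1,q}_c with ‖h^q_{k'c}(x)‖ ≤ H·‖x‖ for all x, such that for all c ≥ c₀ and q = 0,…,m the map res^{1,q}_{k'²c,k'c} ∘ d^{0,q}_{k'²c} + h^q_{k'²c} ∘ d'^{0,q}_{k'²c} + d'^{1,q−1}_{k'c} ∘ h^{q−1}_{k'²c}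 : M^{0,q}_{k'²c} → M^{1,q}_{k'c} factors as δ^{0,q}_c ∘ res^{0,q}_{k'²c,c} for maps δ^{0,q}_c : M^{0,q}_c → M^{1,q}_{k'c} which commute with the horizontal differentials in degrees ≤ m and satisfy ‖δ^{0,q}_c(x)‖ ≤ ε·‖x‖ for all x ∈ M^{0,q}_c. Then the first row (M^{0,•}_c) is ≤max(k'², 2k₀H)-exact in degrees ≤ m for c ≥ c₀. -/
/-- The compatibilities between the differentials and the restriction maps of an
admissible system of complexes. -/
structure IsAdmissibleComplex (X : ℝ → ℕ → Type*) [∀ c i, NormedAddCommGroup (X c i)]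
    (d : ∀ c i, X c i →+ X c (i + 1))
    (res : ∀ c' c : ℝ, ∀ i : ℕ, X c' i →+ X c i) : Prop where
  norm_d_le : ∀ c i (x : X c i), ‖d c i x‖ ≤ ‖x‖
  norm_res_le : ∀ c' c : ℝ, c ≤ c' → ∀ i (x : X c' i), ‖res c' c i x‖ ≤ ‖x‖
  res_res : ∀ c'' c' c : ℝ, c ≤ c' → c' ≤ c'' → ∀ i (x : X c'' i),
    res c' c i (res c'' c' i x) = res c'' c i x
  d_res : ∀ c' c : ℝ, c ≤ c' → ∀ i (x : X c' i),
    d c i (res c' c i x) = res c' c (i + 1) (d c' i x)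
  d_d : ∀ c i (x : X c i), d c (i + 1) (d c i x) = 0

/-- `x` has distance at most `B` to a boundary (to `0` in degree `0`). -/
def NearBoundary {X : ℕ → Type*} [∀ i, NormedAddCommGroup (X i)]
    (d : ∀ i, X i →+ X (i + 1)) : ∀ i, X i → ℝ → Prop
  | 0, x, B => ‖x‖ ≤ B
  | i + 1, x, B => ∃ y : X i, ‖x - d i y‖ ≤ B

namespace IsAdmissibleComplex

variable {X : ℝ → ℕ → Type*} [∀ c i, NormedAddCommGroup (X c i)]
  {d : ∀ c i, X c i →+ X c (i + 1)} {res : ∀ c' c : ℝ, ∀ i : ℕ, X c' i →+ X c i}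

theorem norm_d_le_of_nearBoundary (hX : IsAdmissibleComplex X d res) {c : ℝ} {i : ℕ}
    {x : X c i} {B : ℝ} (hx : NearBoundary (d c) i x B) : ‖d c i x‖ ≤ B := by
  cases i with
  | zero => exact (hX.norm_d_le _ _ _).trans hx
  | succ i =>
    obtain ⟨y, hy⟩ := hx
    have := hX.norm_d_le c (i + 1) (x - d c i y)
    rw [map_sub, hX.d_d, sub_zero] at this
    exact this.trans hy

theorem nearBoundary_res (hX : IsAdmissibleComplex X d res) {k c₀ c c' : ℝ} {n i : ℕ}
    (hk : 1 ≤ k) (hc₀ : 0 < c₀) (hE : SystemExactLt X d res k n c₀) (hc : c₀ ≤ c)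
    (hc' : k * c ≤ c') (hi : i < n) (x : X c' i) :
    NearBoundary (d c) i (res c' c i x) (k * ‖d c' i x‖) := by
  have hck : c ≤ k * c := le_mul_of_one_le_left (hc₀.le.trans hc) hk
  have hle : k * ‖d (k * c) i (res c' (k * c) i x)‖ ≤ k * ‖d c' i x‖ := by
    rw [hX.d_res _ _ hc']
    have := hX.norm_res_le _ _ hc' _ (d c' i x)
    gcongr
  rw [← hX.res_res _ _ _ hck hc']
  cases i with
  | zero => exact ((hE c hc).1 hi _).trans hle
  | succ i =>
    obtain ⟨y, hy⟩ := (hE c hc).2 i hi (res c' (k * c) (i + 1) x)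
    exact ⟨y, hy.trans hle⟩

theorem exists_d_eq_d_res (hX : IsAdmissibleComplex X d res) {k c₀ c c' : ℝ} {n i : ℕ}
    (hk : 1 ≤ k) (hc₀ : 0 < c₀) (hE : SystemExactLt X d res k n c₀) (hc : c₀ ≤ c)
    (hc' : k * c ≤ c') (hi : i < n) (x : X c' i) :
    ∃ t : X c i, d c i t = d c i (res c' c i x) ∧ ‖t‖ ≤ k * ‖d c' i x‖ := by
  have h := hX.nearBoundary_res hk hc₀ hE hc hc' hi x
  cases i with
  | zero => exact ⟨_, rfl, h⟩
  | succ i =>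
    obtain ⟨y, hy⟩ := h
    exact ⟨_, by rw [map_sub, hX.d_d, sub_zero], hy⟩

/-- A limit of boundaries becomes a boundary after restriction, provided that the
complex is exact one degree lower. -/
theorem exists_d_eq_res_of_forall_near (hX : IsAdmissibleComplex X d res)
    [∀ c i, CompleteSpace (X c i)] {k c₀ c c' : ℝ} {n i : ℕ}
    (hk : 1 ≤ k) (hc₀ : 0 < c₀) (hE : SystemExactLt X d res k n c₀) (hc : c₀ ≤ c)
    (hc' : k * c ≤ c') (hi : i < n) (x : X c' (i + 1))
    (hx : ∀ η : ℝ, 0 < η → ∃ w : X c' i, ‖x - d c' i w‖ ≤ η) :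
    ∃ y : X c i, d c i y = res c' c (i + 1) x := by
  have hcc' : c ≤ c' := (le_mul_of_one_le_left (hc₀.le.trans hc) hk).trans hc'
  choose w hw using fun n : ℕ => hx ((1 / 2) ^ n) (by positivity)
  choose t htd htn using fun n : ℕ =>
    hX.exists_d_eq_d_res hk hc₀ hE hc hc' hi (w (n + 1) - w n)
  have hbound (n : ℕ) : ‖t n‖ ≤ 2 * k * (1 / 2) ^ n := by
    have h1 : d c' i (w (n + 1) - w n) = (x - d c' i (w n)) - (x - d c' i (w (n + 1))) := by
      rw [map_sub]; abel
    have h2 : ‖d c' i (w (n + 1) - w n)‖ ≤ 2 * (1 / 2) ^ n := by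
      rw [h1]
      refine (norm_sub_le _ _).trans ?_
      have h3 := hw (n + 1)
      have h4 : (0 : ℝ) < (1 / 2) ^ n := by positivity
      rw [pow_succ] at h3
      linarith [hw n]
    calc ‖t n‖ ≤ k * ‖d c' i (w (n + 1) - w n)‖ := htn n
      _ ≤ k * (2 * (1 / 2) ^ n) := by gcongr
      _ = _ := by ring
  have hsum : Summable t :=
    Summable.of_norm_bounded (summable_geometric_two.mul_left (2 * k)) hbound
  have hcont : Continuous (d c i) :=
    AddMonoidHomClass.continuous_of_bound (d c i) 1 (by simpa using hX.norm_d_le c i)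
  have hpart (n : ℕ) : d c i (res c' c i (w 0) + ∑ j ∈ Finset.range n, t j) =
      res c' c (i + 1) (d c' i (w n)) := by
    induction n with
    | zero => simp [hX.d_res _ _ hcc']
    | succ n ih =>
      rw [Finset.sum_range_succ, ← add_assoc, map_add, ih, htd, hX.d_res _ _ hcc', map_sub,
        map_sub]
      abel
  have hlim : Filter.Tendsto (fun n => res c' c (i + 1) (d c' i (w n))) Filter.atTop
      (nhds (res c' c (i + 1) x)) := by
    rw [tendsto_iff_norm_sub_tendsto_zero]
    refine squeeze_zero (fun _ => norm_nonneg _) (fun n => ?_)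
      (tendsto_pow_atTop_nhds_zero_of_lt_one (r := (1 / 2 : ℝ)) (by norm_num) (by norm_num))
    rw [norm_sub_rev, ← map_sub]
    exact (hX.norm_res_le _ _ hcc' _ _).trans (hw n)
  refine ⟨res c' c i (w 0) + ∑' j, t j, tendsto_nhds_unique ?_ hlim⟩
  simp only [← hpart]
  exact (hcont.tendsto _).comp (hsum.hasSum.tendsto_sum_nat.const_add _)

end IsAdmissibleComplex

/-- The constant controlling the loss in a zigzag through `j + 1` columns. -/
def zigzagConst (k : ℝ) (j : ℕ) : ℝ := k * (2 * k ^ 2) ^ j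

theorem one_le_two_mul_sq {k : ℝ} (hk : 1 ≤ k) : 1 ≤ 2 * k ^ 2 := by nlinarith

theorem zigzagConst_mono {k : ℝ} (hk : 1 ≤ k) : Monotone (zigzagConst k) := fun i j hij => by
  have := pow_le_pow_right₀ (one_le_two_mul_sq hk) hij
  unfold zigzagConst
  gcongr

theorem le_zigzagConst {k : ℝ} (hk : 1 ≤ k) (j : ℕ) : k ≤ zigzagConst k j :=
  le_mul_of_one_le_right (by linarith) (one_le_pow₀ (one_le_two_mul_sq hk))

theorem zigzagConst_succ (k : ℝ) (j : ℕ) :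
    zigzagConst k (j + 1) = 2 * (k * (k * zigzagConst k j)) := by
  unfold zigzagConst; ring

theorem mul_one_add_le_zigzagConst_succ {k : ℝ} (hk : 1 ≤ k) (j : ℕ) :
    k * (1 + zigzagConst k j * k) ≤ zigzagConst k (j + 1) := by
  have h := le_zigzagConst hk j
  rw [zigzagConst_succ]
  have : 1 ≤ k * zigzagConst k j := by nlinarith
  nlinarith

/-- The compatibilities between the differentials and the restriction maps of an
admissible system of double complexes. -/
structure IsAdmissibleDoubleComplex (M : ℝ → ℕ → ℕ → Type*)
    [∀ c p q, NormedAddCommGroup (M c p q)]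
    (dV : ∀ c p q, M c p q →+ M c (p + 1) q) (dH : ∀ c p q, M c p q →+ M c p (q + 1))
    (res : ∀ c' c : ℝ, ∀ p q : ℕ, M c' p q →+ M c p q) : Prop where
  row : ∀ p, IsAdmissibleComplex (fun c q => M c p q) (fun c q => dH c p q)
    (fun c' c q => res c' c p q)
  col : ∀ q, IsAdmissibleComplex (fun c p => M c p q) (fun c p => dV c p q)
    (fun c' c p => res c' c p q)
  dH_dV : ∀ c p q (x : M c p q), dH c (p + 1) q (dV c p q x) = dV c p (q + 1) (dH c p q x)

namespace IsAdmissibleDoubleComplex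

variable {M : ℝ → ℕ → ℕ → Type*} [∀ c p q, NormedAddCommGroup (M c p q)]
  {dV : ∀ c p q, M c p q →+ M c (p + 1) q} {dH : ∀ c p q, M c p q →+ M c p (q + 1)}
  {res : ∀ c' c : ℝ, ∀ p q : ℕ, M c' p q →+ M c p q} {k c₀ : ℝ} {m : ℕ}

/-- The inductive step of the zigzag: an approximate lift property `hz` in bidegree
`(p + 1, j)` allows one to modify `x` in bidegree `(p, j + 1)` by a horizontal boundary
so that its vertical differential becomes small. -/
theorem exists_norm_dV_sub_le (hM : IsAdmissibleDoubleComplex M dV dH res)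
    (hk : 1 ≤ k) (hc₀ : 0 < c₀)
    (hrow : ∀ i : ℕ, i ≤ m + 1 → SystemExactLt (fun c q => M c i q) (fun c q => dH c i q)
      (fun c' c q => res c' c i q) k m c₀)
    {p j : ℕ} (hpj : p + (j + 1) ≤ m) {c c' L C : ℝ} (hc : c₀ ≤ c) (hL : 1 ≤ L) (hC : 0 ≤ C)
    (hcc' : k * (L * c) ≤ c')
    (hz : ∀ (z : M (L * c) (p + 1) j) (B : ℝ),
      NearBoundary (dH (L * c) (p + 2)) j (dV (L * c) (p + 1) j z) B →
      ∃ u : M c p j, NearBoundary (dH c (p + 1)) j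
        (res (L * c) c (p + 1) j z - dV c p j u) (C * B))
    (x : M c' p (j + 1)) (B : ℝ)
    (hx : NearBoundary (dH c' (p + 1)) (j + 1) (dV c' p (j + 1) x) B) :
    ∃ u : M c p j, ‖dV c p (j + 1) (res c' c p (j + 1) x - dH c p j u)‖ ≤ (1 + C * k) * B := by
  obtain ⟨z, hxz⟩ := hx
  have hc0 : 0 ≤ c := hc₀.le.trans hc
  have hcL : c ≤ L * c := le_mul_of_one_le_left hc0 hL
  have hLc' : L * c ≤ c' := (le_mul_of_one_le_left (hc0.trans hcL) hk).trans hcc'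
  have hdz : ‖dH c' (p + 2) j (dV c' (p + 1) j z)‖ ≤ B := by
    have h := (hM.col (j + 1)).norm_d_le c' (p + 1) (dV c' p (j + 1) x - dH c' (p + 1) j z)
    have h0 := (hM.col (j + 1)).d_d c' p x
    rw [map_sub, h0, zero_sub, norm_neg, ← hM.dH_dV] at h
    exact h.trans hxz
  have hnear := (hM.row (p + 2)).nearBoundary_res hk hc₀ (hrow (p + 2) (by omega))
    (hc.trans hcL) hcc' (i := j) (by omega) (dV c' (p + 1) j z)
  have hdres := (hM.col j).d_res _ _ hLc' (p + 1) z
  rw [← hdres] at hnear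
  obtain ⟨u, hu⟩ := hz _ _ hnear
  refine ⟨u, ?_⟩
  have hu' := (hM.row (p + 1)).norm_d_le_of_nearBoundary hu
  have hxr := (hM.row (p + 1)).d_res _ _ (hcL.trans hLc') j z
  have hxd := (hM.col (j + 1)).d_res _ _ (hcL.trans hLc') p x
  have hrr := (hM.col j).res_res _ _ _ hcL hLc' (p + 1) z
  rw [hrr] at hu'
  have hsplit : dV c p (j + 1) (res c' c p (j + 1) x - dH c p j u) =
      res c' c (p + 1) (j + 1) (dV c' p (j + 1) x - dH c' (p + 1) j z) +
        dH c (p + 1) j (res c' c (p + 1) j z - dV c p j u) := by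
    rw [map_sub, map_sub, map_sub, hxd, hxr, hM.dH_dV]
    abel
  rw [hsplit]
  have hres := (hM.row (p + 1)).norm_res_le _ _ (hcL.trans hLc') (j + 1)
    (dV c' p (j + 1) x - dH c' (p + 1) j z)
  calc _ ≤ B + C * (k * B) := by
        refine (norm_add_le _ _).trans (add_le_add (hres.trans hxz) (hu'.trans ?_))
        gcongr
    _ = _ := by ring

theorem exists_nearBoundary_res_sub (hM : IsAdmissibleDoubleComplex M dV dH res)
    (hk : 1 ≤ k) (hc₀ : 0 < c₀)
    (hrow : ∀ i : ℕ, i ≤ m + 1 → SystemExactLt (fun c q => M c i q) (fun c q => dH c i q)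
      (fun c' c q => res c' c i q) k m c₀)
    (hcol : ∀ j : ℕ, j ≤ m → SystemExactLt (fun c p => M c p j) (fun c p => dV c p j)
      (fun c' c p => res c' c p j) k (m + 1) c₀)
    (j p : ℕ) (hpj : p + 1 + j ≤ m) {c c' : ℝ} (hc : c₀ ≤ c)
    (hcc' : zigzagConst k j * c ≤ c') (x : M c' (p + 1) j) (B : ℝ)
    (hx : NearBoundary (dH c' (p + 2)) j (dV c' (p + 1) j x) B) :
    ∃ u : M c p j, NearBoundary (dH c (p + 1)) j
      (res c' c (p + 1) j x - dV c p j u) (zigzagConst k j * B) := by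
  have hc0 : 0 ≤ c := hc₀.le.trans hc
  induction j generalizing p c c' B with
  | zero =>
    have hK : zigzagConst k 0 = k := by simp [zigzagConst]
    rw [hK] at hcc' ⊢
    obtain ⟨u, hu⟩ := (hM.col 0).nearBoundary_res hk hc₀ (hcol 0 (by omega)) hc hcc'
      (i := p + 1) (by omega) x
    refine ⟨u, hu.trans ?_⟩
    have hx' : ‖dV c' (p + 1) 0 x‖ ≤ B := hx
    gcongr
  | succ j ih =>
    have hK := le_zigzagConst hk j
    have hck : c ≤ k * c := le_mul_of_one_le_left hc0 hk
    have hcc'' : k * (zigzagConst k j * (k * c)) ≤ c' := by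
      refine le_trans ?_ hcc'
      rw [zigzagConst_succ]
      have hK0 : 0 ≤ zigzagConst k j := by linarith
      have : 0 ≤ k * (k * zigzagConst k j) * c := by positivity
      linarith
    have hkc' : k * c ≤ c' := by
      refine le_trans ?_ hcc'
      gcongr
      exact le_zigzagConst hk _
    obtain ⟨u, hu⟩ := hM.exists_norm_dV_sub_le hk hc₀ hrow (p := p + 1) hpj (hc.trans hck)
      (hk.trans hK) (by linarith) hcc''
      (fun z B hz => ih (p + 1) (by omega) (hc.trans hck) le_rfl z B hz (hc0.trans hck)) x B hx
    have hB : 0 ≤ B := (norm_nonneg _).trans hx.choose_spec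
    obtain ⟨t, ht⟩ := (hM.col (j + 1)).nearBoundary_res hk hc₀ (hcol (j + 1) (by omega)) hc
      le_rfl (i := p + 1) (by omega) (res c' (k * c) (p + 1) (j + 1) x - dH (k * c) (p + 1) j u)
    refine ⟨t, res (k * c) c (p + 1) j u, ?_⟩
    have h1 := (hM.row (p + 1)).d_res _ _ hck j u
    have h2 := (hM.row (p + 1)).res_res _ _ _ hck hkc' (j + 1) x
    rw [map_sub, h2, ← h1] at ht
    rw [sub_right_comm]
    calc _ ≤ _ := ht
      _ ≤ k * ((1 + zigzagConst k j * k) * B) := by gcongr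
      _ = k * (1 + zigzagConst k j * k) * B := by ring
      _ ≤ _ := by
        gcongr
        exact mul_one_add_le_zigzagConst_succ hk j

theorem nearBoundary_res_first_row (hM : IsAdmissibleDoubleComplex M dV dH res)
    (hk : 1 ≤ k) (hc₀ : 0 < c₀)
    (hrow : ∀ i : ℕ, i ≤ m + 1 → SystemExactLt (fun c q => M c i q) (fun c q => dH c i q)
      (fun c' c q => res c' c i q) k m c₀)
    (hcol : ∀ j : ℕ, j ≤ m → SystemExactLt (fun c p => M c p j) (fun c p => dV c p j)
      (fun c' c p => res c' c p j) k (m + 1) c₀)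
    (j : ℕ) (hj : j ≤ m) {c c' : ℝ} (hc : c₀ ≤ c)
    (hcc' : zigzagConst k j * c ≤ c') (x : M c' 0 j) (B : ℝ)
    (hx : NearBoundary (dH c' 1) j (dV c' 0 j x) B) :
    NearBoundary (dH c 0) j (res c' c 0 j x) (zigzagConst k j * B) := by
  have hc0 : 0 ≤ c := hc₀.le.trans hc
  cases j with
  | zero =>
    have hK : zigzagConst k 0 = k := by simp [zigzagConst]
    rw [hK] at hcc' ⊢
    have hu := (hM.col 0).nearBoundary_res hk hc₀ (hcol 0 (by omega)) hc hcc'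
      (i := 0) (by omega) x
    refine le_trans hu ?_
    have hx' : ‖dV c' 0 0 x‖ ≤ B := hx
    gcongr
  | succ j =>
    have hK := le_zigzagConst hk j
    have hck : c ≤ k * c := le_mul_of_one_le_left hc0 hk
    have hcc'' : k * (zigzagConst k j * (k * c)) ≤ c' := by
      refine le_trans ?_ hcc'
      rw [zigzagConst_succ]
      have hK0 : 0 ≤ zigzagConst k j := by linarith
      have : 0 ≤ k * (k * zigzagConst k j) * c := by positivity
      linarith
    have hkc' : k * c ≤ c' := by
      refine le_trans ?_ hcc'
      gcongr
      exact le_zigzagConst hk _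
    obtain ⟨u, hu⟩ := hM.exists_norm_dV_sub_le hk hc₀ hrow (p := 0) (by omega) (hc.trans hck)
      (hk.trans hK) (by linarith) hcc''
      (fun z B hz => hM.exists_nearBoundary_res_sub hk hc₀ hrow hcol j 0 (by omega)
        (hc.trans hck) le_rfl z B hz) x B hx
    have hB : 0 ≤ B := (norm_nonneg _).trans hx.choose_spec
    have ht := (hM.col (j + 1)).nearBoundary_res hk hc₀ (hcol (j + 1) (by omega)) hc
      le_rfl (i := 0) (by omega) (res c' (k * c) 0 (j + 1) x - dH (k * c) 0 j u)
    refine ⟨res (k * c) c 0 j u, ?_⟩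
    have h1 := (hM.row 0).d_res _ _ hck j u
    have h2 := (hM.row 0).res_res _ _ _ hck hkc' (j + 1) x
    simp only [NearBoundary] at ht
    rw [map_sub, h2, ← h1] at ht
    calc _ ≤ _ := ht
      _ ≤ k * ((1 + zigzagConst k j * k) * B) := by gcongr
      _ = k * (1 + zigzagConst k j * k) * B := by ring
      _ ≤ _ := by
        gcongr
        exact mul_one_add_le_zigzagConst_succ hk j

end IsAdmissibleDoubleComplex

/-- The key spectral-sequence-style proposition: given `m ≥ 0` and `k ≥ 1`, there
exist `ε > 0` and `k₀ ≥ k` (depending only on `k` and `m`) such that for every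
admissible system of double complexes of complete normed abelian groups whose rows
are `≤k`-exact in degrees `≤ m−1`, whose columns are `≤k`-exact in degrees `≤ m`,
and which admits a bounded homotopy (with bound `H`) making the "homotopic map"
factor through a deep restriction with norm `≤ ε`, the first row is
`≤max(k'², 2k₀H)`-exact in degrees `≤ m` for `c ≥ c₀`. -/
theorem double_complex_first_row_exact (m : ℕ) (k : ℝ) (hk : 1 ≤ k) :
    ∃ ε : ℝ, 0 < ε ∧ ∃ k₀ : ℝ, k ≤ k₀ ∧
      ∀ (c₀ : ℝ), 0 < c₀ →
      ∀ (k' H : ℝ), k₀ ≤ k' → 0 < H →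
      ∀ (M : ℝ → ℕ → ℕ → Type)
        [∀ c p q, NormedAddCommGroup (M c p q)] [∀ c p q, CompleteSpace (M c p q)]
        (dV : ∀ c p q, M c p q →+ M c (p + 1) q)
        (dH : ∀ c p q, M c p q →+ M c p (q + 1))
        (res : ∀ c' c : ℝ, ∀ p q : ℕ, M c' p q →+ M c p q),
      -- admissibility of the system of double complexes
      (∀ c p q (x : M c p q), ‖dV c p q x‖ ≤ ‖x‖) →
      (∀ c p q (x : M c p q), ‖dH c p q x‖ ≤ ‖x‖) →
      (∀ c' c : ℝ, c ≤ c' → ∀ p q (x : M c' p q), ‖res c' c p q x‖ ≤ ‖x‖) →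
      (∀ c p q (x : M c p q), res c c p q x = x) →
      (∀ c'' c' c : ℝ, c ≤ c' → c' ≤ c'' → ∀ p q (x : M c'' p q),
        res c' c p q (res c'' c' p q x) = res c'' c p q x) →
      (∀ c' c : ℝ, c ≤ c' → ∀ p q (x : M c' p q),
        dV c p q (res c' c p q x) = res c' c (p + 1) q (dV c' p q x)) →
      (∀ c' c : ℝ, c ≤ c' → ∀ p q (x : M c' p q),
        dH c p q (res c' c p q x) = res c' c p (q + 1) (dH c' p q x)) →
      (∀ c p q (x : M c p q), dV c (p + 1) q (dV c p q x) = 0) →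
      (∀ c p q (x : M c p q), dH c p (q + 1) (dH c p q x) = 0) →
      (∀ c p q (x : M c p q),
        dH c (p + 1) q (dV c p q x) = dV c p (q + 1) (dH c p q x)) →
      -- (1) rows i = 0, …, m+1 are ≤k-exact in degrees ≤ m−1 for c ≥ c₀
      (∀ i : ℕ, i ≤ m + 1 →
        SystemExactLt (fun c q => M c i q) (fun c q => dH c i q)
          (fun c' c q => res c' c i q) k m c₀) →
      -- (2) columns j = 0, …, m are ≤k-exact in degrees ≤ m for c ≥ c₀
      (∀ j : ℕ, j ≤ m →
        SystemExactLt (fun c p => M c p j) (fun c p => dV c p j)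
          (fun c' c p => res c' c p j) k (m + 1) c₀) →
      -- (3) the homotopy h (bounded by H) and the homotopic maps δ (bounded by ε)
      ∀ (h : ∀ (c : ℝ) (q : ℕ), M (k' * c) 0 (q + 1) →+ M c 1 q)
        (δ : ∀ (c : ℝ) (q : ℕ), M c 0 q →+ M (k' * c) 1 q),
      (∀ c : ℝ, c₀ ≤ c → ∀ q : ℕ, q ≤ m → ∀ x : M (k' * c) 0 (q + 1),
        ‖h c q x‖ ≤ H * ‖x‖) →
      -- δ is a map of complexes in degrees ≤ m
      (∀ c : ℝ, c₀ ≤ c → ∀ q : ℕ, q + 1 ≤ m → ∀ x : M c 0 q,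
        dH (k' * c) 1 q (δ c q x) = δ c (q + 1) (dH c 0 q x)) →
      -- the homotopic map factors as δ ∘ res (case q = 0)
      (∀ c : ℝ, c₀ ≤ c → ∀ x : M (k' * (k' * c)) 0 0,
        res (k' * (k' * c)) (k' * c) 1 0 (dV (k' * (k' * c)) 0 0 x) +
            h (k' * c) 0 (dH (k' * (k' * c)) 0 0 x) =
          δ c 0 (res (k' * (k' * c)) c 0 0 x)) →
      -- the homotopic map factors as δ ∘ res (case q = q'+1 ≤ m)
      (∀ c : ℝ, c₀ ≤ c → ∀ q : ℕ, q + 1 ≤ m → ∀ x : M (k' * (k' * c)) 0 (q + 1),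
        res (k' * (k' * c)) (k' * c) 1 (q + 1) (dV (k' * (k' * c)) 0 (q + 1) x) +
            h (k' * c) (q + 1) (dH (k' * (k' * c)) 0 (q + 1) x) +
            dH (k' * c) 1 q (h (k' * c) q x) =
          δ c (q + 1) (res (k' * (k' * c)) c 0 (q + 1) x)) →
      -- the norm estimate on the homotopic maps δ
      (∀ c : ℝ, c₀ ≤ c → ∀ q : ℕ, q ≤ m → ∀ x : M c 0 q,
        ‖δ c q x‖ ≤ ε * ‖x‖) →
      -- conclusion: the first row is ≤max(k'², 2k₀H)-exact in degrees ≤ m for c ≥ c₀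
      SystemExactLt (fun c q => M c 0 q) (fun c q => dH c 0 q)
        (fun c' c q => res c' c 0 q) (max (k' ^ 2) (2 * k₀ * H)) (m + 1) c₀ := by
  have hK : k ≤ zigzagConst k m := le_zigzagConst hk m
  have hK0 : 0 < zigzagConst k m := by linarith
  refine ⟨1 / (2 * zigzagConst k m), by positivity, 2 * k * zigzagConst k m, by nlinarith, ?_⟩
  intro c₀ hc₀ k' H hk' hH M _ _ dV dH res hVn hHn hRn _ hRR hVR hHR hVV hHH hHV hrow hcol h δ
    hh hδ hom0 homS hδn
  have hM : IsAdmissibleDoubleComplex M dV dH res :=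
    { row := fun p => ⟨fun c q => hHn c p q, fun c' c hc q => hRn c' c hc p q,
        fun c'' c' c h1 h2 q => hRR c'' c' c h1 h2 p q, fun c' c hc q => hHR c' c hc p q,
        fun c q => hHH c p q⟩
      col := fun q => ⟨fun c p => hVn c p q, fun c' c hc p => hRn c' c hc p q,
        fun c'' c' c h1 h2 p => hRR c'' c' c h1 h2 p q, fun c' c hc p => hVR c' c hc p q,
        fun c p => hVV c p q⟩
      dH_dV := hHV }
  have hkK : k * zigzagConst k m ≤ k' := by nlinarith
  have hk'1 : 1 ≤ k' := by nlinarith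
  intro c hc
  have hc0 : 0 < c := hc₀.trans_le hc
  have hck : c ≤ k * c := le_mul_of_one_le_left hc0.le hk
  have hck' : c ≤ k' * c := le_mul_of_one_le_left hc0.le hk'1
  have hk'k' : k' * c ≤ k' * (k' * c) := le_mul_of_one_le_left (by positivity) hk'1
  have hkck' : zigzagConst k m * (k * c) ≤ k' * c := by
    rw [← mul_assoc, mul_comm (zigzagConst k m)]
    gcongr
  have hkc' : k * c ≤ k' * c := le_trans
    (le_mul_of_one_le_left (by positivity) (hk.trans hK)) hkck'
  have hC : k' * (k' * c) ≤ max (k' ^ 2) (2 * (2 * k * zigzagConst k m) * H) * c := by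
    rw [← mul_assoc, ← sq]
    gcongr
    exact le_max_left _ _
  have hconst : 2 * (2 * k * zigzagConst k m) * H ≤
    max (k' ^ 2) (2 * (2 * k * zigzagConst k m) * H) := le_max_right _ _
  have hKH : zigzagConst k m ≤ k * zigzagConst k m := le_mul_of_one_le_left hK0.le hk
  refine ⟨fun _ x₀ => ?_, fun i hi x₀ => ?_⟩
  · simp only at x₀ ⊢
    set x := res _ (k' * (k' * c)) 0 0 x₀ with hxdef
    rw [← hRR _ _ _ (hck'.trans hk'k') hC, ← hxdef]
    have hdx : ‖dH _ 0 0 x‖ ≤ ‖dH _ 0 0 x₀‖ := by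
      rw [hxdef, hHR _ _ hC]; exact hRn _ _ hC _ _ _
    have h1 := hom0 c hc x
    have h2 := (hM.col 0).nearBoundary_res hk hc₀ (hcol 0 (by omega)) hc hkc' (i := 0)
      (by omega) (res _ (k' * c) 0 0 x)
    simp only [NearBoundary] at h2
    rw [hRR _ _ _ hck' hk'k', hVR _ _ hk'k', eq_sub_of_add_eq h1] at h2
    have h3 := hδn c hc 0 (by omega) (res _ c 0 0 x)
    have h4 := hh (k' * c) (hc.trans hck') 0 (by omega) (dH _ 0 0 x)
    have h5 := h2.trans (mul_le_mul_of_nonneg_left (norm_sub_le _ _) (by linarith))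
    set r := ‖res (k' * (k' * c)) c 0 0 x‖
    have h6 : k * (1 / (2 * zigzagConst k m) * r) ≤ r / 2 := by
      have : k * (1 / (2 * zigzagConst k m)) ≤ 1 / 2 := by
        rw [mul_one_div, div_le_div_iff₀ (by positivity) (by norm_num)]; linarith
      nlinarith [norm_nonneg (res (k' * (k' * c)) c 0 0 x)]
    have h7 : r ≤ 2 * k * (H * ‖dH _ 0 0 x‖) := by nlinarith
    calc r ≤ 2 * k * (H * ‖dH _ 0 0 x₀‖) := h7.trans (by gcongr)
      _ = (2 * k * H) * ‖dH _ 0 0 x₀‖ := by ring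
      _ ≤ _ := by
        gcongr
        refine le_trans ?_ hconst
        gcongr
        nlinarith
  · simp only at x₀ ⊢
    set x := res _ (k' * (k' * c)) 0 (i + 1) x₀ with hxdef
    rw [← hRR _ _ _ (hck'.trans hk'k') hC, ← hxdef]
    have hdx : ‖dH _ 0 (i + 1) x‖ ≤ ‖dH _ 0 (i + 1) x₀‖ := by
      rw [hxdef, hHR _ _ hC]; exact hRn _ _ hC _ _ _
    have step (y : M c 0 i) : ∃ w : M (k * c) 0 i,
        ‖res _ (k * c) 0 (i + 1) x - dH _ 0 i w‖ ≤
          ‖res _ c 0 (i + 1) x - dH c 0 i y‖ / 2 +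
            zigzagConst k m * (H * ‖dH _ 0 (i + 1) x‖) := by
      have h1 := homS c hc i (by omega) x
      have hnear : NearBoundary (dH (k' * c) 1) (i + 1)
          (dV (k' * c) 0 (i + 1) (res _ (k' * c) 0 (i + 1) x))
          (1 / (2 * zigzagConst k m) * ‖res _ c 0 (i + 1) x - dH c 0 i y‖ +
            H * ‖dH _ 0 (i + 1) x‖) := by
        refine ⟨δ c i y - h (k' * c) i x, ?_⟩
        have h2 : dV (k' * c) 0 (i + 1) (res _ (k' * c) 0 (i + 1) x) -
            dH (k' * c) 1 i (δ c i y - h (k' * c) i x) =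
            δ c (i + 1) (res _ c 0 (i + 1) x - dH c 0 i y) -
              h (k' * c) (i + 1) (dH _ 0 (i + 1) x) := by
          rw [hVR _ _ hk'k', map_sub, map_sub, hδ c hc i (by omega), ← h1]
          abel
        rw [h2]
        exact (norm_sub_le _ _).trans (add_le_add (hδn c hc _ (by omega) _)
          (hh _ (hc.trans hck') _ (by omega) _))
      have hmono : zigzagConst k (i + 1) ≤ zigzagConst k m := zigzagConst_mono hk (by omega)
      obtain ⟨w, hw⟩ := hM.nearBoundary_res_first_row hk hc₀ hrow hcol (i + 1) (by omega)
        (hc.trans hck) ((mul_le_mul_of_nonneg_right hmono (by positivity)).trans hkck') _ _ hnear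
      refine ⟨w, ?_⟩
      rw [hRR _ _ _ hkc' hk'k'] at hw
      refine hw.trans ((mul_le_mul_of_nonneg_right hmono (by positivity)).trans_eq ?_)
      field_simp
    have approx (n : ℕ) : ∃ w : M (k * c) 0 i,
        ‖res _ (k * c) 0 (i + 1) x - dH _ 0 i w‖ ≤
          (1 / 2) ^ n * ‖x‖ + 2 * zigzagConst k m * (H * ‖dH _ 0 (i + 1) x‖) := by
      induction n with
      | zero =>
        refine ⟨0, ?_⟩
        rw [map_zero, sub_zero, pow_zero, one_mul]
        exact (hRn _ _ (hkc'.trans hk'k') _ _ _).trans (le_add_of_nonneg_right (by positivity))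
      | succ n ih =>
        obtain ⟨w, hw⟩ := ih
        obtain ⟨v, hv⟩ := step (res _ c 0 i w)
        refine ⟨v, hv.trans ?_⟩
        have h1 := hRn _ _ hck _ _ (res _ (k * c) 0 (i + 1) x - dH _ 0 i w)
        rw [map_sub, hRR _ _ _ hck (hkc'.trans hk'k'), ← hHR _ _ hck] at h1
        rw [pow_succ]
        linarith
    have small (η : ℝ) (hη : 0 < η) : ∃ n : ℕ, (1 / 2) ^ n * ‖x‖ ≤ η := by
      obtain ⟨n, hn⟩ := exists_pow_lt_of_lt_one (div_pos hη (by positivity : 0 < ‖x‖ + 1))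
        (by norm_num : (1 / 2 : ℝ) < 1)
      refine ⟨n, ?_⟩
      rw [lt_div_iff₀ (by positivity)] at hn
      have : (0 : ℝ) < (1 / 2) ^ n := by positivity
      linarith
    have hxr : res (k * c) c 0 (i + 1) (res _ (k * c) 0 (i + 1) x) = res _ c 0 (i + 1) x :=
      hRR _ _ _ hck (hkc'.trans hk'k') _ _ _
    rcases (norm_nonneg (dH _ 0 (i + 1) x)).eq_or_lt with h0 | h0
    · obtain ⟨y, hy⟩ := (hM.row 0).exists_d_eq_res_of_forall_near hk hc₀ (hrow 0 (by omega)) hc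
        le_rfl (i := i) (by omega) (res _ (k * c) 0 (i + 1) x) (fun η hη => by
          obtain ⟨n, hn⟩ := small η hη
          obtain ⟨w, hw⟩ := approx n
          rw [← h0, mul_zero, mul_zero, add_zero] at hw
          exact ⟨w, hw.trans hn⟩)
      refine ⟨y, ?_⟩
      rw [hy, hxr, sub_self, norm_zero]
      exact mul_nonneg (le_trans (by positivity) hconst) (norm_nonneg _)
    · obtain ⟨n, hn⟩ := small (2 * zigzagConst k m * (H * ‖dH _ 0 (i + 1) x‖)) (by positivity)
      obtain ⟨w, hw⟩ := approx n
      refine ⟨res _ c 0 i w, ?_⟩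
      have h1 := hRn _ _ hck _ _ (res _ (k * c) 0 (i + 1) x - dH _ 0 i w)
      rw [map_sub, hxr, ← hHR _ _ hck] at h1
      calc _ ≤ _ := h1.trans hw
        _ ≤ 2 * (2 * zigzagConst k m) * H * ‖dH _ 0 (i + 1) x‖ := by linarith
        _ ≤ 2 * (2 * (k * zigzagConst k m)) * H * ‖dH _ 0 (i + 1) x₀‖ := by gcongr
        _ ≤ _ := by
          rw [← mul_assoc 2 k]
          gcongr
end

section
/- Let Λ be a finite free abelian group (a finitely generated free ℤ-module), let N be a positive integer, and let λ₁, …, λ_m ∈ Λ be finitely many elements. Then there is a finite subset A of the dual Λ^∨ = Hom(Λ, ℤ) such that for every x ∈ Λ^∨ there exists x' ∈ A with: (i) x − x' ∈ N·Λ^∨ (i.e., x − x' = N·y for some y ∈ Λ^∨); and (ii) for each i = 1, …, m, the integers x'(λᵢ) and (x − x')(λᵢ) have the same sign, i.e. x'(λᵢ)·(x(λᵢ) − x'(λᵢ)) ≥ 0. -/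
/-- In a well-quasi-order, finitely many elements suffice to lie below every element. -/
theorem WellQuasiOrdered.exists_finset_forall_exists {α : Type*} {r : α → α → Prop}
    (h : WellQuasiOrdered r) : ∃ s : Finset α, ∀ x, ∃ a ∈ s, r a x := by
  by_contra! hs
  obtain ⟨f, -, hf⟩ := exists_seq_of_forall_finset_exists (fun _ : α ↦ True)
    (fun a x ↦ ¬ r a x) fun s _ ↦ (hs s).imp fun _ hx ↦ ⟨trivial, hx⟩
  obtain ⟨i, j, hij, hr⟩ := h f
  exact hf i j hij hr

/-- If the positive and negative parts of `a` are at most those of `b`, then `a` and `b - a`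
have the same sign. -/
theorem Int.mul_sub_nonneg_of_toNat_le {a b : ℤ} (hpos : a.toNat ≤ b.toNat)
    (hneg : (-a).toNat ≤ (-b).toNat) : 0 ≤ a * (b - a) := by
  rcases lt_trichotomy a 0 with h | rfl | h
  · exact mul_nonneg_of_nonpos_of_nonpos h.le (by omega)
  · simp
  · exact mul_nonneg h.le (by omega)

/-- A linear functional whose values on a basis are divisible by `n` is divisible by `n`. -/
theorem Module.Basis.exists_eq_smul_of_forall_dvd {ι M : Type*} [AddCommGroup M]
    (b : Module.Basis ι ℤ M) {n : ℤ} {f : M →ₗ[ℤ] ℤ} (h : ∀ i, n ∣ f (b i)) :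
    ∃ g : M →ₗ[ℤ] ℤ, f = n • g := by
  choose c hc using h
  exact ⟨b.constr ℤ c, b.ext fun i ↦ by simp [hc]⟩


/-- Let `Λ` be a finite free abelian group, `N` a positive integer and
`λ₁, …, λ_m ∈ Λ`. Then there is a finite subset `A` of the dual `Λ^∨ = Hom(Λ, ℤ)`
such that every `x ∈ Λ^∨` can be written as `x = x' + N·y` with `x' ∈ A`,
`y ∈ Λ^∨`, in such a way that `x'(λᵢ)` and `(x − x')(λᵢ)` have the same sign for
every `i`. -/
theorem exists_finite_set_decomposition_same_sign
    (Λ : Type*) [AddCommGroup Λ] [Module.Free ℤ Λ] [Module.Finite ℤ Λ]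
    (N : ℕ) (hN : 0 < N) (m : ℕ) (lam : Fin m → Λ) :
    ∃ A : Set (Λ →ₗ[ℤ] ℤ), A.Finite ∧
      ∀ x : Λ →ₗ[ℤ] ℤ, ∃ x' ∈ A,
        (∃ y : Λ →ₗ[ℤ] ℤ, x - x' = (N : ℤ) • y) ∧
        ∀ i : Fin m, 0 ≤ x' (lam i) * (x (lam i) - x' (lam i)) := by
  have : NeZero N := ⟨hN.ne'⟩
  let b := Module.Free.chooseBasis ℤ Λ
  let residues : (Λ →ₗ[ℤ] ℤ) → (Module.Free.ChooseBasisIndex ℤ Λ → ZMod N) :=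
    fun x i ↦ (x (b i) : ZMod N)
  let parts : (Λ →ₗ[ℤ] ℤ) → (Fin m → ℕ × ℕ) :=
    fun x i ↦ ((x (lam i)).toNat, (-x (lam i)).toNat)
  have hwqo : WellQuasiOrdered
      fun x' x ↦ residues x' = residues x ∧ parts x' ≤ parts x := fun f ↦
    ((Finite.wellQuasiOrdered (· = ·)).prod wellQuasiOrdered_le)
      fun n ↦ (residues (f n), parts (f n))
  obtain ⟨A, hA⟩ := hwqo.exists_finset_forall_exists
  refine ⟨A, A.finite_toSet, fun x ↦ ?_⟩
  obtain ⟨x', hx', hres, hparts⟩ := hA x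
  refine ⟨x', hx', b.exists_eq_smul_of_forall_dvd fun i ↦ ?_, fun i ↦
    Int.mul_sub_nonneg_of_toNat_le (hparts i).1 (hparts i).2⟩
  exact (ZMod.intCast_eq_intCast_iff_dvd_sub _ _ N).1 (congrFun hres i)
end
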